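/- Let r divide q^n - 1, let k be a non-negative integer and g in P_k. Let d be a divisor of R and {p_1, ..., p_l} the set of remaining distinct primes dividing R; let h be a monic divisor of x^n - 1 and {h_1, ..., h_m} the set of remaining distinct monic irreducible factors of x^n - 1; let H be a monic divisor of G and {H_1, ..., H_{m'}} the set of remaining distinct monic irreducible factors of G. Define D := 1 - Σ_{i=1}^{m} 1/q^{deg(h_i)} - Σ_{i=1}^{l} 1/p_i - Σ_{i=1}^{m'} 1/q^{deg(H_i)} and S := (m + l + m' - 1)/D + 2. If D > 0 and q^{n/2 - ϑ} > 2·r·rad(r)·W(h)·W(d)·W(H)·S, where ϑ = 2k if gcd(q, n) = 1 and ϑ = 3k otherwise, then N_{r,k,g}(x^n - 1, R, G) > 0. -/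

import Mathlib

open Polynomial UniqueFactorizationMonoid
open scoped Classical

noncomputable section

/-- The action `h ∘ β = Σ_i a_i β^{q^i}` of a polynomial `h = Σ_i a_i x^i` over `F_q`
on an element `β` of an extension field. -/
def polyAct {Fq F : Type*} [Field Fq] [Field F] [Algebra Fq F]
    (q : ℕ) (h : Fq[X]) (β : F) : F :=
  h.sum fun i a => algebraMap Fq F a * β ^ q ^ i

/-- `h` is the `F_q`-order of `β`: the monic divisor of `x^n - 1` of least degree
annihilating `β`. -/
def IsFqOrder {Fq F : Type*} [Field Fq] [Field F] [Algebra Fq F]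
    (q n : ℕ) (h : Fq[X]) (β : F) : Prop :=
  h.Monic ∧ h ∣ (X ^ n - 1 : Fq[X]) ∧ polyAct q h β = 0 ∧
    ∀ h' : Fq[X], h'.Monic → h' ∣ (X ^ n - 1 : Fq[X]) → polyAct q h' β = 0 →
      h.natDegree ≤ h'.natDegree

/-- `α` is `k`-normal over `F_q`: its `F_q`-order has degree `n - k`. -/
def IsKNormal (Fq : Type*) {F : Type*} [Field Fq] [Field F] [Algebra Fq F]
    (q n k : ℕ) (α : F) : Prop :=
  ∃ h : Fq[X], IsFqOrder q n h α ∧ h.natDegree = n - k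

/-- `β` is `h`-free: `gcd(h, (x^n - 1)/Ord_q(β)) = 1`. -/
def IsPolyFree {Fq F : Type*} [Field Fq] [Field F] [Algebra Fq F]
    (q n : ℕ) (h : Fq[X]) (β : F) : Prop :=
  ∃ f : Fq[X], IsFqOrder q n f β ∧ IsCoprime h ((X ^ n - 1 : Fq[X]) / f)

/-- `rad(m)`: product of the distinct primes dividing `m`. -/
def radN (m : ℕ) : ℕ := ∏ p ∈ m.primeFactors, p

/-- `W(m)`: number of squarefree divisors of `m`. -/
def Wnat (m : ℕ) : ℕ := (m.divisors.filter Squarefree).card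

/-- `rad(f)`: product of the distinct monic irreducible factors of `f`. -/
def radPoly {Fq : Type*} [Field Fq] (f : Fq[X]) : Fq[X] :=
  (normalizedFactors f).toFinset.prod id

/-- `W(f)`: number of monic squarefree divisors of `f`. -/
def Wpoly {Fq : Type*} [Field Fq] (f : Fq[X]) : ℕ :=
  {g : Fq[X] | g.Monic ∧ Squarefree g ∧ g ∣ f}.ncard

/-- The primes `p_1, …, p_s` in the decomposition `r = u·p_1^{b_1}···p_s^{b_s}`:
primes `p ∣ r` such that `p^{b_p + 1} ∣ M` where `b_p` is the multiplicity of `p`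
in `r` (here `M = q^n - 1`). -/
def rBadPrimes (r M : ℕ) : Finset ℕ :=
  r.primeFactors.filter fun p => p ^ (r.factorization p + 1) ∣ M

/-- `Q_r^d`: the set of `α ∈ F_{q^n}^*` that are `d`-free, are `r`-th powers, but are
not `λ_j = p_j^{b_j+1}`-th powers for any of the primes `p_j` in the decomposition
of `r`. -/
def QSet (F : Type*) [Field F] (q n r d : ℕ) : Set F :=
  {α | α ≠ 0 ∧ Nat.gcd d ((q ^ n - 1) / orderOf α) = 1 ∧
    (∃ β : F, β ^ r = α) ∧
    ∀ p ∈ rBadPrimes r (q ^ n - 1), ∀ β : F, β ^ p ^ (r.factorization p + 1) ≠ α}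

/-- The irreducible factors `f_1, …, f_t` in the decomposition
`g = π·f_1^{b_1}···f_t^{b_t}`: monic irreducible `f ∣ g` with `f^{b_f + 1} ∣ M`
where `b_f` is the multiplicity of `f` in `g` (here `M = x^n - 1`). -/
def gBadFactors {Fq : Type*} [Field Fq] (g M : Fq[X]) : Finset (Fq[X]) :=
  (normalizedFactors g).toFinset.filter
    fun f => f ^ ((normalizedFactors g).count f + 1) ∣ M

/-- `T_{g,k}^H`: the set of `α ∈ F_{q^n}` that are `H`-free, of the form `g∘β`, but
not of the form `Λ_i∘β` for `Λ_i = f_i^{b_i+1}`. -/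
def TSet {Fq : Type*} (F : Type*) [Field Fq] [Field F] [Algebra Fq F]
    (q n : ℕ) (g H : Fq[X]) : Set F :=
  {α | IsPolyFree q n H α ∧ (∃ β : F, polyAct q g β = α) ∧
    ∀ f ∈ gBadFactors g (X ^ n - 1 : Fq[X]), ∀ β : F,
      polyAct q (f ^ ((normalizedFactors g).count f + 1)) β ≠ α}

/-- `N_{r,k,g}(h, d, H)`: the number of `β ∈ F_{q^n}` such that `β` is `h`-free,
`g∘β ∈ Q_r^d` and `(g∘β)⁻¹ ∈ T_{g,k}^H`. -/
def Ncnt {Fq : Type*} (F : Type*) [Field Fq] [Field F] [Algebra Fq F]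
    (q n r : ℕ) (g h : Fq[X]) (d : ℕ) (H : Fq[X]) : ℕ :=
  {β : F | IsPolyFree q n h β ∧ polyAct q g β ∈ QSet F q n r d ∧
    (polyAct q g β)⁻¹ ∈ TSet F q n g H}.ncard

lemma mixed_radix_injective {Q q1 e0 I : ℕ} (hQ : 2 ≤ Q) (he : e0 * (Q - 1) + 1 = Q * q1)
    (hI : I * (Q - 1) ≤ q1) {i j k l i' j' k' l' : ℕ} (hi : i < I) (hi' : i' < I)
    (hj : j < Q - 1) (hj' : j' < Q - 1) (hk : k < Q) (hk' : k' < Q)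
    (heq : i + e0 * j + k * q1 + l * (Q * q1) = i' + e0 * j' + k' * q1 + l' * (Q * q1)) :
    i = i' ∧ j = j' ∧ k = k' ∧ l = l' := by
  obtain ⟨P, rfl⟩ : ∃ P, Q = P + 1 := ⟨Q - 1, by omega⟩
  simp only [Nat.add_sub_cancel] at *
  zify at *
  have h1 : (q1 : ℤ) * (((P + 1) * j + P * k + P * (P + 1) * l)
      - ((P + 1) * j' + P * k' + P * (P + 1) * l')) = (P * i' - j') - (P * i - j) := by
    linear_combination P * heq - (j - j') * he
  have hb1 : (P : ℤ) * i' ≤ P * (I - 1) := by gcongr; omega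
  have hb2 : (P : ℤ) * i ≤ P * (I - 1) := by gcongr; omega
  have hp1 : (0 : ℤ) ≤ P * i' := by positivity
  have hp2 : (0 : ℤ) ≤ P * i := by positivity
  have h2 : ((P * i' - j') - (P * i - j) : ℤ) = 0 := by
    refine Int.eq_zero_of_abs_lt_dvd (Dvd.intro _ h1) ?_
    rw [abs_lt]
    constructor <;> nlinarith
  have hq1 : (q1 : ℤ) ≠ 0 := by
    rintro h
    rw [h] at he
    nlinarith [mul_nonneg (Nat.cast_nonneg (α := ℤ) e0) (Nat.cast_nonneg (α := ℤ) P)]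
  have hB := (mul_eq_zero.1 (h1.trans h2)).resolve_left hq1
  have hjj : (j : ℤ) - j' = 0 := by
    refine Int.eq_zero_of_abs_lt_dvd (m := P)
      ⟨-(j + k + (P + 1) * l) + (j' + k' + (P + 1) * l'), ?_⟩ ?_
    · linear_combination hB
    · rw [abs_lt]; constructor <;> linarith
  have hkk : (k : ℤ) - k' = 0 := by
    refine Int.eq_zero_of_abs_lt_dvd (m := P + 1) ⟨j + k + P * l - (j' + k' + P * l'), ?_⟩ ?_
    · linear_combination -hB
    · rw [abs_lt]; constructor <;> linarith
  have hP : (P : ℤ) ≠ 0 := by linarith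
  have hll : (l : ℤ) - l' = 0 := by
    have : (P : ℤ) * (P + 1) * (l - l') = 0 := by linear_combination hB - (P + 1) * hjj - P * hkk
    rcases mul_eq_zero.1 this with h | h
    · exfalso; have := mul_ne_zero hP (show (P : ℤ) + 1 ≠ 0 by positivity); exact this h
    · exact h
  have hii : (i : ℤ) - i' = 0 := by
    have : (P : ℤ) * (i - i') = 0 := by linear_combination -h2 + hjj
    exact (mul_eq_zero.1 this).resolve_left hP
  refine ⟨?_, ?_, ?_, ?_⟩ <;> linarith

section Stepanov

variable {E : Type*} [Field E]

/-- The half trace `Σ_{i ≤ m} (a x^{Q^i} + b x^{-Q^i})`, multiplied by `x^{Q^m}`. -/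
def halfTrace (Q m : ℕ) (a b : E) : E[X] :=
  ∑ i ∈ Finset.range (m + 1), (C a * X ^ (Q ^ m + Q ^ i) + C b * X ^ (Q ^ m - Q ^ i))

lemma degree_halfTrace {Q m : ℕ} (hQ : 2 ≤ Q) {a : E} (b : E) (ha : a ≠ 0) :
    (halfTrace Q m a b).degree = (2 * Q ^ m : ℕ) := by
  have hpos : 0 < Q ^ m := by positivity
  rw [halfTrace, Finset.sum_range_succ, ← two_mul, add_comm, add_assoc]
  rw [degree_add_eq_left_of_degree_lt]
  · rw [degree_C_mul_X_pow _ ha]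
  · rw [degree_C_mul_X_pow _ ha]
    refine (degree_add_le _ _).trans_lt (max_lt ?_ ?_)
    · refine (degree_C_mul_X_pow_le _ _).trans_lt ?_
      exact_mod_cast (by omega : Q ^ m - Q ^ m < 2 * Q ^ m)
    · refine (degree_sum_le _ _).trans_lt ((Finset.sup_lt_iff (WithBot.bot_lt_coe _)).2 ?_)
      intro i hi
      have : Q ^ i < Q ^ m := Nat.pow_lt_pow_right (by omega) (Finset.mem_range.1 hi)
      refine (degree_add_le _ _).trans_lt (max_lt ?_ ?_)
      · refine (degree_C_mul_X_pow_le _ _).trans_lt ?_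
        exact_mod_cast (by omega : Q ^ m + Q ^ i < 2 * Q ^ m)
      · refine (degree_C_mul_X_pow_le _ _).trans_lt ?_
        exact_mod_cast (by omega : Q ^ m - Q ^ i < 2 * Q ^ m)

lemma eval_halfTrace {Q m : ℕ} (hQ : 2 ≤ Q) (a b : E) {x : E} (hx : x ≠ 0) :
    (halfTrace Q m a b).eval x = x ^ Q ^ m *
      ∑ i ∈ Finset.range (m + 1), (a * x ^ Q ^ i + b * x⁻¹ ^ Q ^ i) := by
  rw [halfTrace, eval_finsetSum, Finset.mul_sum]
  refine Finset.sum_congr rfl fun i hi => ?_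
  have : Q ^ i ≤ Q ^ m := Nat.pow_le_pow_right (by omega) (by simpa [Nat.lt_succ_iff] using hi)
  simp only [eval_add, eval_mul, eval_C, eval_pow, eval_X]
  rw [pow_sub₀ _ hx this, pow_add]
  ring

/-- The auxiliary monomials whose combinations vanish at the points to be counted. -/
def stepanovMono (Q m e0 : ℕ) (a b : E) (t : ℕ × ℕ × ℕ × ℕ) : E[X] :=
  X ^ (t.1 + e0 * t.2.1 + (Q - t.2.2.1) * Q ^ m + t.2.2.2 * (Q * Q ^ m)) *
    halfTrace Q m a b ^ t.2.2.1

/-- The Frobenius twists of the auxiliary monomials, reduced at the points to be counted. -/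
def stepanovDual (Q m e0 : ℕ) (a b ζ c : E) (t : ℕ × ℕ × ℕ × ℕ) : E[X] :=
  C (ζ ^ t.2.1) * X ^ (e0 * (Q - 1 - t.2.1) + (Q - t.2.2.1) * Q ^ m
    + t.1 * (Q * Q ^ m) + t.2.2.2 + 1) * (C c * X ^ Q ^ m - halfTrace Q m a b) ^ t.2.2.1

/-- The index set of the auxiliary monomials. -/
def stepanovIndex (Q I L : ℕ) : Finset (ℕ × ℕ × ℕ × ℕ) :=
  Finset.range I ×ˢ Finset.range (Q - 1) ×ˢ Finset.range Q ×ˢ Finset.range L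

lemma degree_stepanovMono {Q m e0 : ℕ} (hQ : 2 ≤ Q) {a : E} (b : E) (ha : a ≠ 0)
    {t : ℕ × ℕ × ℕ × ℕ} (ht : t.2.2.1 < Q) :
    (stepanovMono Q m e0 a b t).degree =
      (t.1 + e0 * t.2.1 + t.2.2.1 * Q ^ m + t.2.2.2 * (Q * Q ^ m) + Q * Q ^ m : ℕ) := by
  obtain ⟨s, hs⟩ : ∃ s, Q = t.2.2.1 + s := ⟨Q - t.2.2.1, by omega⟩
  rw [stepanovMono, degree_mul, degree_pow, degree_X, degree_pow, degree_halfTrace hQ b ha]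
  simp only [nsmul_eq_mul, mul_one]
  norm_cast
  rw [show Q - t.2.2.1 = s by omega]
  generalize Q ^ m = y
  rw [hs]
  ring

lemma eval_stepanovMono_pow {Q m e0 p s : ℕ} [Fact p.Prime] [CharP E p] (hQ : 2 ≤ Q)
    (hQp : Q = p ^ s) {a b ζ c x : E} (ha : a ^ Q = a)
    (hb : b ^ Q = b) (hx : x ≠ 0) (hxc : x ^ (Q ^ (2 * (m + 1))) = x)
    (hζ : x ^ (e0 * (1 + Q ^ (m + 1))) = ζ)
    (hc : ∑ i ∈ Finset.range (2 * (m + 1)), (a * x ^ Q ^ i + b * x⁻¹ ^ Q ^ i) = c)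
    {t : ℕ × ℕ × ℕ × ℕ} (ht1 : t.2.1 < Q - 1) (ht : t.2.2.1 < Q) :
    (stepanovDual Q m e0 a b ζ c t).eval x =
      (stepanovMono Q m e0 a b t).eval x ^ Q ^ (m + 1) * x ^ (e0 * (Q - 1) + Q ^ (m + 1)) := by
  obtain ⟨i, j, k, l⟩ := t
  simp only at ht1 ht
  set v := ∑ i ∈ Finset.range (m + 1), (a * x ^ Q ^ i + b * x⁻¹ ^ Q ^ i) with hv
  have hpow : ∀ z : E, z ^ Q = z → ∀ n, z ^ Q ^ n = z := by
    intro z hz n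
    induction n with
    | zero => simp
    | succ n ih => rw [pow_succ, pow_mul, ih, hz]
  have hvc : v ^ Q ^ (m + 1) = c - v := by
    have : v ^ Q ^ (m + 1) = ∑ i ∈ Finset.range (m + 1),
        (a * x ^ Q ^ (m + 1 + i) + b * x⁻¹ ^ Q ^ (m + 1 + i)) := by
      have h1 : Q ^ (m + 1) = p ^ (s * (m + 1)) := by rw [hQp, pow_mul]
      rw [hv, h1, sum_pow_char_pow]
      refine Finset.sum_congr rfl fun i _ => ?_
      rw [add_pow_char_pow, ← h1, mul_pow, mul_pow, hpow a ha, hpow b hb, ← pow_mul, ← pow_mul,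
        ← pow_add, add_comm i]
    have hsplit := Finset.sum_range_add (fun i => a * x ^ Q ^ i + b * x⁻¹ ^ Q ^ i) (m + 1) (m + 1)
    rw [← two_mul, hc] at hsplit
    rw [this, hsplit, add_sub_cancel_left]
  have hq : Q * Q ^ m = Q ^ (m + 1) := (pow_succ' Q m).symm
  have hevm : (stepanovMono Q m e0 a b (i, j, k, l)).eval x =
      x ^ (i + e0 * j + (l + 1) * Q ^ (m + 1)) * v ^ k := by
    simp only [stepanovMono, eval_mul, eval_pow, eval_X, eval_halfTrace hQ a b hx, ← hv]
    rw [mul_pow, ← mul_assoc, ← pow_mul, ← pow_add]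
    congr 2
    obtain ⟨s, hs⟩ : ∃ s, Q = k + s := ⟨Q - k, by omega⟩
    rw [show Q - k = s by omega, ← hq]
    generalize Q ^ m = y
    rw [hs]
    ring
  have hevd : (stepanovDual Q m e0 a b ζ c (i, j, k, l)).eval x =
      ζ ^ j * x ^ (e0 * (Q - 1 - j) + (i + 1) * Q ^ (m + 1) + l + 1) * (c - v) ^ k := by
    simp only [stepanovDual, eval_mul, eval_pow, eval_X, eval_sub, eval_C,
      eval_halfTrace hQ a b hx, ← hv]
    rw [show c * x ^ Q ^ m - x ^ Q ^ m * v = x ^ Q ^ m * (c - v) by ring, mul_pow, ← mul_assoc,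
      mul_assoc (ζ ^ j), ← pow_mul, ← pow_add]
    congr 3
    obtain ⟨s, hs⟩ : ∃ s, Q = k + s := ⟨Q - k, by omega⟩
    rw [show Q - k = s by omega, ← hq]
    generalize Q ^ m = y
    generalize e0 * (Q - 1 - j) = z
    rw [hs]
    ring
  rw [hevm, hevd, mul_pow, ← pow_mul v, mul_comm k, pow_mul v, hvc, ← hζ, ← pow_mul, ← pow_add]
  have hl : x ^ ((l + 1) * Q ^ (m + 1) * Q ^ (m + 1)) = x ^ (l + 1) := by
    rw [mul_assoc, ← pow_add, ← two_mul, mul_comm, pow_mul, hxc]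
  obtain ⟨s, hs⟩ : ∃ s, Q - 1 = j + s := ⟨Q - 1 - j, by omega⟩
  rw [show Q - 1 - j = s by omega, hs]
  rw [← pow_mul, mul_right_comm (x ^ _), ← pow_add]
  congr 1
  generalize Q ^ (m + 1) = y at *
  rw [show (i + e0 * j + (l + 1) * y) * y + (e0 * (j + s) + y)
    = ((l + 1) * y * y) + ((i + e0 * j) * y + (e0 * (j + s) + y)) by ring,
    pow_add x ((l + 1) * y * y), hl, ← pow_add]
  congr 1
  ring

lemma natDegree_stepanovDual_lt {Q m e0 I L : ℕ} (hQ : 2 ≤ Q)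
    (he : e0 * (Q - 1) + 1 = Q * Q ^ m) {a : E} (b ζ c : E) (ha : a ≠ 0)
    {t : ℕ × ℕ × ℕ × ℕ} (ht : t ∈ stepanovIndex Q I L) :
    stepanovDual Q m e0 a b ζ c t ∈ degreeLT E ((I + 2) * Q ^ (m + 1) + L) := by
  simp only [stepanovIndex, Finset.mem_product, Finset.mem_range] at ht
  obtain ⟨h1, h2, h3, h4⟩ := ht
  have hv : (halfTrace Q m a b).natDegree = 2 * Q ^ m :=
    natDegree_eq_of_degree_eq_some (degree_halfTrace hQ b ha)
  have hw : (C c * X ^ Q ^ m - halfTrace Q m a b).natDegree ≤ 2 * Q ^ m := by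
    refine (natDegree_sub_le _ _).trans (max_le ?_ hv.le)
    exact (natDegree_C_mul_X_pow_le _ _).trans (by omega)
  have hdeg : (stepanovDual Q m e0 a b ζ c t).natDegree ≤ (e0 * (Q - 1 - t.2.1) +
      (Q - t.2.2.1) * Q ^ m + t.1 * (Q * Q ^ m) + t.2.2.2 + 1) + t.2.2.1 * (2 * Q ^ m) := by
    refine natDegree_mul_le.trans (add_le_add ?_ ?_)
    · exact natDegree_C_mul_X_pow_le _ _
    · exact natDegree_pow_le.trans (Nat.mul_le_mul_left _ hw)
  rw [mem_degreeLT]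
  refine degree_le_natDegree.trans_lt ?_
  norm_cast
  refine hdeg.trans_lt ?_
  have e1 : e0 * (Q - 1 - t.2.1) ≤ e0 * (Q - 1) := Nat.mul_le_mul_left _ (by omega)
  have e2 : t.1 * (Q * Q ^ m) + Q * Q ^ m ≤ I * (Q * Q ^ m) := by
    rw [← Nat.succ_mul]; exact Nat.mul_le_mul_right _ h1
  have e3 : (Q - t.2.2.1) * Q ^ m + t.2.2.1 * Q ^ m = Q * Q ^ m := by
    rw [← add_mul]; congr 1; omega
  have e4 : t.2.2.1 * Q ^ m ≤ Q * Q ^ m := Nat.mul_le_mul_right _ h3.le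
  rw [pow_succ', add_mul]
  have e5 : t.2.2.1 * (2 * Q ^ m) = 2 * (t.2.2.1 * Q ^ m) := by ring
  omega

lemma sum_stepanovMono_ne_zero {Q m e0 I L : ℕ} (hQ : 2 ≤ Q)
    (he : e0 * (Q - 1) + 1 = Q * Q ^ m) (hI : I * (Q - 1) ≤ Q ^ m) {a : E} (b : E) (ha : a ≠ 0)
    {d : stepanovIndex Q I L → E} (hd : d ≠ 0) :
    ∑ t, C (d t) * stepanovMono Q m e0 a b t ≠ 0 := by
  obtain ⟨t0, ht0⟩ := Function.ne_iff.1 hd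
  have hdeg : ∀ t : stepanovIndex Q I L, d t ≠ 0 → (C (d t) * stepanovMono Q m e0 a b t).degree =
      (t.1.1 + e0 * t.1.2.1 + t.1.2.2.1 * Q ^ m + t.1.2.2.2 * (Q * Q ^ m) + Q * Q ^ m : ℕ) := by
    rintro ⟨t, ht⟩ hdt
    simp only [stepanovIndex, Finset.mem_product, Finset.mem_range] at ht
    rw [degree_mul, degree_C hdt, zero_add, degree_stepanovMono hQ b ha ht.2.2.1]
  intro h0
  have hsum := degree_sum_eq_of_disjoint (fun t => C (d t) * stepanovMono Q m e0 a b t)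
    Finset.univ ?_
  · rw [h0, degree_zero] at hsum
    have := Finset.le_sup (f := fun t => (C (d t) * stepanovMono Q m e0 a b t).degree)
      (Finset.mem_univ t0)
    rw [← hsum, hdeg t0 ht0] at this
    exact absurd this (not_le.2 (WithBot.bot_lt_coe _))
  · rintro ⟨t, ht⟩ hdt ⟨t', ht'⟩ hdt' hne heq
    refine hne ?_
    have h1 : d ⟨t, ht⟩ ≠ 0 := fun h => hdt.2 (by simp [h])
    have h2 : d ⟨t', ht'⟩ ≠ 0 := fun h => hdt'.2 (by simp [h])
    simp only [Function.comp_apply] at heq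
    rw [hdeg _ h1, hdeg _ h2] at heq
    norm_cast at heq
    simp only [stepanovIndex, Finset.mem_product, Finset.mem_range] at ht ht'
    obtain ⟨e1, e2, e3, e4⟩ := mixed_radix_injective hQ he hI ht.1 ht'.1 ht.2.1 ht'.2.1 ht.2.2.1
      ht'.2.2.1 (Nat.add_right_cancel heq)
    ext <;> assumption

lemma natDegree_sum_stepanovMono_le {Q m e0 I L : ℕ} (hQ : 2 ≤ Q)
    (he : e0 * (Q - 1) + 1 = Q * Q ^ m) (hI : I * (Q - 1) ≤ Q ^ m) {a : E} (b : E) (ha : a ≠ 0)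
    (d : stepanovIndex Q I L → E) :
    (∑ t, C (d t) * stepanovMono Q m e0 a b t).natDegree ≤ (L + 3) * Q ^ (m + 1) := by
  refine natDegree_sum_le_of_forall_le _ _ ?_
  rintro ⟨t, ht⟩ -
  simp only [stepanovIndex, Finset.mem_product, Finset.mem_range] at ht
  obtain ⟨h1, h2, h3, h4⟩ := ht
  refine (natDegree_C_mul_le _ _).trans ?_
  rw [natDegree_eq_of_degree_eq_some (degree_stepanovMono hQ b ha h3), pow_succ', add_mul]
  have e1 : e0 * t.2.1 ≤ e0 * (Q - 1) := Nat.mul_le_mul_left _ (by omega)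
  have e2 : t.2.2.2 * (Q * Q ^ m) + Q * Q ^ m ≤ L * (Q * Q ^ m) := by
    rw [← Nat.succ_mul]; exact Nat.mul_le_mul_right _ h4
  have e4 : t.2.2.1 * Q ^ m ≤ Q * Q ^ m := Nat.mul_le_mul_right _ h3.le
  have e5 : I ≤ I * (Q - 1) := Nat.le_mul_of_pos_right _ (by omega)
  have e6 : Q ^ m ≤ Q * Q ^ m := Nat.le_mul_of_pos_left _ (by omega)
  omega

/-- Stepanov's bound for the number of points with prescribed norm and prescribed
trace of `a x + b / x`. -/
theorem stepanov_card_le [Fintype E] {Q m e0 p s I L : ℕ} [Fact p.Prime] [CharP E p] (hQ : 2 ≤ Q)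
    (hQp : Q = p ^ s) (hcard : Fintype.card E = Q ^ (2 * (m + 1)))
    (he : e0 * (Q - 1) + 1 = Q * Q ^ m) (hI : I * (Q - 1) ≤ Q ^ m)
    (hL : (I + 2) * Q ^ (m + 1) + L < I * (Q - 1) * Q * L) {a b : E} (ζ c : E) (ha0 : a ≠ 0)
    (ha : a ^ Q = a) (hb : b ^ Q = b) (Z : Finset E)
    (hZ : ∀ x ∈ Z, x ≠ 0 ∧ x ^ (e0 * (1 + Q ^ (m + 1))) = ζ ∧
      ∑ i ∈ Finset.range (2 * (m + 1)), (a * x ^ Q ^ i + b * x⁻¹ ^ Q ^ i) = c) :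
    Z.card ≤ (L + 3) * Q ^ (m + 1) := by
  set N := (I + 2) * Q ^ (m + 1) + L with hN
  let Φ : (stepanovIndex Q I L → E) → E[X] :=
    fun d => ∑ t, C (d t ^ Q ^ (m + 1)) * stepanovDual Q m e0 a b ζ c t
  have hsub : ∀ y z : E, (y - z) ^ Q ^ (m + 1) = y ^ Q ^ (m + 1) - z ^ Q ^ (m + 1) := by
    intro y z
    rw [hQp, ← pow_mul, sub_pow_char_pow]
  have hΦsub : ∀ d d', Φ (d - d') = Φ d - Φ d' := by
    intro d d'
    simp only [Φ, ← Finset.sum_sub_distrib, Pi.sub_apply, hsub, C_sub, sub_mul]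
  have hΦmem : ∀ d, Φ d ∈ degreeLT E N := by
    intro d
    refine Submodule.sum_mem _ fun t _ => ?_
    rw [← smul_eq_C_mul]
    exact Submodule.smul_mem _ _ (natDegree_stepanovDual_lt hQ he b ζ c ha0 t.2)
  obtain ⟨d, hd0, hd⟩ : ∃ d, d ≠ 0 ∧ Φ d = 0 := by
    have hlt : Fintype.card (Fin N → E) < Fintype.card (stepanovIndex Q I L → E) := by
      rw [Fintype.card_fun, Fintype.card_fun, Fintype.card_fin]
      refine Nat.pow_lt_pow_right Fintype.one_lt_card ?_
      rw [Fintype.card_coe, stepanovIndex]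
      simp only [Finset.card_product, Finset.card_range]
      calc N < I * (Q - 1) * Q * L := hL
        _ = _ := by ring
    obtain ⟨d, d', hne, heq⟩ := Fintype.exists_ne_map_eq_of_card_lt
      (fun d (i : Fin N) => (Φ d).coeff i) hlt
    refine ⟨d - d', sub_ne_zero.2 hne, ?_⟩
    ext i
    rw [coeff_zero]
    by_cases hi : i < N
    · rw [hΦsub, coeff_sub, sub_eq_zero]
      exact congrFun heq ⟨i, hi⟩
    · refine coeff_eq_zero_of_degree_lt ((mem_degreeLT.1 (hΦmem _)).trans_le ?_)
      exact_mod_cast not_lt.1 hi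
  set G := ∑ t, C (d t) * stepanovMono Q m e0 a b t with hG
  have hG0 : G ≠ 0 := sum_stepanovMono_ne_zero hQ he hI b ha0 hd0
  refine le_trans ?_ (natDegree_sum_stepanovMono_le hQ he hI b ha0 d)
  refine card_le_degree_of_subset_roots fun x hx => ?_
  obtain ⟨hx0, hxζ, hxc⟩ := hZ x hx
  rw [mem_roots hG0, IsRoot.def]
  have hfix : x ^ Q ^ (2 * (m + 1)) = x := by rw [← hcard]; exact FiniteField.pow_card x
  have key : (Φ d).eval x = G.eval x ^ Q ^ (m + 1) * x ^ (e0 * (Q - 1) + Q ^ (m + 1)) := by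
    have h1 : Q ^ (m + 1) = p ^ (s * (m + 1)) := by rw [hQp, pow_mul]
    have h2 : G.eval x ^ Q ^ (m + 1) = ∑ t, (d t) ^ Q ^ (m + 1) *
        (stepanovMono Q m e0 a b t).eval x ^ Q ^ (m + 1) := by
      rw [hG, eval_finsetSum, h1, sum_pow_char_pow]
      simp only [eval_mul, eval_C, mul_pow]
    rw [h2, Finset.sum_mul]
    simp only [Φ, eval_finsetSum, eval_mul, eval_C]
    refine Finset.sum_congr rfl fun t _ => ?_
    obtain ⟨t, ht⟩ := t
    simp only [stepanovIndex, Finset.mem_product, Finset.mem_range] at ht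
    rw [eval_stepanovMono_pow hQ hQp ha hb hx0 hfix hxζ hxc ht.2.1 ht.2.2.1, mul_assoc]
  rw [hd, eval_zero] at key
  exact pow_eq_zero_iff (by positivity) |>.1
    ((mul_eq_zero.1 key.symm).resolve_right (pow_ne_zero _ hx0))

lemma exists_stepanov_parameters {Q m : ℕ} (hQ : 2 ≤ Q) (hm : 1 ≤ m) :
    ∃ I, I * (Q - 1) ≤ Q ^ m ∧ (I + 2) * Q ^ (m + 1) + (Q ^ (m + 1) / (Q * (Q - 1)) + 14) <
      I * (Q - 1) * Q * (Q ^ (m + 1) / (Q * (Q - 1)) + 14) := by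
  have h1 := Nat.div_add_mod (Q ^ m) (Q - 1)
  have h2 := Nat.mod_lt (Q ^ m) (show 0 < Q - 1 by omega)
  set I := Q ^ m / (Q - 1) with hI
  have hQm : Q ≤ Q ^ m := Nat.le_self_pow (by omega) Q
  have hI1 : 1 ≤ I := by rw [hI, Nat.one_le_div_iff (by omega)]; omega
  have hI2 : Q - 1 ≤ (Q - 1) * I := Nat.le_mul_of_pos_right _ hI1
  have hI3 : Q ^ m < 2 * ((Q - 1) * I) := by omega
  refine ⟨I, by rw [mul_comm]; omega, ?_⟩
  have hq0 : Q ^ (m + 1) = Q * Q ^ m := pow_succ' Q m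
  have hT : 2 ≤ Q * (Q - 1) := by nlinarith [Nat.sub_add_cancel (show 1 ≤ Q by omega)]
  have h3 := Nat.div_add_mod (Q ^ (m + 1)) (Q * (Q - 1))
  have h4 := Nat.mod_lt (Q ^ (m + 1)) (show 0 < Q * (Q - 1) by omega)
  have h5 : Q ^ (m + 1) / (Q * (Q - 1)) ≤ Q ^ (m + 1) / 2 := Nat.div_le_div_left hT (by norm_num)
  set L := Q ^ (m + 1) / (Q * (Q - 1)) with hL
  have h6 : Q ^ (m + 1) < 2 * (I * (Q * (Q - 1))) := by
    calc Q ^ (m + 1) = Q * Q ^ m := hq0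
      _ < Q * (2 * ((Q - 1) * I)) := by gcongr
      _ = _ := by ring
  have h7 : 4 ≤ Q ^ (m + 1) := by rw [hq0]; nlinarith
  set T := Q * (Q - 1) with hTd
  have h8 : I * (Q - 1) * Q = I * T := by rw [hTd]; ring
  rw [h8]
  have h9 : I * Q ^ (m + 1) + 13 * (I * T) ≤ I * T * (L + 14) := by
    have : I * Q ^ (m + 1) ≤ I * (T * L + T) := Nat.mul_le_mul_left _ (by omega)
    nlinarith
  have h10 : (I + 2) * Q ^ (m + 1) = I * Q ^ (m + 1) + 2 * Q ^ (m + 1) := by ring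
  omega

/-- The upper half of the equidistribution of norm and trace of `a x + b / x`. -/
theorem stepanov_card_le_real [Fintype E] {Q m e0 p s : ℕ} [Fact p.Prime] [CharP E p]
    (hQ : 2 ≤ Q) (hm : 1 ≤ m) (hQp : Q = p ^ s) (hcard : Fintype.card E = Q ^ (2 * (m + 1)))
    (he : e0 * (Q - 1) + 1 = Q * Q ^ m) {a b : E} (ζ c : E) (ha0 : a ≠ 0)
    (ha : a ^ Q = a) (hb : b ^ Q = b) (Z : Finset E)
    (hZ : ∀ x ∈ Z, x ≠ 0 ∧ x ^ (e0 * (1 + Q ^ (m + 1))) = ζ ∧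
      ∑ i ∈ Finset.range (2 * (m + 1)), (a * x ^ Q ^ i + b * x⁻¹ ^ Q ^ i) = c) :
    (Z.card : ℝ) ≤ (Q : ℝ) ^ (2 * (m + 1)) / (Q * (Q - 1)) + 17 * (Q : ℝ) ^ (m + 1) := by
  obtain ⟨I, hI, hL⟩ := exists_stepanov_parameters hQ hm
  have h := stepanov_card_le hQ hQp hcard he hI hL ζ c ha0 ha hb Z hZ
  have h' : (Z.card : ℝ) ≤ ((Q ^ (m + 1) / (Q * (Q - 1)) : ℕ) + 14 + 3) * (Q : ℝ) ^ (m + 1) := by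
    exact_mod_cast h
  have h2 : ((Q ^ (m + 1) / (Q * (Q - 1)) : ℕ) : ℝ) ≤ (Q : ℝ) ^ (m + 1) / (Q * (Q - 1)) := by
    refine Nat.cast_div_le.trans_eq ?_
    push_cast [Nat.cast_sub (show 1 ≤ Q by omega)]
    rfl
  calc (Z.card : ℝ) ≤ _ := h'
    _ ≤ ((Q : ℝ) ^ (m + 1) / (Q * (Q - 1)) + 14 + 3) * (Q : ℝ) ^ (m + 1) := by gcongr
    _ = _ := by rw [two_mul, pow_add]; ring

end Stepanov

section LFunction

variable {F : Type*} [Field F]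

/-- The completely multiplicative function on monic polynomials attached to the Kloosterman sum
`∑ χ(x) ψ(ax + b/x)`. -/
def kloostermanWeight (χ : MulChar F ℂ) (ψ : AddChar F ℂ) (a b : F) (f : F[X]) : ℂ :=
  χ ((-1) ^ f.natDegree * f.coeff 0) * ψ (-(a * f.nextCoeff) - b * (f.coeff 1 / f.coeff 0))

lemma kloostermanWeight_mul (χ : MulChar F ℂ) (ψ : AddChar F ℂ) (a b : F) {f g : F[X]}
    (hf : f.Monic) (hg : g.Monic) :
    kloostermanWeight χ ψ a b (f * g) =
      kloostermanWeight χ ψ a b f * kloostermanWeight χ ψ a b g := by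
  unfold kloostermanWeight
  by_cases hf0 : f.coeff 0 = 0
  · simp [mul_coeff_zero, hf0, MulChar.map_zero χ]
  by_cases hg0 : g.coeff 0 = 0
  · simp [mul_coeff_zero, hg0, MulChar.map_zero χ]
  have h1 : (-1 : F) ^ (f * g).natDegree * (f * g).coeff 0 =
      ((-1) ^ f.natDegree * f.coeff 0) * ((-1) ^ g.natDegree * g.coeff 0) := by
    rw [hf.natDegree_mul hg, mul_coeff_zero, pow_add]; ring
  have h2 : -(a * (f * g).nextCoeff) - b * ((f * g).coeff 1 / (f * g).coeff 0) =
      (-(a * f.nextCoeff) - b * (f.coeff 1 / f.coeff 0)) +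
      (-(a * g.nextCoeff) - b * (g.coeff 1 / g.coeff 0)) := by
    rw [hf.nextCoeff_mul hg, mul_coeff_zero, mul_coeff_one]
    field_simp
    ring
  rw [h1, h2, map_mul, AddChar.map_add_eq_mul]
  ring

lemma kloostermanWeight_one (χ : MulChar F ℂ) (ψ : AddChar F ℂ) (a b : F) :
    kloostermanWeight χ ψ a b 1 = 1 := by
  simp [kloostermanWeight, nextCoeff, coeff_one]

lemma kloostermanWeight_pow (χ : MulChar F ℂ) (ψ : AddChar F ℂ) (a b : F) {f : F[X]}
    (hf : f.Monic) (k : ℕ) :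
    kloostermanWeight χ ψ a b (f ^ k) = kloostermanWeight χ ψ a b f ^ k := by
  induction k with
  | zero => simp [kloostermanWeight_one]
  | succ k ih => rw [pow_succ, kloostermanWeight_mul _ _ _ _ (hf.pow k) hf, ih, pow_succ]

lemma exists_map_mul_ne_one {ψ : AddChar F ℂ} (hψ : ψ ≠ 1) {a : F} (ha : a ≠ 0) :
    ∃ t, ψ (a * t) ≠ 1 := by
  obtain ⟨y, hy⟩ := AddChar.ne_one_iff.1 hψ
  exact ⟨a⁻¹ * y, by rwa [mul_inv_cancel_left₀ ha]⟩

variable [Finite F]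

lemma finite_monic_natDegree_eq (m : ℕ) : {f : F[X] | f.Monic ∧ f.natDegree = m}.Finite := by
  have : Finite ({f : F[X] | f.Monic ∧ f.natDegree = m} : Set F[X]) :=
    Finite.of_equiv _ ((monicEquivDegreeLT m).trans (degreeLTEquiv F m).toEquiv).symm
  exact Set.toFinite {f : F[X] | f.Monic ∧ f.natDegree = m}

variable (F) in
/-- The monic polynomials of degree `m` over a finite field. -/
def monicsOfDegree (m : ℕ) : Finset F[X] := (finite_monic_natDegree_eq m).toFinset

lemma mem_monicsOfDegree {m : ℕ} {f : F[X]} :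
    f ∈ monicsOfDegree F m ↔ f.Monic ∧ f.natDegree = m := by
  simp [monicsOfDegree]

/-- The coefficients of the `L`-function attached to a Kloosterman sum. -/
def lCoeff (χ : MulChar F ℂ) (ψ : AddChar F ℂ) (a b : F) (m : ℕ) : ℂ :=
  ∑ f ∈ monicsOfDegree F m, kloostermanWeight χ ψ a b f

lemma lCoeff_zero (χ : MulChar F ℂ) (ψ : AddChar F ℂ) (a b : F) : lCoeff χ ψ a b 0 = 1 := by
  have : monicsOfDegree F 0 = {1} := by
    ext f
    simp only [mem_monicsOfDegree, Finset.mem_singleton]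
    constructor
    · rintro ⟨h1, h2⟩; exact eq_one_of_monic_natDegree_zero h1 h2
    · rintro rfl; simp
  rw [lCoeff, this, Finset.sum_singleton, kloostermanWeight_one]

lemma lCoeff_one [Fintype F] (χ : MulChar F ℂ) (ψ : AddChar F ℂ) (a b : F) :
    lCoeff χ ψ a b 1 = ∑ x : F, χ x * ψ (a * x + b * x⁻¹) := by
  symm
  refine Finset.sum_bij (fun x _ => X - C x) ?_ ?_ ?_ ?_
  · intro x _; exact mem_monicsOfDegree.2 ⟨monic_X_sub_C x, natDegree_X_sub_C x⟩
  · intro x _ y _ h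
    simpa using h
  · intro f hf
    obtain ⟨hm, hd⟩ := mem_monicsOfDegree.1 hf
    refine ⟨-f.coeff 0, Finset.mem_univ _, ?_⟩
    have := hm.eq_X_add_C hd
    rw [this]; simp
  · intro x _
    simp only [kloostermanWeight, natDegree_X_sub_C, nextCoeff_X_sub_C]
    simp [coeff_X, coeff_C, div_eq_mul_inv, inv_neg]

lemma lCoeff_eq_zero (χ : MulChar F ℂ) {ψ : AddChar F ℂ} (hψ : ψ ≠ 1) {a : F} (ha : a ≠ 0)
    (b : F) {m : ℕ} (hm : 3 ≤ m) : lCoeff χ ψ a b m = 0 := by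
  obtain ⟨t, ht⟩ := exists_map_mul_ne_one hψ (neg_ne_zero.2 ha)
  have hdeg : ∀ s : F, (C s * X ^ (m - 1) : F[X]).degree < m := fun s =>
    (degree_C_mul_X_pow_le _ _).trans_lt (by exact_mod_cast (by omega : m - 1 < m))
  have key : ∀ s : F, ∀ f ∈ monicsOfDegree F m, f + C s * X ^ (m - 1) ∈ monicsOfDegree F m := by
    intro s f hf
    obtain ⟨h1, h2⟩ := mem_monicsOfDegree.1 hf
    have hd : (C s * X ^ (m - 1) : F[X]).degree < f.degree := by
      rw [degree_eq_natDegree h1.ne_zero, h2]; exact hdeg s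
    exact mem_monicsOfDegree.2 ⟨h1.add_of_left hd,
      by rw [natDegree_add_eq_left_of_degree_lt hd, h2]⟩
  have h : lCoeff χ ψ a b m = ψ (-a * t) * lCoeff χ ψ a b m := by
    conv_lhs => rw [lCoeff]
    rw [lCoeff, Finset.mul_sum]
    symm
    refine Finset.sum_bij (fun f _ => f + C t * X ^ (m - 1)) (key t) (by simp) ?_ ?_
    · intro f hf
      exact ⟨f + C (-t) * X ^ (m - 1), key (-t) f hf, by simp⟩
    · intro f hf
      have h2 := (mem_monicsOfDegree.1 (key t f hf)).2
      have h1 := (mem_monicsOfDegree.1 hf).2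
      have e0 : (f + C t * X ^ (m - 1)).coeff 0 = f.coeff 0 := by
        simp [coeff_X_pow, show (0 : ℕ) ≠ m - 1 by omega]
      have e1 : (f + C t * X ^ (m - 1)).coeff 1 = f.coeff 1 := by
        simp only [coeff_add, coeff_C_mul, coeff_X_pow, if_neg (show (1 : ℕ) ≠ m - 1 by omega)]
        simp
      have e2 : (f + C t * X ^ (m - 1)).nextCoeff = f.nextCoeff + t := by
        rw [nextCoeff_of_natDegree_pos (by omega), nextCoeff_of_natDegree_pos (by omega), h1, h2]
        simp
      simp only [kloostermanWeight]
      rw [e0, e1, e2, h1, h2, mul_left_comm, ← AddChar.map_add_eq_mul]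
      congr 2
      ring
  have : (1 - ψ (-a * t)) * lCoeff χ ψ a b m = 0 := by linear_combination h
  rcases mul_eq_zero.1 this with h | h
  · exact absurd (sub_eq_zero.1 h).symm ht
  · exact h

lemma norm_addChar_le [Fintype F] (ψ : AddChar F ℂ) (x : F) : ‖ψ x‖ ≤ 1 :=
  (AddChar.norm_apply ψ x).le

lemma norm_mulChar_le (χ : MulChar F ℂ) (x : F) : ‖χ x‖ ≤ 1 := by
  by_cases hx : x = 0
  · simp [hx, MulChar.map_zero χ]
  · have : IsOfFinOrder (χ x) := by
      have := isOfFinOrder_of_finite (Units.mk0 x hx)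
      exact MonoidHom.isOfFinOrder χ.toMonoidHom (Units.isOfFinOrder_val.2 this)
    exact this.norm_eq_one.le

lemma norm_lCoeff_two_le [Fintype F] (χ : MulChar F ℂ) {ψ : AddChar F ℂ} (hψ : ψ ≠ 1) {a : F}
    (ha : a ≠ 0) (b : F) : ‖lCoeff χ ψ a b 2‖ ≤ Fintype.card F := by
  have h : lCoeff χ ψ a b 2 = ∑ v : F, ∑ u : F, χ v * ψ (-(a + b / v) * u) := by
    rw [← Finset.sum_product']
    symm
    have hd2 : ∀ x : F × F, (X ^ 2 + C x.2 * X + C x.1 : F[X]).natDegree = 2 := fun x => by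
      compute_degree!
    refine Finset.sum_bij (fun x _ => X ^ 2 + C x.2 * X + C x.1) ?_ ?_ ?_ ?_
    · intro x _
      exact mem_monicsOfDegree.2 ⟨by monicity!, hd2 x⟩
    · intro x _ y _ hxy
      have h0 := congrArg (coeff · 0) hxy
      have h1 := congrArg (coeff · 1) hxy
      simp [coeff_C] at h0 h1
      exact Prod.ext h0 h1
    · intro f hf
      obtain ⟨hm, hd⟩ := mem_monicsOfDegree.1 hf
      refine ⟨(f.coeff 0, f.coeff 1), Finset.mem_univ _, ?_⟩
      conv_rhs => rw [hm.as_sum, hd]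
      simp [Finset.sum_range_succ]
      ring
    · intro x _
      have e0 : (X ^ 2 + C x.2 * X + C x.1 : F[X]).coeff 0 = x.1 := by simp
      have e1 : (X ^ 2 + C x.2 * X + C x.1 : F[X]).coeff 1 = x.2 := by simp [coeff_C]
      have e2 : (X ^ 2 + C x.2 * X + C x.1 : F[X]).nextCoeff = x.2 := by
        rw [nextCoeff_of_natDegree_pos (by rw [hd2]; omega), hd2, e1]
      rw [kloostermanWeight, e0, e1, e2, hd2]
      congr 2
      · ring
      · ring
  have hin : ∀ v : F, ‖∑ u : F, χ v * ψ (-(a + b / v) * u)‖ ≤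
      if v = -b / a then (Fintype.card F : ℝ) else 0 := by
    intro v
    rw [← Finset.mul_sum]
    by_cases hv : v = 0
    · rw [hv, MulChar.map_zero χ, zero_mul, norm_zero]; split_ifs <;> simp
    split_ifs with hva
    · rw [norm_mul]
      calc _ ≤ 1 * ∑ u : F, (1 : ℝ) := by
            gcongr
            · exact norm_mulChar_le _ _
            · exact norm_sum_le_of_le _ fun u _ => norm_addChar_le _ _
        _ = _ := by simp
    · have hc : -(a + b / v) ≠ 0 := by
        intro h0
        apply hva
        field_simp at h0 ⊢
        linear_combination -h0
      have : ∑ u : F, ψ (-(a + b / v) * u) = 0 := by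
        rw [← AddChar.sum_eq_zero_of_ne_one hψ]
        exact Equiv.sum_comp (Equiv.mulLeft₀ _ hc) ψ
      rw [this, mul_zero, norm_zero]
  rw [h]
  calc _ ≤ ∑ v : F, if v = -b / a then (Fintype.card F : ℝ) else 0 :=
        norm_sum_le_of_le _ fun v _ => hin v
    _ = _ := by simp

end LFunction

section Newton

variable {F : Type*} [Field F] [Finite F]

variable (F) in
/-- The monic irreducible polynomials of degree `m` over a finite field. -/
def irredsOfDegree (m : ℕ) : Finset F[X] := (monicsOfDegree F m).filter Irreducible

lemma mem_irredsOfDegree {m : ℕ} {f : F[X]} :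
    f ∈ irredsOfDegree F m ↔ (f.Monic ∧ f.natDegree = m) ∧ Irreducible f := by
  simp [irredsOfDegree, mem_monicsOfDegree]

/-- The power sums attached to a Kloosterman sum. -/
def lPowerSum (χ : MulChar F ℂ) (ψ : AddChar F ℂ) (a b : F) (m : ℕ) : ℂ :=
  ∑ x ∈ m.divisorsAntidiagonal, ∑ P ∈ irredsOfDegree F x.1,
    (x.1 : ℂ) * kloostermanWeight χ ψ a b P ^ x.2

lemma natDegree_eq_sum_pow_dvd {m : ℕ} {f : F[X]} (hf : f ∈ monicsOfDegree F m) :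
    m = ∑ x ∈ Finset.Icc 1 m ×ˢ Finset.Icc 1 m, ∑ P ∈ irredsOfDegree F x.1,
      if P ^ x.2 ∣ f then x.1 else 0 := by
  obtain ⟨hm, hd⟩ := mem_monicsOfDegree.1 hf
  have hf0 := hm.ne_zero
  have hcount : ∀ P : F[X], P.Monic → Irreducible P → ∀ k, P ^ k ∣ f ↔
      k ≤ (normalizedFactors f).count P := by
    intro P hP hirr k
    rw [pow_dvd_iff_le_emultiplicity, emultiplicity_eq_count_normalizedFactors hirr hf0,
      hP.normalize_eq_self]
    exact Nat.cast_le
  have h1 : f.natDegree = ∑ P ∈ (normalizedFactors f).toFinset,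
      (normalizedFactors f).count P * P.natDegree := by
    have h2 : f = (normalizedFactors f).prod := by
      rw [prod_normalizedFactors_eq hf0, hm.normalize_eq_self]
    conv_lhs => rw [h2, natDegree_multiset_prod _ (zero_notMem_normalizedFactors f)]
    rw [Finset.sum_multiset_map_count]
    simp
  rw [Finset.sum_product]
  have h3 : ∀ e ∈ Finset.Icc 1 m, ∑ k ∈ Finset.Icc 1 m, ∑ P ∈ irredsOfDegree F e,
      (if P ^ k ∣ f then e else 0) =
      ∑ P ∈ irredsOfDegree F e, (normalizedFactors f).count P * P.natDegree := by
    intro e he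
    rw [Finset.sum_comm]
    refine Finset.sum_congr rfl fun P hP => ?_
    obtain ⟨⟨hPm, hPd⟩, hirr⟩ := mem_irredsOfDegree.1 hP
    rw [← Finset.sum_filter, Finset.sum_const, hPd, smul_eq_mul]
    congr 1
    have : (Finset.Icc 1 m).filter (fun k => P ^ k ∣ f) =
        Finset.Icc 1 ((normalizedFactors f).count P) := by
      ext k
      simp only [Finset.mem_filter, Finset.mem_Icc, hcount P hPm hirr]
      have h5 : k ≤ (normalizedFactors f).count P → k ≤ m := by
        intro h
        have h6 := natDegree_le_of_dvd ((hcount P hPm hirr k).2 h) hf0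
        rw [hPm.natDegree_pow, hd, hPd] at h6
        have : 1 ≤ e := (Finset.mem_Icc.1 he).1
        nlinarith
      constructor
      · rintro ⟨⟨h, _⟩, h'⟩; exact ⟨h, h'⟩
      · rintro ⟨h, h'⟩; exact ⟨⟨h, h5 h'⟩, h'⟩
    rw [this]; simp
  rw [Finset.sum_congr rfl h3]
  conv_lhs => rw [← hd, h1]
  rw [← Finset.sum_fiberwise_of_maps_to (s := (normalizedFactors f).toFinset)
    (t := Finset.Icc 1 m) (g := natDegree)]
  · refine Finset.sum_congr rfl fun e he => ?_
    refine Finset.sum_subset ?_ ?_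
    · intro P hP
      simp only [Finset.mem_filter, Multiset.mem_toFinset] at hP
      have hirr := irreducible_of_normalized_factor P hP.1
      refine mem_irredsOfDegree.2 ⟨⟨?_, hP.2⟩, hirr⟩
      rw [← normalize_normalized_factor P hP.1]
      exact monic_normalize hirr.ne_zero
    · intro P hP hn
      obtain ⟨⟨hPm, hPd⟩, hirr⟩ := mem_irredsOfDegree.1 hP
      simp only [Finset.mem_filter, Multiset.mem_toFinset, not_and] at hn
      rw [Multiset.count_eq_zero_of_notMem (fun h => hn h hPd), zero_mul]
  · intro P hP
    rw [Multiset.mem_toFinset] at hP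
    have hirr := irreducible_of_normalized_factor P hP
    exact Finset.mem_Icc.2 ⟨hirr.natDegree_pos,
      hd ▸ natDegree_le_of_dvd (dvd_of_mem_normalizedFactors hP) hf0⟩

lemma sum_weight_of_dvd (χ : MulChar F ℂ) (ψ : AddChar F ℂ) (a b : F) (m : ℕ) {P : F[X]}
    (hP : P.Monic) :
    ∑ f ∈ (monicsOfDegree F m).filter (P ∣ ·), kloostermanWeight χ ψ a b f =
      if P.natDegree ≤ m then kloostermanWeight χ ψ a b P * lCoeff χ ψ a b (m - P.natDegree)
      else 0 := by
  split_ifs with h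
  · rw [lCoeff, Finset.mul_sum]
    symm
    refine Finset.sum_bij (fun g _ => P * g) ?_ ?_ ?_ ?_
    · intro g hg
      obtain ⟨h1, h2⟩ := mem_monicsOfDegree.1 hg
      refine Finset.mem_filter.2 ⟨mem_monicsOfDegree.2 ⟨hP.mul h1, ?_⟩, dvd_mul_right _ _⟩
      rw [hP.natDegree_mul h1]; omega
    · intro g _ g' _ h
      exact mul_left_cancel₀ hP.ne_zero h
    · intro f hf
      obtain ⟨hf, g, rfl⟩ := Finset.mem_filter.1 hf
      obtain ⟨h1, h2⟩ := mem_monicsOfDegree.1 hf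
      have hg := hP.of_mul_monic_left h1
      refine ⟨g, mem_monicsOfDegree.2 ⟨hg, ?_⟩, rfl⟩
      rw [hP.natDegree_mul hg] at h2; omega
    · intro g hg
      rw [kloostermanWeight_mul _ _ _ _ hP (mem_monicsOfDegree.1 hg).1]
  · refine Finset.sum_eq_zero fun f hf => ?_
    obtain ⟨hf, hdvd⟩ := Finset.mem_filter.1 hf
    obtain ⟨h1, h2⟩ := mem_monicsOfDegree.1 hf
    exact absurd (h2 ▸ natDegree_le_of_dvd hdvd h1.ne_zero) h

/-- Newton's identities for the coefficients of the `L`-function. -/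
lemma newton_lCoeff (χ : MulChar F ℂ) (ψ : AddChar F ℂ) (a b : F) (m : ℕ) :
    (m : ℂ) * lCoeff χ ψ a b m =
      ∑ j ∈ Finset.Icc 1 m, lPowerSum χ ψ a b j * lCoeff χ ψ a b (m - j) := by
  have h1 : (m : ℂ) * lCoeff χ ψ a b m =
      ∑ x ∈ Finset.Icc 1 m ×ˢ Finset.Icc 1 m, ∑ P ∈ irredsOfDegree F x.1,
        (x.1 : ℂ) * ∑ f ∈ (monicsOfDegree F m).filter (P ^ x.2 ∣ ·),
          kloostermanWeight χ ψ a b f := by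
    rw [lCoeff, Finset.mul_sum]
    have : ∀ f ∈ monicsOfDegree F m, (m : ℂ) * kloostermanWeight χ ψ a b f =
        ∑ x ∈ Finset.Icc 1 m ×ˢ Finset.Icc 1 m, ∑ P ∈ irredsOfDegree F x.1,
          if P ^ x.2 ∣ f then (x.1 : ℂ) * kloostermanWeight χ ψ a b f else 0 := by
      intro f hf
      conv_lhs => rw [natDegree_eq_sum_pow_dvd hf]
      push_cast
      rw [Finset.sum_mul]
      refine Finset.sum_congr rfl fun x _ => ?_
      rw [Finset.sum_mul]
      refine Finset.sum_congr rfl fun P _ => ?_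
      split_ifs <;> simp
    rw [Finset.sum_congr rfl this, Finset.sum_comm]
    refine Finset.sum_congr rfl fun x _ => ?_
    rw [Finset.sum_comm]
    refine Finset.sum_congr rfl fun P _ => ?_
    rw [Finset.mul_sum, Finset.sum_filter]
  have h2 : ∀ x ∈ Finset.Icc 1 m ×ˢ Finset.Icc 1 m, ∑ P ∈ irredsOfDegree F x.1,
        (x.1 : ℂ) * ∑ f ∈ (monicsOfDegree F m).filter (P ^ x.2 ∣ ·),
          kloostermanWeight χ ψ a b f =
      if x.1 * x.2 ≤ m then (∑ P ∈ irredsOfDegree F x.1,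
        (x.1 : ℂ) * kloostermanWeight χ ψ a b P ^ x.2) * lCoeff χ ψ a b (m - x.1 * x.2)
      else 0 := by
    intro x _
    have h3 : ∀ P ∈ irredsOfDegree F x.1,
        ∑ f ∈ (monicsOfDegree F m).filter (P ^ x.2 ∣ ·), kloostermanWeight χ ψ a b f =
        if x.1 * x.2 ≤ m then kloostermanWeight χ ψ a b P ^ x.2 *
          lCoeff χ ψ a b (m - x.1 * x.2) else 0 := by
      intro P hP
      obtain ⟨⟨hPm, hPd⟩, -⟩ := mem_irredsOfDegree.1 hP
      rw [sum_weight_of_dvd _ _ _ _ _ (hPm.pow x.2), hPm.natDegree_pow, hPd,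
        kloostermanWeight_pow _ _ _ _ hPm, mul_comm x.2]
    split_ifs with h
    · rw [Finset.sum_mul]
      refine Finset.sum_congr rfl fun P hP => ?_
      rw [h3 P hP, if_pos h, mul_assoc]
    · refine Finset.sum_eq_zero fun P hP => ?_
      rw [h3 P hP, if_neg h, mul_zero]
  rw [h1, Finset.sum_congr rfl h2, ← Finset.sum_filter,
    ← Finset.sum_fiberwise_of_maps_to (t := Finset.Icc 1 m) (g := fun x => x.1 * x.2)]
  · refine Finset.sum_congr rfl fun j hj => ?_
    rw [lPowerSum, Finset.sum_mul]
    have : ((Finset.Icc 1 m ×ˢ Finset.Icc 1 m).filter (fun x => x.1 * x.2 ≤ m)).filter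
        (fun x => x.1 * x.2 = j) = j.divisorsAntidiagonal := by
      ext x
      simp only [Finset.mem_filter, Finset.mem_product, Finset.mem_Icc,
        Nat.mem_divisorsAntidiagonal] at hj ⊢
      constructor
      · rintro ⟨_, h⟩; exact ⟨h, by omega⟩
      · rintro ⟨h, h0⟩
        have p1 : 1 ≤ x.1 := Nat.pos_of_ne_zero (by rintro h'; simp [h'] at h; omega)
        have p2 : 1 ≤ x.2 := Nat.pos_of_ne_zero (by rintro h'; simp [h'] at h; omega)
        refine ⟨⟨⟨⟨p1, ?_⟩, ⟨p2, ?_⟩⟩, ?_⟩, h⟩ <;> nlinarith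
    rw [this]
    refine Finset.sum_congr rfl fun x hx => ?_
    rw [(Nat.mem_divisorsAntidiagonal.1 hx).1]
  · intro x hx
    simp only [Finset.mem_filter, Finset.mem_product, Finset.mem_Icc] at hx ⊢
    exact ⟨Nat.mul_pos hx.1.1.1 hx.1.2.1, hx.2⟩

/-- The power sums are governed by the two reciprocal roots of the `L`-function. -/
lemma exists_lPowerSum_eq [Fintype F] (χ : MulChar F ℂ) {ψ : AddChar F ℂ} (hψ : ψ ≠ 1) {a : F}
    (ha : a ≠ 0) (b : F) :
    ∃ ω₁ ω₂ : ℂ, ω₁ + ω₂ = -lCoeff χ ψ a b 1 ∧ ω₁ * ω₂ = lCoeff χ ψ a b 2 ∧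
      ∀ m, 1 ≤ m → lPowerSum χ ψ a b m = -(ω₁ ^ m + ω₂ ^ m) := by
  set c₁ := lCoeff χ ψ a b 1 with hc1
  set c₂ := lCoeff χ ψ a b 2 with hc2
  obtain ⟨s, hs⟩ := IsAlgClosed.exists_pow_nat_eq (c₁ ^ 2 - 4 * c₂) (n := 2) (by norm_num)
  refine ⟨(-c₁ + s) / 2, (-c₁ - s) / 2, by ring, by linear_combination (-1 / 4) * hs, ?_⟩
  set ω₁ := (-c₁ + s) / 2
  set ω₂ := (-c₁ - s) / 2
  have e1 : c₁ = -(ω₁ + ω₂) := by simp only [ω₁, ω₂]; ring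
  have e2 : c₂ = ω₁ * ω₂ := by simp only [ω₁, ω₂]; linear_combination (1 / 4) * hs
  have n1 := newton_lCoeff χ ψ a b 1
  have n2 := newton_lCoeff χ ψ a b 2
  have hz := lCoeff_zero χ ψ a b
  simp [hz] at n1
  rw [show Finset.Icc 1 2 = {1, 2} from rfl] at n2
  simp [hz] at n2
  rw [← hc1] at n1 n2
  rw [← hc2] at n2
  intro m
  induction m using Nat.strong_induction_on with
  | _ m ih =>
    intro hm
    rcases (by omega : m = 1 ∨ m = 2 ∨ 3 ≤ m) with rfl | rfl | h3
    · rw [← n1, e1]; ring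
    · rw [← n1] at n2
      rw [e1, e2] at n2
      linear_combination -n2
    · have nm := newton_lCoeff χ ψ a b m
      rw [lCoeff_eq_zero χ hψ ha b h3, mul_zero] at nm
      have hsub : ({m - 2, m - 1, m} : Finset ℕ) ⊆ Finset.Icc 1 m := by
        intro j hj
        simp only [Finset.mem_insert, Finset.mem_singleton] at hj
        rw [Finset.mem_Icc]; omega
      rw [← Finset.sum_subset hsub] at nm
      · rw [Finset.sum_insert (by simp; omega), Finset.sum_insert (by simp; omega),
          Finset.sum_singleton, show m - (m - 2) = 2 by omega, show m - (m - 1) = 1 by omega,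
          Nat.sub_self, hz, ← hc1, ← hc2, ih (m - 2) (by omega) (by omega),
          ih (m - 1) (by omega) (by omega), e1, e2] at nm
        obtain ⟨l, rfl⟩ : ∃ l, m = l + 2 := ⟨m - 2, by omega⟩
        simp only [Nat.add_sub_cancel, show l + 2 - 1 = l + 1 by omega] at nm
        linear_combination -nm
      · intro j hj hn
        simp only [Finset.mem_insert, Finset.mem_singleton, Finset.mem_Icc] at hj hn
        rw [lCoeff_eq_zero χ hψ ha b (by omega), mul_zero]

end Newton

section ExtensionSum

open IntermediateField Module

lemma adjoin_simple_inv {F E : Type*} [Field F] [Field E] [Algebra F E] (x : E) :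
    F⟮x⁻¹⟯ = F⟮x⟯ := by
  apply le_antisymm
  · exact adjoin_simple_le_iff.2 (inv_mem (mem_adjoin_simple_self F x))
  · refine adjoin_simple_le_iff.2 ?_
    simpa using inv_mem (mem_adjoin_simple_self F x⁻¹)

lemma nextCoeff_minpoly_inv {F E : Type*} [Field F] [Field E] [Algebra F E]
    [FiniteDimensional F E] {x : E} (hx : x ≠ 0) :
    (minpoly F x⁻¹).nextCoeff = (minpoly F x).coeff 1 / (minpoly F x).coeff 0 := by
  set M := minpoly F x
  set N := minpoly F x⁻¹
  have hN : N.Monic := minpoly.monic (Algebra.IsIntegral.isIntegral _)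
  have hdeg : N.natDegree = M.natDegree := by
    rw [← adjoin.finrank (Algebra.IsIntegral.isIntegral (R := F) x),
      ← adjoin.finrank (Algebra.IsIntegral.isIntegral (R := F) x⁻¹), adjoin_simple_inv]
  have hdvd : M ∣ N.reverse := by
    apply minpoly.dvd
    let _ := invertibleOfNonzero (inv_ne_zero hx)
    have := (eval₂_reverse_eq_zero_iff (algebraMap F E) x⁻¹ N).2 (minpoly.aeval F x⁻¹)
    simpa [aeval_def] using this
  obtain ⟨w, hw⟩ := hdvd
  have hr0 : N.reverse ≠ 0 := by simpa using hN.ne_zero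
  have hw0 : w ≠ 0 := by rintro rfl; simp [hw] at hr0
  have hM0 : M ≠ 0 := by rintro h; simp [hw, h] at hr0
  have hwd : w.natDegree = 0 := by
    have h1 := reverse_natDegree_le N
    rw [hw, natDegree_mul hM0 hw0] at h1
    omega
  obtain ⟨u, rfl⟩ := natDegree_eq_zero.1 hwd
  have h0 : N.reverse.coeff 0 = M.coeff 0 * u := by rw [hw, coeff_mul_C]
  have h1 : N.reverse.coeff 1 = M.coeff 1 * u := by rw [hw, coeff_mul_C]
  rw [coeff_zero_reverse, hN.leadingCoeff] at h0
  rw [coeff_one_reverse] at h1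
  have : M.coeff 0 ≠ 0 := by rintro h; simp [h] at h0
  rw [h1, eq_div_iff this]
  linear_combination -(M.coeff 1) * h0

lemma norm_eq_minpoly_coeff_pow {F E : Type*} [Field F] [Field E] [Algebra F E]
    [FiniteDimensional F E] (x : E) :
    Algebra.norm F x =
      ((-1) ^ (minpoly F x).natDegree * (minpoly F x).coeff 0) ^ finrank F⟮x⟯ E := by
  have hx := Algebra.IsIntegral.isIntegral (R := F) x
  rw [Algebra.norm_eq_norm_adjoin]
  congr 1
  have := Algebra.PowerBasis.norm_gen_eq_coeff_zero_minpoly (adjoin.powerBasis hx)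
  rwa [adjoin.powerBasis_gen, adjoin.powerBasis_dim, minpoly_gen] at this

variable {F E : Type*} [Field F] [Field E] [Algebra F E]

lemma weight_minpoly_pow [FiniteDimensional F E] (χ : MulChar F ℂ) (ψ : AddChar F ℂ) (a b : F)
    (x : E) :
    χ (Algebra.norm F x) * ψ (a * Algebra.trace F E x + b * Algebra.trace F E x⁻¹) =
      kloostermanWeight χ ψ a b (minpoly F x) ^ finrank F⟮x⟯ E := by
  have hpos : 0 < finrank F⟮x⟯ E := finrank_pos
  by_cases hx : x = 0
  · subst hx
    have : kloostermanWeight χ ψ a b (minpoly F (0 : E)) = 0 := by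
      simp [kloostermanWeight, minpoly.zero, MulChar.map_zero χ]
    rw [this, zero_pow hpos.ne']
    rw [Algebra.norm_zero, MulChar.map_zero χ, zero_mul]
  · rw [norm_eq_minpoly_coeff_pow, trace_eq_finrank_mul_minpoly_nextCoeff,
      trace_eq_finrank_mul_minpoly_nextCoeff, nextCoeff_minpoly_inv hx, adjoin_simple_inv,
      kloostermanWeight, map_pow χ, mul_pow (χ _), ← AddChar.map_nsmul_eq_pow]
    congr 2
    rw [nsmul_eq_mul]
    ring

variable [Finite F] [Fintype E]

lemma card_filter_minpoly_eq {P : F[X]} (hP : P.Monic) (hirr : Irreducible P)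
    (hdvd : P.natDegree ∣ finrank F E) :
    (Finset.univ.filter fun x : E => minpoly F x = P).card = P.natDegree := by
  have hcard : Nat.card E = Nat.card F ^ finrank F E := natCard_eq_pow_finrank
  have h1 : P ∣ X ^ (Nat.card F) ^ finrank F E - X :=
    (Irreducible.natDegree_dvd_iff_dvd_X_pow_card_pow_sub_X hirr).1 hdvd
  rw [← hcard, Nat.card_eq_fintype_card] at h1
  have h2 := Polynomial.map_dvd (algebraMap F E) h1
  have hne : (X ^ Fintype.card E - X : E[X]) ≠ 0 :=
    FiniteField.X_pow_card_sub_X_ne_zero E Fintype.one_lt_card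
  simp only [Polynomial.map_sub, Polynomial.map_pow, map_X] at h2
  have hs : (P.map (algebraMap F E)).Splits := by
    refine Splits.of_dvd ?_ hne h2
    rw [splits_iff_card_roots, FiniteField.roots_X_pow_card_sub_X,
      FiniteField.X_pow_card_sub_X_natDegree_eq E Fintype.one_lt_card]
    simp
  have hnd : (P.map (algebraMap F E)).roots.Nodup := by
    refine Multiset.nodup_of_le (roots.le_of_dvd hne h2) ?_
    rw [FiniteField.roots_X_pow_card_sub_X]
    exact Finset.univ.nodup
  have : (Finset.univ.filter fun x : E => minpoly F x = P) =
      (P.map (algebraMap F E)).roots.toFinset := by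
    ext x
    simp only [Finset.mem_filter, Finset.mem_univ, true_and, Multiset.mem_toFinset]
    rw [mem_roots (hP.map _).ne_zero, IsRoot, eval_map_algebraMap]
    constructor
    · rintro rfl; exact minpoly.aeval F x
    · intro h
      exact (minpoly.eq_of_irreducible_of_monic hirr h hP).symm
  rw [this, Multiset.toFinset_card_of_nodup hnd, ← hs.natDegree_eq_card_roots,
    natDegree_map]

/-- Character sums over an extension field of degree `m` are the `m`-th power sums. -/
lemma sum_extension_eq_lPowerSum (χ : MulChar F ℂ) (ψ : AddChar F ℂ) (a b : F) :
    ∑ x : E, χ (Algebra.norm F x) * ψ (a * Algebra.trace F E x + b * Algebra.trace F E x⁻¹) =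
      lPowerSum χ ψ a b (finrank F E) := by
  have hmul : ∀ x : E, (minpoly F x).natDegree * finrank F⟮x⟯ E = finrank F E := fun x => by
    rw [← adjoin.finrank (Algebra.IsIntegral.isIntegral (R := F) x), finrank_mul_finrank]
  have hpos : finrank F E ≠ 0 := finrank_pos.ne'
  rw [lPowerSum, ← Finset.sum_fiberwise_of_maps_to (t := (finrank F E).divisorsAntidiagonal)
    (g := fun x : E => ((minpoly F x).natDegree, finrank F⟮x⟯ E))
    (fun x _ => Nat.mem_divisorsAntidiagonal.2 ⟨hmul x, hpos⟩)]
  refine Finset.sum_congr rfl fun y hy => ?_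
  obtain ⟨hy1, -⟩ := Nat.mem_divisorsAntidiagonal.1 hy
  rw [← Finset.sum_fiberwise_of_maps_to (t := irredsOfDegree F y.1) (g := fun x : E => minpoly F x)]
  · refine Finset.sum_congr rfl fun P hP => ?_
    obtain ⟨⟨hPm, hPd⟩, hirr⟩ := mem_irredsOfDegree.1 hP
    have hfilter : (Finset.univ.filter fun x : E =>
        ((minpoly F x).natDegree, finrank F⟮x⟯ E) = y).filter (fun x => minpoly F x = P) =
        Finset.univ.filter fun x : E => minpoly F x = P := by
      ext x
      simp only [Finset.mem_filter, Finset.mem_univ, true_and, and_iff_right_iff_imp]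
      rintro rfl
      refine Prod.ext hPd ?_
      have := hmul x
      rw [hPd, ← hy1] at this
      exact Nat.eq_of_mul_eq_mul_left (Nat.pos_of_ne_zero (by
        rintro h; rw [h, zero_mul] at hy1; exact hpos hy1.symm)) this
    rw [Finset.sum_congr rfl (g := fun _ => kloostermanWeight χ ψ a b P ^ y.2), Finset.sum_const,
      hfilter, card_filter_minpoly_eq hPm hirr (hPd ▸ ⟨y.2, hy1.symm⟩), hPd, nsmul_eq_mul]
    intro x hx
    simp only [Finset.mem_filter, Finset.mem_univ, true_and] at hx
    rw [weight_minpoly_pow, hx.2, ← hx.1]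
  · intro x hx
    have hintegral := Algebra.IsIntegral.isIntegral (R := F) x
    simp only [Finset.mem_filter, Finset.mem_univ, true_and] at hx
    exact mem_irredsOfDegree.2 ⟨⟨minpoly.monic hintegral, by rw [← hx]⟩, minpoly.irreducible hintegral⟩

end ExtensionSum

section KloostermanBound

open Module

lemma norm_le_of_norm_pow_add_pow_le {u v : ℂ} {C : ℝ} (huv : ‖u * v‖ ≤ 1)
    (h : ∀ M : ℕ, 2 ≤ M → ‖u ^ M + v ^ M‖ ≤ C) : ‖u‖ ≤ 1 := by
  by_contra! hu
  have hv : ‖v‖ ≤ 1 := by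
    rw [norm_mul] at huv
    by_contra! hv
    nlinarith
  obtain ⟨M, hM⟩ := pow_unbounded_of_one_lt (C + 1) hu
  have h1 := h (M + 2) (by omega)
  have h2 : ‖u ^ (M + 2)‖ ≤ ‖u ^ (M + 2) + v ^ (M + 2)‖ + ‖v ^ (M + 2)‖ := by
    simpa using norm_sub_le (u ^ (M + 2) + v ^ (M + 2)) (v ^ (M + 2))
  rw [norm_pow, norm_pow] at h2
  have h3 : ‖v‖ ^ (M + 2) ≤ 1 := pow_le_one₀ (norm_nonneg _) hv
  have h4 : ‖u‖ ^ M ≤ ‖u‖ ^ (M + 2) := pow_le_pow_right₀ hu.le (by omega)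
  linarith

variable {F : Type*} [Field F] [Fintype F]

lemma norm_sum_extension_le {E : Type*} [Field E] [Fintype E] [Algebra F E] (χ : MulChar F ℂ)
    {ψ : AddChar F ℂ} (hψ : ψ ≠ 1) {a : F} (ha : a ≠ 0) (b : F) {m : ℕ} (hm : 1 ≤ m)
    (hfin : finrank F E = 2 * (m + 1)) :
    ‖∑ x : E, χ (Algebra.norm F x) * ψ (a * Algebra.trace F E x + b * Algebra.trace F E x⁻¹)‖ ≤
      (17 * (Fintype.card F : ℝ) ^ 2 + 1) * (Fintype.card F : ℝ) ^ (m + 1) := by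
  set Q := Fintype.card F with hQdef
  obtain ⟨p, hp, s, hpp, hps⟩ := FiniteField.card' F
  have : Fact p.Prime := ⟨hpp⟩
  have : CharP E p := charP_of_injective_algebraMap (algebraMap F E).injective p
  have hQ2 : 2 ≤ Q := Fintype.one_lt_card
  have hcard : Fintype.card E = Q ^ (2 * (m + 1)) := by
    rw [← hfin]; exact card_eq_pow_finrank
  have hN : Nat.card F = Q := Nat.card_eq_fintype_card
  have hgs : ∀ l : ℕ, (∑ i ∈ Finset.range l, Q ^ i) * (Q - 1) + 1 = Q ^ l := by
    intro l
    have := Nat.geomSum_eq hQ2 l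
    rw [this, Nat.div_mul_cancel (by simpa using Nat.sub_dvd_pow_sub_pow Q 1 l)]
    exact Nat.sub_add_cancel (Nat.one_le_pow _ _ (by omega))
  set e0 := ∑ i ∈ Finset.range (m + 1), Q ^ i with he0
  have he : e0 * (Q - 1) + 1 = Q * Q ^ m := by rw [hgs, pow_succ']
  have hexp : ∑ i ∈ Finset.range (2 * (m + 1)), Q ^ i = e0 * (1 + Q ^ (m + 1)) := by
    rw [two_mul, Finset.sum_range_add, mul_add, mul_one, mul_comm e0, he0, Finset.mul_sum]
    simp [pow_add]
  have hfrob : ∀ y : F, algebraMap F E y ^ Q = algebraMap F E y := by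
    intro y; rw [← map_pow, FiniteField.pow_card]
  set N : F × F → Finset E := fun z => Finset.univ.filter fun x : E =>
    (Algebra.norm F x, a * Algebra.trace F E x + b * Algebra.trace F E x⁻¹) = z with hNdef
  have hbound : ∀ z : F × F, z.1 ≠ 0 → ((N z).card : ℝ) ≤
      (Q : ℝ) ^ (2 * (m + 1)) / (Q * (Q - 1)) + 17 * (Q : ℝ) ^ (m + 1) := by
    intro z hz
    refine stepanov_card_le_real hQ2 hm hps hcard he (algebraMap F E z.1) (algebraMap F E z.2)
      (a := algebraMap F E a) (b := algebraMap F E b) (by simpa using ha) (hfrob a) (hfrob b)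
      (N z) ?_
    intro x hx
    simp only [hNdef, Finset.mem_filter, Finset.mem_univ, true_and] at hx
    refine ⟨?_, ?_, ?_⟩
    · rintro rfl
      rw [← hx] at hz
      simp at hz
    · rw [← hx, FiniteField.algebraMap_norm_eq_pow_sum, hfin, hN, hexp]
    · rw [← hx]
      simp only [map_add, map_mul, FiniteField.algebraMap_trace_eq_sum_pow, hfin, hN]
      rw [Finset.sum_add_distrib, Finset.mul_sum, Finset.mul_sum]
  set U : Finset (F × F) := (Finset.univ.erase 0) ×ˢ Finset.univ with hU
  have hUcard : (U.card : ℝ) = Q * (Q - 1) := by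
    rw [hU, Finset.card_product, Finset.card_erase_of_mem (Finset.mem_univ _), Finset.card_univ,
      ← hQdef]
    push_cast [Nat.cast_sub (show 1 ≤ Q by omega)]
    ring
  set B : ℝ := (Q : ℝ) ^ (2 * (m + 1)) / (Q * (Q - 1)) + 17 * (Q : ℝ) ^ (m + 1) with hB
  have hmaps : ∀ x ∈ (Finset.univ.erase (0 : E)),
      (Algebra.norm F x, a * Algebra.trace F E x + b * Algebra.trace F E x⁻¹) ∈ U := by
    intro x hx
    simp only [hU, Finset.mem_product, Finset.mem_erase, Finset.mem_univ, and_true] at hx ⊢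
    simpa [Algebra.norm_eq_zero_iff] using hx
  have hfib : ∀ z ∈ U, (Finset.univ.erase (0 : E)).filter (fun x =>
      (Algebra.norm F x, a * Algebra.trace F E x + b * Algebra.trace F E x⁻¹) = z) = N z := by
    intro z hz
    ext x
    simp only [hNdef, Finset.mem_filter, Finset.mem_erase, Finset.mem_univ, and_true, true_and,
      and_iff_right_iff_imp]
    rintro rfl rfl
    simp [hU] at hz
  have htotal : ∑ z ∈ U, ((N z).card : ℝ) = (Q : ℝ) ^ (2 * (m + 1)) - 1 := by
    have h1 := Finset.card_eq_sum_card_fiberwise hmaps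
    rw [Finset.sum_congr rfl (fun z hz => congrArg Finset.card (hfib z hz)),
      Finset.card_erase_of_mem (Finset.mem_univ _), Finset.card_univ, hcard] at h1
    rw [← Nat.cast_sum, ← h1, Nat.cast_sub (Nat.one_le_pow _ _ (by omega))]
    simp
  have hsum : ∑ x : E, χ (Algebra.norm F x) *
      ψ (a * Algebra.trace F E x + b * Algebra.trace F E x⁻¹) =
      ∑ z ∈ U, ((N z).card : ℂ) * (χ z.1 * ψ z.2) := by
    rw [← Finset.sum_erase (s := Finset.univ) (a := (0 : E)) (by
      rw [Algebra.norm_zero, MulChar.map_zero χ, zero_mul])]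
    rw [← Finset.sum_fiberwise_of_maps_to hmaps]
    refine Finset.sum_congr rfl fun z hz => ?_
    rw [hfib z hz, ← nsmul_eq_mul, ← Finset.sum_const]
    refine Finset.sum_congr rfl fun x hx => ?_
    simp only [hNdef, Finset.mem_filter, Finset.mem_univ, true_and] at hx
    rw [← hx]
  have hzero : ∑ z ∈ U, (χ z.1 * ψ z.2) = 0 := by
    rw [hU, Finset.sum_product]
    refine Finset.sum_eq_zero fun y _ => ?_
    simp only
    rw [← Finset.mul_sum, AddChar.sum_eq_zero_of_ne_one hψ, mul_zero]
  have hsum2 : ∑ x : E, χ (Algebra.norm F x) *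
      ψ (a * Algebra.trace F E x + b * Algebra.trace F E x⁻¹) =
      ∑ z ∈ U, (((N z).card : ℂ) - B) * (χ z.1 * ψ z.2) := by
    simp only [sub_mul]
    rw [hsum, Finset.sum_sub_distrib, ← Finset.mul_sum, hzero, mul_zero, sub_zero]
  rw [hsum2]
  have hQr : (2 : ℝ) ≤ Q := by exact_mod_cast hQ2
  calc _ ≤ ∑ z ∈ U, (B - (N z).card) := by
        refine norm_sum_le_of_le _ fun z hz => ?_
        have hz0 : z.1 ≠ 0 := by simpa [hU] using hz
        have e1 : ‖((N z).card : ℂ) - B‖ = B - (N z).card := by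
          rw [norm_sub_rev, ← Complex.ofReal_natCast, ← Complex.ofReal_sub, Complex.norm_real,
            Real.norm_of_nonneg (sub_nonneg.2 (hbound z hz0))]
        rw [norm_mul, e1, norm_mul]
        refine mul_le_of_le_one_right (sub_nonneg.2 (hbound z hz0)) ?_
        exact mul_le_one₀ (norm_mulChar_le _ _) (norm_nonneg _) (norm_addChar_le _ _)
    _ = 17 * (Q * (Q - 1)) * (Q : ℝ) ^ (m + 1) + 1 := by
        rw [Finset.sum_sub_distrib, htotal, Finset.sum_const, nsmul_eq_mul, hUcard, hB]
        have : (Q : ℝ) - 1 ≠ 0 := by linarith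
        field_simp
        ring
    _ ≤ _ := by
        have : 1 ≤ (Q : ℝ) ^ (m + 1) := one_le_pow₀ (by linarith)
        nlinarith

/-- The Weil bound for (twisted) Kloosterman sums. -/
theorem norm_kloosterman_le (χ : MulChar F ℂ) {ψ : AddChar F ℂ} (hψ : ψ ≠ 1) {a : F}
    (ha : a ≠ 0) (b : F) :
    ‖∑ x : F, χ x * ψ (a * x + b * x⁻¹)‖ ≤ 2 * √(Fintype.card F : ℝ) := by
  set Q := Fintype.card F with hQdef
  have hQ2 : 2 ≤ Q := Fintype.one_lt_card
  have hQpos : (0 : ℝ) < Q := by positivity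
  obtain ⟨ω₁, ω₂, hadd, hmul, hpow⟩ := exists_lPowerSum_eq χ hψ ha b
  obtain ⟨p, hp⟩ := CharP.exists F
  have : Fact p.Prime := ⟨CharP.char_is_prime F p⟩
  have hps : ∀ M : ℕ, 2 ≤ M → ‖ω₁ ^ (2 * M) + ω₂ ^ (2 * M)‖ ≤ (17 * (Q : ℝ) ^ 2 + 1) * Q ^ M := by
    intro M hM
    obtain ⟨m, rfl⟩ : ∃ m, M = m + 1 := ⟨M - 1, by omega⟩
    have : NeZero (2 * (m + 1)) := ⟨by omega⟩
    let _ := Fintype.ofFinite (FiniteField.Extension F p (2 * (m + 1)))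
    have hfin := FiniteField.finrank_extension F p (2 * (m + 1))
    have := norm_sum_extension_le (E := FiniteField.Extension F p (2 * (m + 1))) χ hψ ha b
      (by omega) hfin
    rw [sum_extension_eq_lPowerSum, hfin, hpow _ (by omega), norm_neg] at this
    exact this
  have hmul' : ‖ω₁ * ω₂‖ ≤ Q := hmul ▸ norm_lCoeff_two_le χ hψ ha b
  have key : ∀ u v : ℂ, ‖u * v‖ ≤ Q →
      (∀ M : ℕ, 2 ≤ M → ‖u ^ (2 * M) + v ^ (2 * M)‖ ≤ (17 * (Q : ℝ) ^ 2 + 1) * Q ^ M) →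
      ‖u‖ ≤ √(Q : ℝ) := by
    intro u v huv h
    have h1 : ‖u ^ 2 / Q‖ ≤ 1 := by
      refine norm_le_of_norm_pow_add_pow_le (v := v ^ 2 / Q) (C := 17 * (Q : ℝ) ^ 2 + 1) ?_ ?_
      · rw [div_mul_div_comm, ← mul_pow, norm_div, norm_pow, ← pow_two, norm_pow,
          Complex.norm_natCast, ← div_pow]
        exact pow_le_one₀ (by positivity) ((div_le_one hQpos).2 huv)
      · intro M hM
        have := h M hM
        rw [div_pow, div_pow, ← add_div, ← pow_mul, ← pow_mul, norm_div, norm_pow,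
          Complex.norm_natCast, div_le_iff₀ (by positivity)]
        exact this
    rw [norm_div, Complex.norm_natCast, norm_pow, div_le_one hQpos] at h1
    exact Real.le_sqrt_of_sq_le h1
  have h1 := key ω₁ ω₂ hmul' hps
  have h2 := key ω₂ ω₁ (by rwa [mul_comm]) (fun M hM => by rw [add_comm]; exact hps M hM)
  rw [← lCoeff_one, ← norm_neg, ← hadd]
  calc _ ≤ ‖ω₁‖ + ‖ω₂‖ := norm_add_le _ _
    _ ≤ _ := by linarith

lemma exists_eq_mulShift {ψ : AddChar F ℂ} (hψ : ψ ≠ 1) (ψ' : AddChar F ℂ) :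
    ∃ b : F, ψ' = AddChar.mulShift ψ b := by
  have hinj : Function.Injective (AddChar.mulShift ψ) :=
    AddChar.to_mulShift_inj_of_isPrimitive (AddChar.IsPrimitive.of_ne_one hψ)
  have hbij := (Fintype.bijective_iff_injective_and_card (AddChar.mulShift ψ)).2
    ⟨hinj, (AddChar.card_eq (α := F)).symm⟩
  obtain ⟨b, hb⟩ := hbij.2 ψ'
  exact ⟨b, hb.symm⟩

/-- The Weil bound for sums over the units twisted by arbitrary characters, not all trivial. -/
theorem norm_sum_units_le (ψ₁ ψ₂ : AddChar F ℂ) (χ : AddChar (Additive Fˣ) ℂ)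
    (h : ¬ (ψ₁ = 1 ∧ χ = 1 ∧ ψ₂ = 1)) :
    ‖∑ x : Fˣ, ψ₁ x * χ (Additive.ofMul x) * ψ₂ ((x⁻¹ : Fˣ) : F)‖ ≤
      2 * √(Fintype.card F : ℝ) := by
  have main : ∀ (ψ₁ ψ₂ : AddChar F ℂ) (χ : AddChar (Additive Fˣ) ℂ), ψ₁ ≠ 1 →
      ‖∑ x : Fˣ, ψ₁ x * χ (Additive.ofMul x) * ψ₂ ((x⁻¹ : Fˣ) : F)‖ ≤
      2 * √(Fintype.card F : ℝ) := by
    intro ψ₁ ψ₂ χ h1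
    obtain ⟨b, rfl⟩ := exists_eq_mulShift h1 ψ₂
    let f : Fˣ →* ℂ :=
      { toFun := fun x => χ (Additive.ofMul x)
        map_one' := by simp
        map_mul' := fun x y => by rw [ofMul_mul, AddChar.map_add_eq_mul] }
    have hf := norm_kloosterman_le (MulChar.ofUnitHom f.toHomUnits) h1 one_ne_zero b
    rw [← Fintype.sum_of_injective (fun x : Fˣ => (x : F)) Units.val_injective
      (fun x : Fˣ => ψ₁ x * χ (Additive.ofMul x) * (AddChar.mulShift ψ₁ b) ((x⁻¹ : Fˣ) : F))] at hf
    · exact hf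
    · intro x hx
      have hx0 : x = 0 := by
        by_contra h0
        exact hx ⟨Units.mk0 x h0, rfl⟩
      rw [hx0, MulChar.map_zero, zero_mul]
    · intro x
      rw [MulChar.ofUnitHom_coe, MonoidHom.coe_toHomUnits, AddChar.mulShift_apply,
        AddChar.map_add_eq_mul, one_mul, Units.val_inv_eq_inv_val]
      simp only [f, MonoidHom.coe_mk, OneHom.coe_mk]
      ring
  by_cases h1 : ψ₁ = 1
  · by_cases h2 : ψ₂ = 1
    · have hχ : χ ≠ 1 := fun hχ => h ⟨h1, hχ, h2⟩
      have h0 : ∑ x : Additive Fˣ, χ x = 0 := AddChar.sum_eq_zero_of_ne_one hχ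
      have : ∑ x : Fˣ, ψ₁ x * χ (Additive.ofMul x) * ψ₂ ((x⁻¹ : Fˣ) : F) =
          ∑ x : Additive Fˣ, χ x := by
        rw [h1, h2]
        simp only [AddChar.one_apply, one_mul, mul_one]
        exact Equiv.sum_comp Additive.ofMul χ
      rw [this, h0, norm_zero]
      positivity
    · have := main ψ₂ ψ₁ χ⁻¹ h2
      rw [← Equiv.sum_comp (Equiv.inv Fˣ)] at this
      convert this using 3 with x
      simp only [Equiv.inv_apply, inv_inv, AddChar.inv_apply, ofMul_inv, neg_neg]
      ring
  · exact main ψ₁ ψ₂ χ h1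

end KloostermanBound

section FourierSieve

variable {G : Type*} [AddCommGroup G] [Fintype G]

/-- `f` is a combination of characters trivial on `V`, with constant term `c` and with the sum of
the absolute values of the coefficients at most `N`. -/
def FourierRep (V : AddSubgroup G) (c N : ℝ) (f : G → ℝ) : Prop :=
  ∃ a : AddChar G ℂ → ℂ, (∀ x, (f x : ℂ) = ∑ Ψ, a Ψ * Ψ x) ∧
    (∀ Ψ, a Ψ ≠ 0 → ∀ v ∈ V, Ψ v = 1) ∧ a 1 = c ∧ ∑ Ψ, ‖a Ψ‖ ≤ N

lemma FourierRep.mul {V V' : AddSubgroup G} {c c' N N' : ℝ} {f f' : G → ℝ}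
    (h : FourierRep V c N f) (h' : FourierRep V' c' N' f') (hV : V ⊔ V' = ⊤) :
    FourierRep (V ⊓ V') (c * c') (N * N') (fun x => f x * f' x) := by
  obtain ⟨a, ha, hs, h1, hn⟩ := h
  obtain ⟨a', ha', hs', h1', hn'⟩ := h'
  have shift : ∀ (Φ : AddChar G ℂ) (u : AddChar G ℂ → ℂ), ∑ Ψ, u (Φ⁻¹ * Ψ) = ∑ Ψ, u Ψ :=
    fun Φ u => Equiv.sum_comp (Equiv.mulLeft Φ⁻¹) u
  refine ⟨fun Ψ => ∑ Φ, a Φ * a' (Φ⁻¹ * Ψ), ?_, ?_, ?_, ?_⟩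
  · intro x
    push_cast
    simp only [Finset.sum_mul]
    rw [ha, ha', Finset.sum_comm, Finset.sum_mul]
    refine Finset.sum_congr rfl fun Φ _ => ?_
    rw [Finset.mul_sum, ← shift Φ]
    refine Finset.sum_congr rfl fun Ψ _ => ?_
    have : Ψ x = Φ x * (Φ⁻¹ * Ψ) x := by rw [← AddChar.mul_apply, mul_inv_cancel_left]
    rw [this]; ring
  · intro Ψ hΨ v hv
    obtain ⟨Φ, -, hΦ⟩ := Finset.exists_ne_zero_of_sum_ne_zero hΨ
    have e1 := hs Φ (left_ne_zero_of_mul hΦ) v hv.1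
    have e2 := hs' _ (right_ne_zero_of_mul hΦ) v hv.2
    have : Ψ v = Φ v * (Φ⁻¹ * Ψ) v := by rw [← AddChar.mul_apply, mul_inv_cancel_left]
    rw [this, e1, e2, mul_one]
  · beta_reduce
    rw [Finset.sum_eq_single 1]
    · simp [h1, h1']
    · intro Φ _ hΦ
      by_contra h0
      have e1 := hs Φ (left_ne_zero_of_mul h0)
      have e2 := hs' _ (right_ne_zero_of_mul h0)
      apply hΦ
      ext x
      obtain ⟨v, hv, v', hv', rfl⟩ := AddSubgroup.mem_sup.1 (hV ▸ AddSubgroup.mem_top x)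
      have e3 := e2 v' hv'
      rw [mul_one, AddChar.inv_apply, AddChar.map_neg_eq_inv, inv_eq_one] at e3
      rw [AddChar.map_add_eq_mul, e1 v hv, e3]
      simp
    · simp
  · calc _ ≤ ∑ Ψ, ∑ Φ, ‖a Φ‖ * ‖a' (Φ⁻¹ * Ψ)‖ :=
          Finset.sum_le_sum fun Ψ _ => norm_sum_le_of_le _ fun Φ _ => (norm_mul _ _).le
      _ = (∑ Φ, ‖a Φ‖) * ∑ Ψ, ‖a' Ψ‖ := by
          rw [Finset.sum_comm, Finset.sum_mul]
          refine Finset.sum_congr rfl fun Φ _ => ?_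
          rw [← Finset.mul_sum]
          congr 1
          exact Equiv.sum_comp (Equiv.mulLeft Φ⁻¹) (fun Ψ => ‖a' Ψ‖)
      _ ≤ N * N' := mul_le_mul hn hn' (Finset.sum_nonneg fun _ _ => norm_nonneg _)
          ((Finset.sum_nonneg fun _ _ => norm_nonneg _).trans hn)

lemma FourierRep.const_sub {V : AddSubgroup G} {c N : ℝ} {f : G → ℝ} (h : FourierRep V c N f)
    (hc : 0 ≤ c) : FourierRep V 0 (N - c) (fun x => c - f x) := by
  obtain ⟨a, ha, hs, h1, hn⟩ := h
  refine ⟨fun Ψ => if Ψ = 1 then 0 else -a Ψ, ?_, ?_, by simp, ?_⟩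
  · intro x
    have hpt : ∀ Ψ : AddChar G ℂ, (if Ψ = 1 then 0 else -a Ψ) * Ψ x =
        (if Ψ = 1 then (c : ℂ) else 0) - a Ψ * Ψ x := by
      intro Ψ
      split_ifs with h
      · simp [h, h1]
      · ring
    simp only [hpt]
    rw [Finset.sum_sub_distrib, ← ha]
    simp
  · intro Ψ hΨ
    apply hs
    intro h0
    simp [h0] at hΨ
  · have hpt : ∀ Ψ : AddChar G ℂ, ‖(if Ψ = 1 then 0 else -a Ψ)‖ =
        ‖a Ψ‖ - (if Ψ = 1 then c else 0) := by
      intro Ψ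
      split_ifs with h
      · simp [h, h1, abs_of_nonneg hc]
      · simp
    simp only [hpt]
    rw [Finset.sum_sub_distrib]
    simpa using hn

lemma FourierRep.one : FourierRep (⊤ : AddSubgroup G) 1 1 (fun _ => 1) := by
  refine ⟨fun Ψ => if Ψ = 1 then 1 else 0, ?_, ?_, by simp, ?_⟩
  · intro x; simp
  · intro Ψ hΨ
    have : Ψ = 1 := by by_contra h; simp [h] at hΨ
    simp [this]
  · have : ∀ Ψ : AddChar G ℂ, ‖(if Ψ = 1 then 1 else 0 : ℂ)‖ = if Ψ = 1 then 1 else 0 := by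
      intro Ψ; split_ifs <;> simp
    simp [this]

lemma FourierRep.prod {ι : Type*} (s : Finset ι) (V : ι → AddSubgroup G) (c N : ι → ℝ)
    (f : ι → G → ℝ) (h : ∀ i ∈ s, FourierRep (V i) (c i) (N i) (f i))
    (hV : ∀ u ⊆ s, ∀ i ∈ s, i ∉ u → V i ⊔ ⨅ j ∈ u, V j = ⊤) :
    FourierRep (⨅ i ∈ s, V i) (∏ i ∈ s, c i) (∏ i ∈ s, N i) (fun x => ∏ i ∈ s, f i x) := by
  induction s using Finset.induction_on with
  | empty => simpa using FourierRep.one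
  | insert i s hi ih =>
    simp only [Finset.prod_insert hi, Finset.iInf_insert]
    refine FourierRep.mul (h i (Finset.mem_insert_self _ _)) (ih ?_ ?_) ?_
    · exact fun j hj => h j (Finset.mem_insert_of_mem hj)
    · exact fun u hu j hj => hV u (hu.trans (Finset.subset_insert _ _)) j
        (Finset.mem_insert_of_mem hj)
    · exact hV s (Finset.subset_insert _ _) i (Finset.mem_insert_self _ _) hi

/-- Summing over a family of points all of whose nontrivial character sums are small. -/
lemma FourierRep.abs_sum_sub_le {V : AddSubgroup G} {c N : ℝ} {f : G → ℝ}
    (h : FourierRep V c N f) (hc : 0 ≤ c) {Y : Type*} [Fintype Y] (π : Y → G) {E₀ : ℝ}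
    (hE₀ : 0 ≤ E₀) (hE : ∀ Ψ : AddChar G ℂ, Ψ ≠ 1 → ‖∑ y, Ψ (π y)‖ ≤ E₀) :
    |∑ y, f (π y) - c * Fintype.card Y| ≤ E₀ * (N - c) := by
  obtain ⟨a, ha, hs, h1, hn⟩ := h
  have e1 : ((∑ y, f (π y) : ℝ) : ℂ) = ∑ Ψ : AddChar G ℂ, a Ψ * ∑ y, Ψ (π y) := by
    push_cast
    simp only [ha, Finset.mul_sum]
    rw [Finset.sum_comm]
  have e2 : ((∑ y, f (π y) - c * Fintype.card Y : ℝ) : ℂ) =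
      ∑ Ψ ∈ (Finset.univ : Finset (AddChar G ℂ)).erase 1, a Ψ * ∑ y, Ψ (π y) := by
    rw [Complex.ofReal_sub, e1, ← Finset.add_sum_erase _ _ (Finset.mem_univ 1), h1]
    simp
  rw [← Finset.add_sum_erase _ _ (Finset.mem_univ 1), h1, Complex.norm_real,
    Real.norm_of_nonneg hc] at hn
  rw [← Real.norm_eq_abs, ← Complex.norm_real, e2]
  calc _ ≤ ∑ Ψ ∈ (Finset.univ : Finset (AddChar G ℂ)).erase 1, ‖a Ψ‖ * E₀ := by
        refine norm_sum_le_of_le _ fun Ψ hΨ => ?_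
        rw [norm_mul]
        gcongr
        exact hE Ψ (Finset.ne_of_mem_erase hΨ)
    _ ≤ _ := by
        rw [← Finset.sum_mul, mul_comm]
        gcongr
        linarith

/-- The Fourier coefficients of the indicator function of a subgroup. -/
def subgroupCoeff (V : AddSubgroup G) (Ψ : AddChar G ℂ) : ℝ :=
  if ∀ v ∈ V, Ψ v = 1 then (V.index : ℝ)⁻¹ else 0

lemma sum_subgroupCoeff_mul (V : AddSubgroup G) (x : G) :
    ∑ Ψ, (subgroupCoeff V Ψ : ℂ) * Ψ x = if x ∈ V then 1 else 0 := by
  have hcard : (Nat.card V * V.index : ℂ) = Fintype.card G := by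
    rw [← Nat.card_eq_fintype_card, ← V.card_mul_index]; push_cast; rfl
  have hG : (Fintype.card G : ℂ) ≠ 0 := by exact_mod_cast Fintype.card_ne_zero
  have h1 : ∀ Ψ : AddChar G ℂ, (subgroupCoeff V Ψ : ℂ) =
      (Fintype.card G : ℂ)⁻¹ * ∑ v : V, Ψ (-v) := by
    intro Ψ
    rw [subgroupCoeff]
    split_ifs with h
    · have : ∀ v : V, Ψ (-(v : G)) = 1 := fun v => h _ (V.neg_mem v.2)
      simp only [this, Finset.sum_const, Finset.card_univ, nsmul_eq_mul, mul_one]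
      rw [← hcard] at hG ⊢
      rw [Nat.card_eq_fintype_card] at hG ⊢
      push_cast
      have := left_ne_zero_of_mul hG
      have := right_ne_zero_of_mul hG
      field_simp
    · have : ∑ v : V, (Ψ⁻¹).compAddMonoidHom V.subtype v = 0 := by
        apply AddChar.sum_eq_zero_of_ne_one
        contrapose! h
        intro v hv
        have := DFunLike.congr_fun h (⟨-v, V.neg_mem hv⟩ : V)
        simpa [AddChar.inv_apply] using this
      simp only [AddChar.compAddMonoidHom_apply, AddChar.inv_apply, AddSubgroup.subtype_apply]
        at this
      rw [this]; simp
  simp only [h1, mul_assoc, Finset.sum_mul]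
  rw [← Finset.mul_sum, Finset.sum_comm]
  have h2 : ∀ v : V, ∑ Ψ : AddChar G ℂ, Ψ (-(v : G)) * Ψ x =
      if x = v then (Fintype.card G : ℂ) else 0 := by
    intro v
    have := AddChar.sum_apply_eq_ite (-(v : G) + x)
    simp only [AddChar.map_add_eq_mul, neg_add_eq_zero] at this
    rw [this]
    simp only [eq_comm]
  simp only [h2]
  split_ifs with hx
  · rw [Finset.sum_eq_single (⟨x, hx⟩ : V)]
    · simp [hG]
    · intro v _ hv
      rw [if_neg]
      rintro rfl
      exact hv rfl
    · simp
  · rw [Finset.sum_eq_zero, mul_zero]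
    intro v _
    rw [if_neg]
    rintro rfl
    exact hx v.2

lemma sum_subgroupCoeff (V : AddSubgroup G) : ∑ Ψ, subgroupCoeff V Ψ = 1 := by
  have := sum_subgroupCoeff_mul V 0
  simp only [AddChar.map_zero_eq_one, mul_one, V.zero_mem, if_true] at this
  exact_mod_cast this

lemma subgroupCoeff_one (V : AddSubgroup G) : subgroupCoeff V 1 = (V.index : ℝ)⁻¹ := by
  simp [subgroupCoeff]

lemma subgroupCoeff_nonneg (V : AddSubgroup G) (Ψ : AddChar G ℂ) : 0 ≤ subgroupCoeff V Ψ := by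
  unfold subgroupCoeff; positivity

lemma FourierRep.indicator (V : AddSubgroup G) :
    FourierRep V (V.index : ℝ)⁻¹ 1 (fun x => if x ∈ V then 1 else 0) := by
  refine ⟨fun Ψ => subgroupCoeff V Ψ, ?_, ?_, ?_, ?_⟩
  · intro x; rw [sum_subgroupCoeff_mul]; split_ifs with h <;> simp [h]
  · intro Ψ hΨ
    by_contra h
    simp [subgroupCoeff, h] at hΨ
  · beta_reduce
    rw [subgroupCoeff_one]
  · rw [← sum_subgroupCoeff V]
    refine Finset.sum_le_sum fun Ψ _ => ?_
    rw [Complex.norm_real, Real.norm_of_nonneg (subgroupCoeff_nonneg V Ψ)]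

lemma FourierRep.indicator_sdiff {U V : AddSubgroup G} (hUV : V ≤ U) :
    FourierRep V ((U.index : ℝ)⁻¹ - (V.index : ℝ)⁻¹)
      (2 * U.index * ((U.index : ℝ)⁻¹ - (V.index : ℝ)⁻¹))
      (fun x => if x ∈ U ∧ x ∉ V then 1 else 0) := by
  have hU : (0 : ℝ) < U.index := by exact_mod_cast Nat.pos_of_ne_zero U.index_ne_zero_of_finite
  have hV : (0 : ℝ) < V.index := by exact_mod_cast Nat.pos_of_ne_zero V.index_ne_zero_of_finite
  have hle : (U.index : ℝ) ≤ V.index := by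
    exact_mod_cast Nat.le_of_dvd (by exact_mod_cast hV) (AddSubgroup.index_dvd_of_le hUV)
  refine ⟨fun Ψ => ((subgroupCoeff U Ψ - subgroupCoeff V Ψ : ℝ) : ℂ), ?_, ?_, ?_, ?_⟩
  · intro x
    simp only [Complex.ofReal_sub, sub_mul]
    rw [Finset.sum_sub_distrib, sum_subgroupCoeff_mul, sum_subgroupCoeff_mul]
    by_cases h1 : x ∈ U <;> by_cases h2 : x ∈ V <;> simp [h1, h2]
    exact h1 (hUV h2)
  · intro Ψ hΨ
    by_contra h
    have h' : ¬ ∀ v ∈ U, Ψ v = 1 := fun hu => h fun v hv => hu v (hUV hv)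
    simp [subgroupCoeff, h, h'] at hΨ
  · beta_reduce
    rw [subgroupCoeff_one, subgroupCoeff_one]
  · have hpt : ∀ Ψ : AddChar G ℂ, ‖((subgroupCoeff U Ψ - subgroupCoeff V Ψ : ℝ) : ℂ)‖ =
        subgroupCoeff V Ψ + subgroupCoeff U Ψ * (1 - 2 * (U.index / V.index)) := by
      intro Ψ
      rw [Complex.norm_real, Real.norm_eq_abs]
      by_cases hu : ∀ v ∈ U, Ψ v = 1
      · have hv : ∀ v ∈ V, Ψ v = 1 := fun v hv => hu v (hUV hv)
        rw [subgroupCoeff, subgroupCoeff, if_pos hu, if_pos hv, abs_of_nonneg]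
        · field_simp; ring
        · exact sub_nonneg.2 (inv_anti₀ hU hle)
      · have e : subgroupCoeff U Ψ = 0 := by rw [subgroupCoeff, if_neg hu]
        rw [e, zero_sub, abs_neg, abs_of_nonneg (subgroupCoeff_nonneg V Ψ)]
        ring
    simp only [hpt]
    rw [Finset.sum_add_distrib, ← Finset.sum_mul, sum_subgroupCoeff, sum_subgroupCoeff]
    apply le_of_eq
    field_simp
    ring

/-- An abstract prime sieve: if the nontrivial character sums over the points `π y` are at most
`E₀`, then some point satisfies all conditions. -/
theorem exists_of_sieve {ι : Type*} (s t : Finset ι) (hst : Disjoint s t)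
    (V : ι → AddSubgroup G) (c N C : ι → ℝ) (f : ι → G → ℝ)
    (hf : ∀ i ∈ s, FourierRep (V i) (c i) (N i) (f i))
    (hf0 : ∀ i ∈ s, ∀ x, f i x = 0 ∨ f i x = 1)
    (hc : ∀ i ∈ s, 0 < c i) (hN : ∀ i ∈ s, 0 ≤ N i) (hNC : ∀ i ∈ s, N i ≤ C i * c i)
    (hV : ∀ u ⊆ s ∪ t, ∀ i ∈ s ∪ t, i ∉ u → V i ⊔ ⨅ j ∈ u, V j = ⊤)
    {Y : Type*} [Fintype Y] (π : Y → G) {E₀ : ℝ} (hE₀ : 0 ≤ E₀)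
    (hE : ∀ Ψ : AddChar G ℂ, Ψ ≠ 1 → ‖∑ y, Ψ (π y)‖ ≤ E₀)
    {D : ℝ} (hD : D = 1 - ∑ i ∈ t, ((V i).index : ℝ)⁻¹) (hDpos : 0 < D)
    (hlt : E₀ * (∏ i ∈ s, C i) * ((t.card - 1) / D + 2) < Fintype.card Y + E₀) :
    ∃ y, (∀ i ∈ s, f i (π y) = 1) ∧ ∀ i ∈ t, π y ∉ V i := by
  by_contra hcon
  push Not at hcon
  have hrep := FourierRep.prod s V c N f hf
    (fun u hu i hi => hV u (hu.trans Finset.subset_union_left) i (Finset.mem_union_left _ hi))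
  set θ := ∏ i ∈ s, c i
  set X := ∏ i ∈ s, C i
  have hθ : 0 < θ := Finset.prod_pos hc
  have hNX : ∏ i ∈ s, N i ≤ X * θ := by
    rw [← Finset.prod_mul_distrib]
    exact Finset.prod_le_prod hN hNC
  have hN0 : 0 ≤ ∏ i ∈ s, N i := Finset.prod_nonneg hN
  have hT0 := abs_le.1 (hrep.abs_sum_sub_le hθ.le π hE₀ hE)
  have hTi : ∀ i ∈ t, -(E₀ * (X * θ * (1 - ((V i).index : ℝ)⁻¹))) ≤
      ∑ y, (∏ j ∈ s, f j (π y)) * (((V i).index : ℝ)⁻¹ - if π y ∈ V i then 1 else 0) := by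
    intro i hi
    have hidx : (1 : ℝ) ≤ (V i).index := by
      exact_mod_cast Nat.one_le_iff_ne_zero.2 (V i).index_ne_zero_of_finite
    have hinv : ((V i).index : ℝ)⁻¹ ≤ 1 := inv_le_one_of_one_le₀ hidx
    have h1 := hrep.mul ((FourierRep.indicator (V i)).const_sub (by positivity))
      (by
        rw [sup_comm]
        exact hV s Finset.subset_union_left i (Finset.mem_union_right _ hi)
          (Finset.disjoint_right.1 hst hi))
    have h2 := (abs_le.1 (h1.abs_sum_sub_le (by simp) π hE₀ hE)).1
    simp only [mul_zero, zero_mul, sub_zero] at h2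
    refine le_trans (neg_le_neg ?_) h2
    gcongr
  have hpt : ∀ y, (∏ j ∈ s, f j (π y)) * (1 - ∑ i ∈ t, if π y ∈ V i then (1 : ℝ) else 0) ≤ 0 := by
    intro y
    by_cases hy : ∀ i ∈ s, f i (π y) = 1
    · obtain ⟨i, hi, hiy⟩ := hcon y hy
      rw [Finset.prod_eq_one hy, one_mul, sub_nonpos]
      refine le_trans ?_ (Finset.single_le_sum (f := fun i => if π y ∈ V i then (1 : ℝ) else 0)
        (fun j _ => by positivity) hi)
      simp [hiy]
    · push Not at hy
      obtain ⟨i, hi, hne⟩ := hy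
      rw [Finset.prod_eq_zero hi ((hf0 i hi _).resolve_right hne), zero_mul]
  have hsum : D * ∑ y, ∏ j ∈ s, f j (π y) + ∑ i ∈ t, ∑ y, (∏ j ∈ s, f j (π y)) *
      (((V i).index : ℝ)⁻¹ - if π y ∈ V i then 1 else 0) ≤ 0 := by
    rw [Finset.sum_comm, Finset.mul_sum, ← Finset.sum_add_distrib]
    refine Finset.sum_nonpos fun y _ => le_trans (le_of_eq ?_) (hpt y)
    rw [← Finset.mul_sum, Finset.sum_sub_distrib, hD]
    ring
  have hTsum := Finset.sum_le_sum hTi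
  rw [Finset.sum_neg_distrib, ← Finset.mul_sum, ← Finset.mul_sum, Finset.sum_sub_distrib,
    Finset.sum_const, nsmul_eq_mul, mul_one] at hTsum
  have hε : ∑ i ∈ t, ((V i).index : ℝ)⁻¹ = 1 - D := by linarith
  rw [hε] at hTsum
  have h3 : θ * (Fintype.card Y - E₀ * (X - 1)) ≤ ∑ y, ∏ j ∈ s, f j (π y) := by
    have : E₀ * (∏ i ∈ s, N i - θ) ≤ E₀ * (X * θ - θ) := by gcongr
    linarith [hT0.1]
  have h4 : D * (θ * (Fintype.card Y - E₀ * (X - 1))) ≤ E₀ * (X * θ * (t.card - (1 - D))) := by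
    have := mul_le_mul_of_nonneg_left h3 hDpos.le
    linarith
  have h5 : D * (Fintype.card Y - E₀ * (X - 1)) ≤ E₀ * X * (t.card - 1 + D) := by
    refine le_of_mul_le_mul_left ?_ hθ
    linarith
  have h6 : D * (E₀ * X * ((t.card - 1) / D + 2)) = E₀ * X * (t.card - 1 + 2 * D) := by
    field_simp
  have h7 := mul_lt_mul_of_pos_left hlt hDpos
  rw [h6] at h7
  linarith

end FourierSieve

section ModuleSieve

variable {R : Type*} [CommRing R] {G : Type*} [AddCommGroup G] (ρ : R →+* AddMonoid.End G)

/-- The subgroup of multiples of `x` in `G`, for an action `ρ` of `R` on `G`. -/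
def actRange (x : R) : AddSubgroup G where
  carrier := {v | ∃ w, ρ x w = v}
  zero_mem' := ⟨0, map_zero _⟩
  add_mem' := by
    rintro _ _ ⟨v, rfl⟩ ⟨w, rfl⟩
    exact ⟨v + w, map_add _ _ _⟩
  neg_mem' := by
    rintro _ ⟨v, rfl⟩
    exact ⟨-v, map_neg _ _⟩

lemma actRange_le_of_dvd {x y : R} (h : x ∣ y) :
    actRange ρ y ≤ actRange ρ x := by
  obtain ⟨z, rfl⟩ := h
  rintro _ ⟨v, rfl⟩
  exact ⟨ρ z v, by rw [map_mul]; rfl⟩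

lemma actRange_sup_iInf {ι : Type*} (x : R) (u : Finset ι) (y : ι → R)
    (h : ∀ j ∈ u, IsCoprime x (y j)) :
    actRange ρ x ⊔ ⨅ j ∈ u, actRange ρ (y j) = ⊤ := by
  obtain ⟨a, b, hab⟩ := IsCoprime.prod_right h
  rw [eq_top_iff]
  intro v _
  have hv : v = ρ x (ρ a v) + ρ (∏ j ∈ u, y j) (ρ b v) := by
    have := DFunLike.congr_fun (congrArg ρ hab) v
    rw [mul_comm a, mul_comm b, map_add, map_mul, map_mul, map_one] at this
    exact this.symm
  rw [hv]
  refine AddSubgroup.add_mem_sup ⟨_, rfl⟩ ?_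
  simp only [AddSubgroup.mem_iInf]
  exact fun j hj => actRange_le_of_dvd ρ (Finset.dvd_prod_of_mem y hj) ⟨_, rfl⟩

/-- The sieve for the conditions of divisibility by `N i ^ b i`, but not by `N i ^ (b i + 1)`. -/
theorem exists_of_module_sieve [Fintype G] (M : R) (ν : R → ℕ)
    (hν : ∀ x, x ∣ M → (actRange ρ x).index = ν x)
    {ι : Type*} (s t : Finset ι) (hst : Disjoint s t) (N : ι → R) (b : ι → ℕ)
    (hcop : ∀ i, i ∈ s ∨ i ∈ t → ∀ j, j ∈ s ∨ j ∈ t → i ≠ j → IsCoprime (N i) (N j))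
    (hs : ∀ i ∈ s, N i ^ b i ∣ M) (ht : ∀ i ∈ t, b i = 0 ∧ N i ∣ M)
    (hlt : ∀ i ∈ s, N i ^ (b i + 1) ∣ M → ν (N i ^ b i) < ν (N i ^ (b i + 1)))
    {Y : Type*} [Fintype Y] (π : Y → G) {E₀ : ℝ} (hE₀ : 0 ≤ E₀)
    (hE : ∀ Ψ : AddChar G ℂ, Ψ ≠ 1 → ‖∑ y, Ψ (π y)‖ ≤ E₀)
    {D : ℝ} (hD : D = 1 - ∑ i ∈ t, (ν (N i) : ℝ)⁻¹) (hDpos : 0 < D)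
    (hbound : E₀ * (∏ i ∈ s, (if N i ^ (b i + 1) ∣ M then 2 else 1) * (ν (N i ^ b i) : ℝ)) *
      ((t.card - 1) / D + 2) < Fintype.card Y + E₀) :
    ∃ y, (∀ i ∈ s, π y ∈ actRange ρ (N i ^ b i) ∧
      (N i ^ (b i + 1) ∣ M → π y ∉ actRange ρ (N i ^ (b i + 1)))) ∧
      ∀ i ∈ t, π y ∉ actRange ρ (N i) := by
  set e : ι → ℕ := fun i => if N i ^ (b i + 1) ∣ M then b i + 1 else b i with he
  have het : ∀ i ∈ t, e i = 1 := by
    intro i hi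
    obtain ⟨h0, hd⟩ := ht i hi
    simp [he, h0, hd]
  have hpos : ∀ x, x ∣ M → (0 : ℝ) < ν x := by
    intro x hx
    rw [← hν x hx]
    exact_mod_cast Nat.pos_of_ne_zero (AddSubgroup.index_ne_zero_of_finite)
  obtain ⟨y, hys, hyt⟩ := exists_of_sieve s t hst
    (fun i => actRange ρ (N i ^ e i))
    (fun i => (ν (N i ^ b i) : ℝ)⁻¹ -
      if N i ^ (b i + 1) ∣ M then (ν (N i ^ (b i + 1)) : ℝ)⁻¹ else 0)
    (fun i => if N i ^ (b i + 1) ∣ M then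
      2 * (ν (N i ^ b i) : ℝ) * ((ν (N i ^ b i) : ℝ)⁻¹ - (ν (N i ^ (b i + 1)) : ℝ)⁻¹) else 1)
    (fun i => (if N i ^ (b i + 1) ∣ M then 2 else 1) * (ν (N i ^ b i) : ℝ))
    (fun i x => if x ∈ actRange ρ (N i ^ b i) ∧
      (N i ^ (b i + 1) ∣ M → x ∉ actRange ρ (N i ^ (b i + 1))) then 1 else 0)
    (by
      intro i hi
      by_cases h : N i ^ (b i + 1) ∣ M
      · have := FourierRep.indicator_sdiff
          (actRange_le_of_dvd ρ (pow_dvd_pow (N i) (Nat.le_succ (b i))))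
        rw [hν _ (hs i hi), hν _ h] at this
        simpa [he, h] using this
      · have := FourierRep.indicator (actRange ρ (N i ^ b i))
        rw [hν _ (hs i hi)] at this
        simpa [he, h] using this)
    (by intro i _ x; split_ifs <;> simp)
    (by
      intro i hi
      split_ifs with h
      · exact sub_pos.2 (inv_strictAnti₀ (hpos _ (hs i hi)) (by exact_mod_cast hlt i hi h))
      · simpa using hpos _ (hs i hi))
    (by
      intro i hi
      split_ifs with h
      · have := inv_strictAnti₀ (hpos _ (hs i hi)) (Nat.cast_lt.2 (hlt i hi h))
        have := sub_nonneg.2 this.le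
        positivity
      · exact zero_le_one)
    (by
      intro i hi
      split_ifs with h
      · rfl
      · have := hpos _ (hs i hi)
        rw [sub_zero, one_mul, mul_inv_cancel₀ this.ne'])
    (by
      intro u hu i hi hiu
      refine actRange_sup_iInf ρ _ u _ fun j hj => IsCoprime.pow ?_
      exact hcop i (Finset.mem_union.1 hi) j (Finset.mem_union.1 (hu hj)) (fun hij => hiu (hij ▸ hj)))
    π hE₀ hE
    (by
      rw [hD]
      congr 1
      refine Finset.sum_congr rfl fun i hi => ?_
      rw [het i hi, pow_one, hν _ (ht i hi).2])
    hDpos hbound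
  refine ⟨y, fun i hi => ?_, fun i hi => ?_⟩
  · by_contra h
    have := hys i hi
    rw [if_neg h] at this
    exact zero_ne_one this
  · have := hyt i hi
    rwa [het i hi, pow_one] at this

end ModuleSieve

section FrobeniusAction

variable (Fq F : Type*) [Field Fq] [Field F] [Fintype Fq] [Algebra Fq F]

/-- The action of `Fq[X]` on `F` in which `X` acts as the Frobenius map. -/
def frobAct : Fq[X] →ₐ[Fq] Module.End Fq F :=
  aeval (FiniteField.frobeniusAlgHom Fq F).toLinearMap

variable {Fq F}

lemma frobenius_pow_apply (i : ℕ) (β : F) :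
    ((FiniteField.frobeniusAlgHom Fq F).toLinearMap ^ i) β = β ^ Fintype.card Fq ^ i := by
  induction i with
  | zero => simp
  | succ i ih =>
    rw [pow_succ', Module.End.mul_apply, ih, AlgHom.toLinearMap_apply,
      FiniteField.frobeniusAlgHom_apply, ← pow_mul, ← pow_succ]

lemma polyAct_eq_frobAct (h : Fq[X]) (β : F) :
    polyAct (Fintype.card Fq) h β = frobAct Fq F h β := by
  rw [polyAct, frobAct, aeval_eq_sum_range, Polynomial.sum_over_range _ (by simp),
    LinearMap.sum_apply]
  simp only [LinearMap.smul_apply, frobenius_pow_apply]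
  simp only [Algebra.smul_def]

lemma card_range_mul_card_ker (h : Fq[X]) :
    Nat.card (LinearMap.range (frobAct Fq F h)) * Nat.card (LinearMap.ker (frobAct Fq F h)) =
      Nat.card F := by
  have h1 := (LinearMap.ker (frobAct Fq F h)).toAddSubgroup.card_mul_index
  rw [mul_comm, ← h1]
  congr 1
  exact (AddSubgroup.index_ker (frobAct Fq F h).toAddMonoidHom).symm

variable (Fq F)

/-- The componentwise action on `F × Fˣ × F`: polynomials act on the outer factors through the
Frobenius map, integers act on the middle factor by taking powers. -/
def sieveAct : Fq[X] × ℤ × Fq[X] →+* AddMonoid.End (F × Additive Fˣ × F) where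
  toFun x := (frobAct Fq F x.1).toAddMonoidHom.prodMap
    ((zsmulAddGroupHom x.2.1).prodMap (frobAct Fq F x.2.2).toAddMonoidHom)
  map_one' := DFunLike.ext _ _ fun v => by
    change (frobAct Fq F 1 v.1, (1 : ℤ) • v.2.1, frobAct Fq F 1 v.2.2) = v
    simp
  map_mul' x y := DFunLike.ext _ _ fun v => by
    change (frobAct Fq F (x.1 * y.1) v.1, (x.2.1 * y.2.1) • v.2.1,
      frobAct Fq F (x.2.2 * y.2.2) v.2.2) = (frobAct Fq F x.1 (frobAct Fq F y.1 v.1),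
        x.2.1 • y.2.1 • v.2.1, frobAct Fq F x.2.2 (frobAct Fq F y.2.2 v.2.2))
    simp [mul_smul]
  map_zero' := DFunLike.ext _ _ fun v => by
    change (frobAct Fq F 0 v.1, (0 : ℤ) • v.2.1, frobAct Fq F 0 v.2.2) = 0
    simp
  map_add' x y := DFunLike.ext _ _ fun v => by
    change (frobAct Fq F (x.1 + y.1) v.1, (x.2.1 + y.2.1) • v.2.1,
      frobAct Fq F (x.2.2 + y.2.2) v.2.2) = (frobAct Fq F x.1 v.1 + frobAct Fq F y.1 v.1,
        x.2.1 • v.2.1 + y.2.1 • v.2.1, frobAct Fq F x.2.2 v.2.2 + frobAct Fq F y.2.2 v.2.2)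
    simp [add_zsmul]

variable {Fq F}

lemma mem_actRange_sieveAct (x : Fq[X] × ℤ × Fq[X]) (v : F × Additive Fˣ × F) :
    v ∈ actRange (sieveAct Fq F) x ↔ (∃ a, frobAct Fq F x.1 a = v.1) ∧
      (∃ u : Fˣ, u ^ x.2.1 = v.2.1.toMul) ∧ ∃ b, frobAct Fq F x.2.2 b = v.2.2 := by
  constructor
  · rintro ⟨w, rfl⟩
    exact ⟨⟨w.1, rfl⟩, ⟨w.2.1.toMul, rfl⟩, ⟨w.2.2, rfl⟩⟩
  · rintro ⟨⟨a, ha⟩, ⟨u, hu⟩, ⟨b, hb⟩⟩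
    exact ⟨(a, Additive.ofMul u, b), Prod.ext ha (Prod.ext hu hb)⟩

variable [Fintype F]

lemma frobAct_X_pow_sub_one : frobAct Fq F (X ^ Module.finrank Fq F - 1) = 0 := by
  ext β
  rw [frobAct, map_sub, map_pow, aeval_X, map_one, LinearMap.sub_apply, frobenius_pow_apply,
    ← Module.card_eq_pow_finrank, FiniteField.pow_card]
  simp

lemma card_ker_frobAct_le {h : Fq[X]} (h0 : h ≠ 0) :
    Nat.card (LinearMap.ker (frobAct Fq F h)) ≤ Fintype.card Fq ^ h.natDegree := by
  set q := Fintype.card Fq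
  have hq : 1 < q := Fintype.one_lt_card
  set P : F[X] := ∑ i ∈ Finset.range (h.natDegree + 1),
    Polynomial.C (algebraMap Fq F (h.coeff i)) * X ^ q ^ i with hP
  have hdeg : P.natDegree ≤ q ^ h.natDegree := by
    refine natDegree_sum_le_of_forall_le _ _ fun i hi => ?_
    refine (natDegree_C_mul_X_pow_le _ _).trans (Nat.pow_le_pow_right hq.le ?_)
    exact Nat.lt_succ_iff.1 (Finset.mem_range.1 hi)
  have hP0 : P ≠ 0 := by
    intro hz
    have := congrArg (fun p : F[X] => p.coeff (q ^ h.natDegree)) hz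
    simp only [hP, finsetSum_coeff, coeff_C_mul, coeff_X_pow, coeff_zero,
      (Nat.pow_right_injective hq).eq_iff] at this
    simp [h0] at this
  have heval : ∀ β ∈ LinearMap.ker (frobAct Fq F h), β ∈ P.roots := by
    intro β hβ
    rw [LinearMap.mem_ker, ← polyAct_eq_frobAct, polyAct,
      Polynomial.sum_over_range _ (by simp)] at hβ
    rw [mem_roots hP0, IsRoot.def, hP, eval_finsetSum]
    simpa using hβ
  calc Nat.card (LinearMap.ker (frobAct Fq F h)) ≤ P.roots.toFinset.card := by
        rw [← Nat.card_eq_finsetCard]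
        exact Nat.card_le_card_of_injective
          (fun β => ⟨β.1, Multiset.mem_toFinset.2 (heval _ β.2)⟩)
          (fun β γ h => Subtype.ext (congrArg (fun x => x.1) h))
    _ ≤ Multiset.card P.roots := Multiset.toFinset_card_le _
    _ ≤ _ := (card_roots' P).trans hdeg

/-- For a factorisation of `x ^ n - 1`, the kernel of one factor is the image of the other. -/
lemma range_frobAct_eq_ker {h h' : Fq[X]} (hh : h * h' = X ^ Module.finrank Fq F - 1) :
    LinearMap.range (frobAct Fq F h) = LinearMap.ker (frobAct Fq F h') ∧
      Nat.card (LinearMap.ker (frobAct Fq F h')) = Fintype.card Fq ^ h'.natDegree := by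
  set q := Fintype.card Fq
  have hq : 0 < q := Fintype.card_pos
  have hn : 0 < Module.finrank Fq F := Module.finrank_pos
  have hne : (X ^ Module.finrank Fq F - 1 : Fq[X]) ≠ 0 := by
    simpa using X_pow_sub_C_ne_zero hn (1 : Fq)
  have h0 : h ≠ 0 := by rintro rfl; exact hne (by simpa using hh.symm)
  have h0' : h' ≠ 0 := by rintro rfl; exact hne (by simpa using hh.symm)
  have hdeg : h.natDegree + h'.natDegree = Module.finrank Fq F := by
    rw [← natDegree_mul h0 h0', hh]
    simpa using natDegree_X_pow_sub_C (n := Module.finrank Fq F) (r := (1 : Fq))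
  have hle : LinearMap.range (frobAct Fq F h) ≤ LinearMap.ker (frobAct Fq F h') := by
    rintro _ ⟨v, rfl⟩
    rw [LinearMap.mem_ker, ← Module.End.mul_apply, ← map_mul, mul_comm, hh,
      frobAct_X_pow_sub_one, LinearMap.zero_apply]
  have h1 := card_range_mul_card_ker (F := F) h
  rw [Nat.card_eq_fintype_card (α := F), Module.card_eq_pow_finrank (K := Fq), ← hdeg,
    pow_add] at h1
  have h2 := card_ker_frobAct_le (F := F) h0
  have h3 := card_ker_frobAct_le (F := F) h0'
  have h4 : Nat.card (LinearMap.range (frobAct Fq F h)) ≤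
      Nat.card (LinearMap.ker (frobAct Fq F h')) :=
    Nat.card_le_card_of_injective _ (Submodule.inclusion_injective hle)
  have h5 : q ^ h'.natDegree ≤ Nat.card (LinearMap.range (frobAct Fq F h)) := by
    refine Nat.le_of_mul_le_mul_left (c := q ^ h.natDegree) ?_ (by positivity)
    rw [← h1, mul_comm]
    exact Nat.mul_le_mul_right _ h2
  refine ⟨?_, le_antisymm h3 (h5.trans h4)⟩
  apply SetLike.coe_injective
  refine Set.eq_of_subset_of_ncard_le hle ?_ (Set.toFinite _)
  exact h3.trans h5

lemma index_range_frobAct {h : Fq[X]} (hh : h ∣ X ^ Module.finrank Fq F - 1) :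
    (LinearMap.range (frobAct Fq F h)).toAddSubgroup.index = Fintype.card Fq ^ h.natDegree := by
  obtain ⟨h', hh'⟩ := hh
  rw [← (range_frobAct_eq_ker ((mul_comm _ _).trans hh'.symm)).2]
  exact AddSubgroup.index_range (f := (frobAct Fq F h).toAddMonoidHom)

/-- The index of the multiples of a divisor of `(x ^ n - 1, q ^ n - 1, x ^ n - 1)`. -/
def sieveNorm (x : Fq[X] × ℤ × Fq[X]) : ℕ :=
  Fintype.card Fq ^ x.1.natDegree * (x.2.1.natAbs * Fintype.card Fq ^ x.2.2.natDegree)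

lemma index_actRange_sieveAct {x : Fq[X] × ℤ × Fq[X]}
    (hx₁ : x.1 ∣ X ^ Module.finrank Fq F - 1) (hx₂ : x.2.1.natAbs ∣ Fintype.card F - 1)
    (hx₃ : x.2.2 ∣ X ^ Module.finrank Fq F - 1) :
    (actRange (sieveAct Fq F) x).index = sieveNorm x := by
  have hpow : ∀ v : Fˣ, (∃ w : Fˣ, w ^ x.2.1 = v) ↔ ∃ w : Fˣ, w ^ x.2.1.natAbs = v := by
    intro v
    rcases Int.natAbs_eq x.2.1 with h | h
    · rw [h, Int.natAbs_natCast]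
      simp only [zpow_natCast]
    · rw [h, Int.natAbs_neg, Int.natAbs_natCast]
      simp only [zpow_neg, zpow_natCast, ← inv_pow]
      exact ⟨fun ⟨w, hw⟩ => ⟨w⁻¹, hw⟩, fun ⟨w, hw⟩ => ⟨w⁻¹, by rwa [inv_inv]⟩⟩
  have h1 : actRange (sieveAct Fq F) x = (LinearMap.range (frobAct Fq F x.1)).toAddSubgroup.prod
      ((powMonoidHom (α := Fˣ) x.2.1.natAbs).range.toAddSubgroup.prod
        (LinearMap.range (frobAct Fq F x.2.2)).toAddSubgroup) := by
    ext v
    rw [mem_actRange_sieveAct, hpow]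
    rfl
  rw [h1, AddSubgroup.index_prod, AddSubgroup.index_prod, index_range_frobAct hx₁,
    index_range_frobAct hx₃, sieveNorm]
  have : (powMonoidHom (α := Fˣ) x.2.1.natAbs).range.toAddSubgroup.index = x.2.1.natAbs := by
    rw [Subgroup.index_toAddSubgroup, IsCyclic.index_powMonoidHom_range, Nat.card_eq_fintype_card,
      Fintype.card_units, Nat.gcd_eq_right hx₂]
  rw [this]

end FrobeniusAction

section FibreSums

variable {F : Type*} [Field F] [Fintype F]

lemma sum_fibre_addChar (L : F →+ F) (ψ : AddChar F ℂ) (α : F) :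
    ∑ β with L β = α, ψ β =
      ∑ φ : AddChar F ℂ with ψ * φ.compAddMonoidHom L = 1, φ⁻¹ α := by
  have hQ : (Fintype.card F : ℂ) ≠ 0 := by exact_mod_cast Fintype.card_ne_zero
  apply mul_left_cancel₀ hQ
  have h1 : ∀ β, (if L β = α then (Fintype.card F : ℂ) else 0) =
      ∑ φ : AddChar F ℂ, φ (L β) * φ⁻¹ α := by
    intro β
    have := AddChar.sum_apply_eq_ite (L β - α)
    simp only [sub_eq_zero] at this
    rw [← this]
    refine Finset.sum_congr rfl fun φ _ => ?_
    rw [sub_eq_add_neg, AddChar.map_add_eq_mul, AddChar.inv_apply]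
  have h2 : ∀ φ : AddChar F ℂ, ∑ β, ψ β * φ (L β) =
      if ψ * φ.compAddMonoidHom L = 1 then (Fintype.card F : ℂ) else 0 := by
    intro φ
    exact AddChar.sum_eq_ite (ψ * φ.compAddMonoidHom L)
  calc _ = ∑ β, ψ β * (if L β = α then (Fintype.card F : ℂ) else 0) := by
        rw [Finset.mul_sum, Finset.sum_filter]
        refine Finset.sum_congr rfl fun β _ => ?_
        split_ifs <;> ring
    _ = ∑ φ : AddChar F ℂ, (∑ β, ψ β * φ (L β)) * φ⁻¹ α := by
        simp only [h1, Finset.mul_sum, Finset.sum_mul]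
        rw [Finset.sum_comm]
        simp only [mul_assoc]
    _ = _ := by
        simp only [h2]
        rw [Finset.mul_sum, Finset.sum_filter]
        refine Finset.sum_congr rfl fun β _ => ?_
        split_ifs <;> ring

lemma card_filter_addChar_le (L : F →+ F) (ψ : AddChar F ℂ) :
    (Finset.univ.filter fun φ : AddChar F ℂ => ψ * φ.compAddMonoidHom L = 1).card ≤
      Nat.card L.ker := by
  have h := sum_fibre_addChar L ψ 0
  simp only [AddChar.map_zero_eq_one, Finset.sum_const, nsmul_eq_mul, mul_one] at h
  have h2 := norm_sum_le_of_le (Finset.univ.filter fun β => L β = 0)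
    (f := fun β => ψ β) (n := fun _ => 1) (fun β _ => norm_addChar_le ψ β)
  rw [h, Complex.norm_natCast, Finset.sum_const, nsmul_eq_mul, mul_one] at h2
  have h3 : Nat.card L.ker = (Finset.univ.filter fun β => L β = 0).card := by
    rw [Nat.card_eq_fintype_card]
    exact Fintype.card_of_subtype _ (by simp [AddMonoidHom.mem_ker])
  rw [h3]
  exact_mod_cast h2

/-- The points over which the sieve runs. -/
def sievePoint (L : F →+ F) (β : {β : F // L β ≠ 0}) : F × Additive Fˣ × F :=
  (β, Additive.ofMul (Units.mk0 (L β) β.2), (L β)⁻¹)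

theorem norm_sum_sievePoint_le (L : F →+ F) (Ψ : AddChar (F × Additive Fˣ × F) ℂ)
    (hΨ : Ψ ≠ 1) :
    ‖∑ β, Ψ (sievePoint L β)‖ ≤ 2 * √(Fintype.card F : ℝ) * Nat.card L.ker := by
  set ψ₁ : AddChar F ℂ := Ψ.compAddMonoidHom (AddMonoidHom.inl _ _)
  set χ : AddChar (Additive Fˣ) ℂ :=
    Ψ.compAddMonoidHom ((AddMonoidHom.inr _ _).comp (AddMonoidHom.inl _ _))
  set ψ₂ : AddChar F ℂ :=
    Ψ.compAddMonoidHom ((AddMonoidHom.inr _ _).comp (AddMonoidHom.inr _ _))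
  have hsplit : ∀ v, Ψ v = ψ₁ v.1 * χ v.2.1 * ψ₂ v.2.2 := by
    intro v
    simp only [ψ₁, χ, ψ₂, AddChar.compAddMonoidHom_apply, ← AddChar.map_add_eq_mul]
    simp
  set A := Finset.univ.filter fun φ : AddChar F ℂ => ψ₁ * φ.compAddMonoidHom L = 1
  have h1 : ∑ β, Ψ (sievePoint L β) = ∑ φ ∈ A, ∑ u : Fˣ,
      φ⁻¹ u * χ (Additive.ofMul u) * ψ₂ ((u⁻¹ : Fˣ) : F) := by
    rw [Finset.sum_comm]
    calc _ = ∑ u : Fˣ, ∑ β ∈ Finset.univ.filter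
          (fun β : {β : F // L β ≠ 0} => Units.mk0 (L β) β.2 = u), Ψ (sievePoint L β) :=
        (Finset.sum_fiberwise _ _ _).symm
      _ = _ := by
        refine Finset.sum_congr rfl fun u _ => ?_
        simp only [mul_assoc]
        rw [← Finset.sum_mul, ← sum_fibre_addChar, Finset.sum_mul]
        symm
        have hne : ∀ β ∈ Finset.univ.filter (fun β => L β = (u : F)), L β ≠ 0 := by
          intro β hβ
          rw [(Finset.mem_filter.1 hβ).2]
          exact u.ne_zero
        refine Finset.sum_bij (fun β hβ => ⟨β, hne β hβ⟩) ?_ ?_ ?_ ?_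
        · intro β hβ
          simp only [Finset.mem_filter, Finset.mem_univ, true_and]
          exact Units.ext (Finset.mem_filter.1 hβ).2
        · intro β _ γ _ h
          exact congrArg Subtype.val h
        · intro β hβ
          refine ⟨β, ?_, rfl⟩
          simp only [Finset.mem_filter, Finset.mem_univ, true_and] at hβ ⊢
          rw [← hβ]; rfl
        · intro β hβ
          have hβ' : L β = u := (Finset.mem_filter.1 hβ).2
          rw [hsplit]
          simp only [sievePoint, hβ', Units.mk0_val, Units.val_inv_eq_inv_val, mul_assoc]
  have h2 : ∀ φ ∈ A, ‖∑ u : Fˣ, φ⁻¹ u * χ (Additive.ofMul u) * ψ₂ ((u⁻¹ : Fˣ) : F)‖ ≤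
      2 * √(Fintype.card F : ℝ) := by
    intro φ hφ
    apply norm_sum_units_le
    rintro ⟨e1, e2, e3⟩
    apply hΨ
    have e4 : ψ₁ = 1 := by
      have := (Finset.mem_filter.1 hφ).2
      rw [inv_eq_one] at e1
      rw [← this, e1]
      ext x
      simp
    ext v
    rw [hsplit, e2, e3, e4]
    simp
  rw [h1]
  calc _ ≤ ∑ φ ∈ A, 2 * √(Fintype.card F : ℝ) := norm_sum_le_of_le _ h2
    _ = 2 * √(Fintype.card F : ℝ) * A.card := by rw [Finset.sum_const, nsmul_eq_mul]; ring
    _ ≤ _ := by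
      gcongr
      exact card_filter_addChar_le L ψ₁

end FibreSums

section Freeness

lemma mem_actRange_prod {R G : Type*} [CommRing R] [AddCommGroup G] (ρ : R →+* AddMonoid.End G)
    {ι : Type*} (u : Finset ι) (y : ι → R)
    (hcop : ∀ i ∈ u, ∀ j ∈ u, i ≠ j → IsCoprime (y i) (y j)) {v : G}
    (hv : ∀ i ∈ u, v ∈ actRange ρ (y i)) : v ∈ actRange ρ (∏ i ∈ u, y i) := by
  induction u using Finset.induction_on with
  | empty => exact ⟨v, by simp⟩
  | insert i u hi ih =>
    rw [Finset.prod_insert hi]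
    obtain ⟨a, ha⟩ := hv i (Finset.mem_insert_self _ _)
    obtain ⟨b, hb⟩ := ih
      (fun i hi j hj => hcop i (Finset.mem_insert_of_mem hi) j (Finset.mem_insert_of_mem hj))
      (fun j hj => hv j (Finset.mem_insert_of_mem hj))
    obtain ⟨c, d, hcd⟩ : IsCoprime (y i) (∏ j ∈ u, y j) := IsCoprime.prod_right fun j hj =>
      hcop i (Finset.mem_insert_self _ _) j (Finset.mem_insert_of_mem hj)
        (fun h => hi (h ▸ hj))
    refine ⟨ρ c b + ρ d a, ?_⟩
    have hmul : ∀ x z w, ρ x (ρ z w) = ρ (x * z) w := fun x z w => by rw [map_mul]; rfl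
    have h1 : v = ρ (c * y i) v + ρ (d * ∏ j ∈ u, y j) v := by
      have := DFunLike.congr_fun (congrArg ρ hcd) v
      rw [map_add, map_one] at this
      exact this.symm
    have h2 : ρ (c * y i) v = ρ (y i * (∏ j ∈ u, y j) * c) b := by
      rw [← hb, hmul]
      congr 2
      ring
    have h3 : ρ (d * ∏ j ∈ u, y j) v = ρ (y i * (∏ j ∈ u, y j) * d) a := by
      rw [← ha, hmul]
      congr 2
      ring
    rw [map_add, hmul, hmul, ← h2, ← h3, ← h1]

variable {Fq F : Type*} [Field Fq] [Field F] [Fintype Fq] [Fintype F] [Algebra Fq F]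

lemma isPolyFree_of_forall_not_mem_range {h : Fq[X]} {β : F}
    (hβ : ∀ f : Fq[X], f.Monic → Irreducible f → f ∣ h → f ∣ X ^ Module.finrank Fq F - 1 →
      ∀ γ, frobAct Fq F f γ ≠ β) :
    IsPolyFree (Fintype.card Fq) (Module.finrank Fq F) h β := by
  set n := Module.finrank Fq F with hn
  have hmonic : (X ^ n - 1 : Fq[X]).Monic := by
    simpa using monic_X_pow_sub_C (1 : Fq) (n := n) Module.finrank_pos.ne'
  obtain ⟨f₀, ⟨hm, hd, h0⟩, hmin⟩ := WellFounded.has_min (measure fun f : Fq[X] => f.natDegree).wf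
    {f | f.Monic ∧ f ∣ (X ^ n - 1 : Fq[X]) ∧ frobAct Fq F f β = 0}
    ⟨X ^ n - 1, hmonic, dvd_rfl, by rw [hn, frobAct_X_pow_sub_one]; rfl⟩
  refine ⟨f₀, ⟨hm, hd, by rwa [polyAct_eq_frobAct], fun h' h1 h2 h3 => ?_⟩, ?_⟩
  · rw [polyAct_eq_frobAct] at h3
    exact not_lt.1 (hmin h' ⟨h1, h2, h3⟩)
  · obtain ⟨e, he⟩ := hd
    have hquot : (X ^ n - 1 : Fq[X]) / f₀ = e := by
      rw [he, mul_div_cancel_left₀ _ hm.ne_zero]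
    rw [hquot]
    have he0 : e ≠ 0 := by
      rintro rfl
      exact hmonic.ne_zero (by rw [he, mul_zero])
    refine isCoprime_of_prime_dvd (fun h => he0 h.2) fun f hf hfh hfe => ?_
    have hf' : normalize f ∣ e := by rwa [normalize_dvd_iff]
    obtain ⟨c, hc⟩ := hf'
    have hprod : normalize f * (f₀ * c) = X ^ n - 1 := by rw [he, hc]; ring
    have hker : β ∈ LinearMap.ker (frobAct Fq F (f₀ * c)) := by
      rw [LinearMap.mem_ker, mul_comm, map_mul, Module.End.mul_apply, h0, map_zero]
    rw [← (range_frobAct_eq_ker hprod).1] at hker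
    obtain ⟨γ, hγ⟩ := hker
    exact hβ (normalize f) (monic_normalize hf.ne_zero)
      ((normalize_associated f).irreducible_iff.2 hf.irreducible) (by rwa [normalize_dvd_iff])
      ⟨_, hprod.symm⟩ γ hγ

lemma gcd_div_orderOf_eq_one {m : ℕ} {α : Fˣ}
    (hα : ∀ p : ℕ, p.Prime → p ∣ m → p ∣ Fintype.card F - 1 → ∀ u : Fˣ, u ^ p ≠ α) :
    Nat.gcd m ((Fintype.card F - 1) / orderOf (α : F)) = 1 := by
  rw [orderOf_units]
  refine Nat.Coprime.gcd_eq_one (Nat.coprime_of_dvd fun p hp hpm hpd => ?_)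
  have hdvd : orderOf α ∣ Fintype.card F - 1 := by
    rw [← Fintype.card_units]; exact orderOf_dvd_card
  obtain ⟨c, hc⟩ := hpd
  have hQ : Fintype.card F - 1 = orderOf α * (p * c) := by
    rw [← hc, Nat.mul_div_cancel' hdvd]
  obtain ⟨ζ, hζ⟩ := IsCyclic.exists_generator (α := Fˣ)
  obtain ⟨j, rfl⟩ := (mem_powers_iff_mem_zpowers.2 (hζ α) : α ∈ Submonoid.powers ζ)
  have hord : orderOf ζ = Fintype.card F - 1 := by
    rw [← Fintype.card_units, orderOf_eq_card_of_forall_mem_zpowers hζ, Nat.card_eq_fintype_card]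
  have hpos : 0 < Fintype.card F - 1 := by rw [← hord]; exact orderOf_pos ζ
  simp only at hα hQ
  have h1 : orderOf ζ ∣ j * orderOf (ζ ^ j) := by
    rw [orderOf_dvd_iff_pow_eq_one, pow_mul, pow_orderOf_eq_one]
  rw [hord, hQ, mul_comm j] at h1
  have h2 : p * c ∣ j := Nat.dvd_of_mul_dvd_mul_left (orderOf_pos _) h1
  obtain ⟨i, rfl⟩ := (Dvd.intro c rfl).trans h2
  exact hα p hp hpm ⟨orderOf (ζ ^ (p * i)) * c, by rw [hQ]; ring⟩ (ζ ^ i)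
    (by rw [← pow_mul, mul_comm])

end Freeness

section Radicals

lemma primeFactors_radN_div {r M : ℕ} (hM : M ≠ 0) (hr : r ∣ M) :
    (radN M / radN r).primeFactors = M.primeFactors \ r.primeFactors := by
  have hsub : r.primeFactors ⊆ M.primeFactors := Nat.primeFactors_mono hr hM
  have hpos : 0 < ∏ p ∈ r.primeFactors, p :=
    Finset.prod_pos fun p hp => (Nat.prime_of_mem_primeFactors hp).pos
  rw [radN, radN, ← Finset.prod_sdiff hsub, Nat.mul_div_cancel _ hpos]
  exact Nat.primeFactors_prod fun p hp =>
    Nat.prime_of_mem_primeFactors (Finset.sdiff_subset hp)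

lemma radN_div_ne_zero {r M : ℕ} (hM : M ≠ 0) (hr : r ∣ M) : radN M / radN r ≠ 0 := by
  have hpos : ∀ m, 0 < radN m := fun m =>
    Finset.prod_pos fun p hp => (Nat.prime_of_mem_primeFactors hp).pos
  have hdvd : radN r ∣ radN M :=
    Finset.prod_dvd_prod_of_subset _ _ _ (Nat.primeFactors_mono hr hM)
  exact (Nat.div_pos (Nat.le_of_dvd (hpos M) hdvd) (hpos r)).ne'

lemma two_pow_card_le_Wnat {d : ℕ} (hd : d ≠ 0) : 2 ^ d.primeFactors.card ≤ Wnat d := by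
  have h := congrArg Multiset.card (Nat.divisors_filter_squarefree hd)
  rw [Multiset.card_map, Finset.card_val, Finset.card_val, Finset.card_powerset] at h
  have h' : (normalizedFactors d).toFinset = d.primeFactors := by
    rw [Nat.factors_eq]
    rfl
  rw [h'] at h
  rw [Wnat, ← h]

variable {K : Type*} [Field K]

lemma normalizedFactors_prod_finset {s : Finset K[X]}
    (hs : ∀ f ∈ s, f.Monic ∧ Irreducible f) : normalizedFactors (s.prod id) = s.val := by
  have h := normalizedFactors_prod_eq s.val fun f hf => (hs f hf).2
  rw [Multiset.map_congr rfl (fun f hf => (hs f hf).1.normalize_eq_self), Multiset.map_id'] at h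
  rwa [Finset.prod, Multiset.map_id]

lemma monic_of_mem_normalizedFactors {f g : K[X]} (hf : f ∈ normalizedFactors g) : f.Monic := by
  rw [← normalize_normalized_factor f hf]
  exact monic_normalize (irreducible_of_normalized_factor f hf).ne_zero

lemma mem_normalizedFactors_iff_monic {f g : K[X]} (hg : g ≠ 0) :
    f ∈ normalizedFactors g ↔ f.Monic ∧ Irreducible f ∧ f ∣ g := by
  refine ⟨fun h => ⟨monic_of_mem_normalizedFactors h, irreducible_of_normalized_factor f h,
    dvd_of_mem_normalizedFactors h⟩, fun ⟨h1, h2, h3⟩ => ?_⟩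
  exact (mem_normalizedFactors_iff' hg).2 ⟨h2, h1.normalize_eq_self, h3⟩

lemma isCoprime_of_monic_irreducible_ne {f f' : K[X]} (hf : f.Monic) (hfi : Irreducible f)
    (hf' : f'.Monic) (hfi' : Irreducible f') (hne : f ≠ f') : IsCoprime f f' := by
  rw [hfi.coprime_iff_not_dvd]
  exact fun h => hne (eq_of_monic_of_associated hf hf' (hfi.associated_of_dvd hfi' h))

lemma prod_pow_count_normalizedFactors {g : K[X]} (hg : g.Monic) :
    ∏ f ∈ (normalizedFactors g).toFinset, f ^ (normalizedFactors g).count f = g := by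
  have h := prod_normalizedFactors_eq hg.ne_zero
  rw [hg.normalize_eq_self] at h
  rw [← Finset.prod_multiset_count, h]

lemma normalizedFactors_radPoly_div {g M : K[X]} (hM : M ≠ 0) (hg : g ∣ M) :
    (normalizedFactors (radPoly M / radPoly g)).toFinset =
      (normalizedFactors M).toFinset \ (normalizedFactors g).toFinset := by
  have hg0 : g ≠ 0 := ne_zero_of_dvd_ne_zero hM hg
  have hsub : (normalizedFactors g).toFinset ⊆ (normalizedFactors M).toFinset := by
    intro f hf
    rw [Multiset.mem_toFinset, mem_normalizedFactors_iff_monic] at hf ⊢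
    · exact ⟨hf.1, hf.2.1, hf.2.2.trans hg⟩
    all_goals assumption
  have hne : (normalizedFactors g).toFinset.prod id ≠ 0 :=
    Finset.prod_ne_zero_iff.2 fun f hf =>
      (irreducible_of_normalized_factor f (Multiset.mem_toFinset.1 hf)).ne_zero
  rw [radPoly, radPoly, ← Finset.prod_sdiff hsub, mul_div_cancel_right₀ _ hne,
    normalizedFactors_prod_finset, Finset.val_toFinset]
  intro f hf
  have := Multiset.mem_toFinset.1 (Finset.sdiff_subset hf)
  exact ⟨monic_of_mem_normalizedFactors this, irreducible_of_normalized_factor f this⟩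

lemma radPoly_div_ne_zero {g M : K[X]} (hM : M ≠ 0) (hg : g ∣ M) :
    radPoly M / radPoly g ≠ 0 := by
  have hne : ∀ f : K[X], radPoly f ≠ 0 := fun f =>
    Finset.prod_ne_zero_iff.2 fun e he =>
      (irreducible_of_normalized_factor e (Multiset.mem_toFinset.1 he)).ne_zero
  have hsub : (normalizedFactors g).toFinset ⊆ (normalizedFactors M).toFinset := by
    rw [Multiset.toFinset_subset]
    exact Multiset.subset_of_le ((dvd_iff_normalizedFactors_le_normalizedFactors
      (ne_zero_of_dvd_ne_zero hM hg) hM).1 hg)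
  obtain ⟨e, he⟩ : radPoly g ∣ radPoly M := Finset.prod_dvd_prod_of_subset _ _ _ hsub
  have he0 : e ≠ 0 := by
    rintro rfl
    exact hne M (by rw [he, mul_zero])
  rwa [he, mul_div_cancel_left₀ _ (hne g)]

lemma two_pow_card_le_Wpoly {h : K[X]} (h0 : h ≠ 0) {A : Finset K[X]}
    (hA : ∀ f ∈ A, f.Monic ∧ Irreducible f ∧ f ∣ h) : 2 ^ A.card ≤ Wpoly h := by
  have hfin : {g : K[X] | g.Monic ∧ Squarefree g ∧ g ∣ h}.Finite := by
    refine Set.Finite.of_finite_image (f := normalizedFactors)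
      ((normalizedFactors h).powerset.toFinset.finite_toSet.subset ?_) ?_
    · rintro _ ⟨g, ⟨_, _, hg⟩, rfl⟩
      simp only [Finset.mem_coe, Multiset.mem_toFinset, Multiset.mem_powerset]
      exact (dvd_iff_normalizedFactors_le_normalizedFactors
        (ne_zero_of_dvd_ne_zero h0 hg) h0).1 hg
    · rintro g ⟨hg, _⟩ g' ⟨hg', _⟩ heq
      rw [← prod_pow_count_normalizedFactors hg, ← prod_pow_count_normalizedFactors hg', heq]
  have hS : ∀ S ∈ A.powerset, normalizedFactors (S.prod id) = S.val := fun S hS =>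
    normalizedFactors_prod_finset fun f hf =>
      ⟨(hA f (Finset.mem_powerset.1 hS hf)).1, (hA f (Finset.mem_powerset.1 hS hf)).2.1⟩
  have hinj : Set.InjOn (fun S : Finset K[X] => S.prod id) A.powerset := by
    intro S h1 S' h2 heq
    apply Finset.val_injective
    rw [← hS S h1, ← hS S' h2]
    exact congrArg normalizedFactors heq
  rw [Wpoly, ← Finset.card_powerset, ← Finset.card_image_of_injOn hinj, ← Set.ncard_coe_finset]
  refine Set.ncard_le_ncard ?_ hfin
  intro g hg
  obtain ⟨S, h1, rfl⟩ := Finset.mem_image.1 hg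
  have h2 := Finset.mem_powerset.1 h1
  have hm : (S.prod id).Monic := monic_prod_of_monic _ _ fun f hf => (hA f (h2 hf)).1
  refine ⟨hm, ?_, ?_⟩
  · rw [squarefree_iff_nodup_normalizedFactors hm.ne_zero, hS S h1]
    exact S.nodup
  · refine Finset.prod_dvd_of_coprime (fun f hf f' hf' hne => ?_) fun f hf => (hA f (h2 hf)).2.2
    exact isCoprime_of_monic_irreducible_ne (hA f (h2 hf)).1 (hA f (h2 hf)).2.1
      (hA f' (h2 hf')).1 (hA f' (h2 hf')).2.1 hne

lemma squarefree_X_pow_sub_one [Fintype K] {n : ℕ} (hn : Nat.gcd (Fintype.card K) n = 1) :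
    Squarefree (X ^ n - 1 : K[X]) := by
  have hne : (n : K) ≠ 0 := by
    intro h0
    have hp := CharP.char_is_prime K (ringChar K)
    have h1 : ringChar K ∣ n := (ringChar.spec K n).1 h0
    have h2 : ringChar K ∣ Fintype.card K := (ringChar.spec K _).1 (by simp)
    have := Nat.dvd_gcd h2 h1
    rw [hn] at this
    exact hp.one_lt.ne' (Nat.dvd_one.1 this)
  simpa using (separable_X_pow_sub_C (1 : K) hne one_ne_zero).squarefree

end Radicals

section SieveElements

variable {Fq F : Type*} [Field Fq] [Field F]

/-- The elements of `Fq[X] × ℤ × Fq[X]` attached to the conditions of the sieve. -/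
def sieveElt : Fq[X] ⊕ ℕ ⊕ Fq[X] → Fq[X] × ℤ × Fq[X] :=
  Sum.elim (fun f => (f, 1, 1)) (Sum.elim (fun p => (1, (p : ℤ), 1)) (fun f => (1, 1, f)))

/-- The index of a sieving condition is a monic irreducible polynomial or a prime. -/
def IsSievePrime : Fq[X] ⊕ ℕ ⊕ Fq[X] → Prop :=
  Sum.elim (fun f => f.Monic ∧ Irreducible f)
    (Sum.elim Nat.Prime (fun f => f.Monic ∧ Irreducible f))

lemma isCoprime_prod {R S : Type*} [CommSemiring R] [CommSemiring S] {x y : R × S}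
    (h₁ : IsCoprime x.1 y.1) (h₂ : IsCoprime x.2 y.2) : IsCoprime x y := by
  obtain ⟨a, b, h⟩ := h₁
  obtain ⟨a', b', h'⟩ := h₂
  exact ⟨(a, a'), (b, b'), Prod.ext h h'⟩

lemma isCoprime_sieveElt {i j : Fq[X] ⊕ ℕ ⊕ Fq[X]} (hi : IsSievePrime i) (hj : IsSievePrime j)
    (hij : i ≠ j) : IsCoprime (sieveElt i) (sieveElt j) := by
  rcases i with f | p | f <;> rcases j with f' | p' | f'
  · refine isCoprime_prod ?_ (isCoprime_prod isCoprime_one_left isCoprime_one_left)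
    exact isCoprime_of_monic_irreducible_ne hi.1 hi.2 hj.1 hj.2
      fun h : f = f' => hij (congrArg Sum.inl h)
  · exact isCoprime_prod isCoprime_one_right (isCoprime_prod isCoprime_one_left isCoprime_one_left)
  · exact isCoprime_prod isCoprime_one_right (isCoprime_prod isCoprime_one_left isCoprime_one_left)
  · exact isCoprime_prod isCoprime_one_left (isCoprime_prod isCoprime_one_right isCoprime_one_left)
  · refine isCoprime_prod isCoprime_one_left (isCoprime_prod ?_ isCoprime_one_left)
    exact Nat.isCoprime_iff_coprime.2 ((Nat.coprime_primes hi hj).2 fun h => hij (by rw [h]))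
  · exact isCoprime_prod isCoprime_one_left (isCoprime_prod isCoprime_one_right isCoprime_one_left)
  · exact isCoprime_prod isCoprime_one_left (isCoprime_prod isCoprime_one_left isCoprime_one_right)
  · exact isCoprime_prod isCoprime_one_left (isCoprime_prod isCoprime_one_left isCoprime_one_right)
  · refine isCoprime_prod isCoprime_one_left (isCoprime_prod isCoprime_one_left ?_)
    exact isCoprime_of_monic_irreducible_ne hi.1 hi.2 hj.1 hj.2
      fun h : f = f' => hij (congrArg (Sum.inr ∘ Sum.inr) h)

lemma sieveElt_inl_pow (f : Fq[X]) (b : ℕ) : sieveElt (Sum.inl f) ^ b = (f ^ b, 1, 1) := by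
  simp [sieveElt]

lemma sieveElt_inr_inl_pow (p b : ℕ) :
    (sieveElt (Sum.inr (Sum.inl p)) : Fq[X] × ℤ × Fq[X]) ^ b = (1, ((p ^ b : ℕ) : ℤ), 1) := by
  simp [sieveElt]

lemma sieveElt_inr_inr_pow (f : Fq[X]) (b : ℕ) :
    sieveElt (Sum.inr (Sum.inr f)) ^ b = (1, 1, f ^ b) := by
  simp [sieveElt]

lemma sieveNorm_sieveElt_pow_lt [Fintype Fq] {i : Fq[X] ⊕ ℕ ⊕ Fq[X]} (hi : IsSievePrime i)
    (b : ℕ) :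
    sieveNorm (sieveElt i ^ b) < sieveNorm (sieveElt i ^ (b + 1)) := by
  have hq : 1 < Fintype.card Fq := Fintype.one_lt_card
  rcases i with f | p | f
  · simp only [sieveElt_inl_pow, sieveNorm, natDegree_pow, Int.natAbs_one, natDegree_one, pow_zero,
      mul_one]
    exact Nat.pow_lt_pow_right hq (Nat.mul_lt_mul_of_pos_right (Nat.lt_succ_self b)
      hi.2.natDegree_pos)
  · simp only [sieveElt_inr_inl_pow, sieveNorm, Int.natAbs_natCast, natDegree_one, pow_zero,
      mul_one, one_mul]
    exact Nat.pow_lt_pow_right hi.one_lt (Nat.lt_succ_self b)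
  · simp only [sieveElt_inr_inr_pow, sieveNorm, natDegree_pow, Int.natAbs_one, natDegree_one,
      pow_zero, one_mul]
    exact Nat.pow_lt_pow_right hq (Nat.mul_lt_mul_of_pos_right (Nat.lt_succ_self b)
      hi.2.natDegree_pos)

variable [Fintype F]

variable (Fq F) in
/-- The element annihilating `F × Fˣ × F`. -/
def sieveModulus [Algebra Fq F] : Fq[X] × ℤ × Fq[X] :=
  (X ^ Module.finrank Fq F - 1, ((Fintype.card F - 1 : ℕ) : ℤ), X ^ Module.finrank Fq F - 1)

lemma card_sievePoint (L : F →+ F) :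
    (Fintype.card {β : F // L β ≠ 0} : ℝ) = Fintype.card F - Nat.card L.ker := by
  have h3 : Nat.card L.ker = Fintype.card {β : F // L β = 0} := by
    rw [← Nat.card_eq_fintype_card]
    rfl
  have := Fintype.card_subtype_compl (fun β : F => L β = 0)
  rw [h3, this, Nat.cast_sub (Fintype.card_subtype_le _)]

/-- The sieve for the points attached to `β ↦ g ∘ β`. -/
theorem exists_sievePoint [Fintype Fq] [Algebra Fq F]
    {g : Fq[X]} (hg : g ∣ X ^ Module.finrank Fq F - 1)
    (s t : Finset (Fq[X] ⊕ ℕ ⊕ Fq[X])) (hst : Disjoint s t) (b : Fq[X] ⊕ ℕ ⊕ Fq[X] → ℕ)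
    (hprime : ∀ i, i ∈ s ∨ i ∈ t → IsSievePrime i)
    (hs : ∀ i ∈ s, sieveElt i ^ b i ∣ sieveModulus Fq F)
    (ht : ∀ i ∈ t, b i = 0 ∧ sieveElt i ∣ sieveModulus Fq F)
    {D : ℝ} (hD : D = 1 - ∑ i ∈ t, (sieveNorm (sieveElt i) : ℝ)⁻¹) (hDpos : 0 < D)
    (hbound : 2 * √(Fintype.card F : ℝ) * (Fintype.card Fq : ℝ) ^ g.natDegree *
      (∏ i ∈ s, (if sieveElt i ^ (b i + 1) ∣ sieveModulus Fq F then 2 else 1) *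
        (sieveNorm (sieveElt i ^ b i) : ℝ)) * ((t.card - 1) / D + 2) ≤ Fintype.card F) :
    ∃ β, (∀ i ∈ s, sievePoint (frobAct Fq F g).toAddMonoidHom β ∈
        actRange (sieveAct Fq F) (sieveElt i ^ b i)) ∧
      ∀ i, i ∈ s ∨ i ∈ t → sieveElt i ^ (b i + 1) ∣ sieveModulus Fq F →
        sievePoint (frobAct Fq F g).toAddMonoidHom β ∉
          actRange (sieveAct Fq F) (sieveElt i ^ (b i + 1)) := by
  have hker : Nat.card (frobAct Fq F g).toAddMonoidHom.ker = Fintype.card Fq ^ g.natDegree := by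
    obtain ⟨g', hg'⟩ := hg
    exact (range_frobAct_eq_ker ((mul_comm _ _).trans hg'.symm)).2
  have hE := norm_sum_sievePoint_le (frobAct Fq F g).toAddMonoidHom
  have hcard := card_sievePoint (frobAct Fq F g).toAddMonoidHom
  rw [hker] at hE hcard
  push_cast at hE hcard
  have hq : (0 : ℝ) < (Fintype.card Fq : ℝ) ^ g.natDegree := by
    have : 0 < Fintype.card Fq := Fintype.card_pos
    positivity
  have hsqrt : 1 ≤ √(Fintype.card F : ℝ) := by
    rw [Real.one_le_sqrt]
    exact_mod_cast Fintype.card_pos (α := F)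
  obtain ⟨β, h1, h2⟩ := exists_of_module_sieve (sieveAct Fq F) (sieveModulus Fq F) sieveNorm
    (by
      intro x hx
      rw [prod_dvd_iff, prod_dvd_iff] at hx
      refine index_actRange_sieveAct hx.1 ?_ hx.2.2
      exact Int.natAbs_dvd_natAbs.2 hx.2.1)
    s t hst sieveElt b
    (fun i hi j hj hij => isCoprime_sieveElt (hprime i hi)
      (hprime j hj) hij)
    hs ht
    (fun i hi _ => sieveNorm_sieveElt_pow_lt (hprime i (Or.inl hi)) (b i))
    (sievePoint (frobAct Fq F g).toAddMonoidHom) (by positivity) hE hD hDpos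
    (by
      refine hbound.trans_lt ?_
      rw [hcard]
      nlinarith)
  refine ⟨β, fun i hi => (h1 i hi).1, fun i hi hd => ?_⟩
  rcases hi with hi | hi
  · exact (h1 i hi).2 hd
  · rw [(ht i hi).1, zero_add, pow_one]
    exact h2 i hi

end SieveElements

section SieveExponent

variable {Fq F : Type*} [Field Fq] [Field F]

lemma card_sub_one_ne_zero [Fintype F] : Fintype.card F - 1 ≠ 0 := by
  have := Fintype.one_lt_card (α := F)
  omega

lemma X_pow_finrank_sub_one_ne_zero [Finite F] [Algebra Fq F] :
    (X ^ Module.finrank Fq F - 1 : Fq[X]) ≠ 0 :=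
  X_pow_sub_C_ne_zero Module.finrank_pos 1

/-- The exponents of the powers required by the sieve. -/
def sieveExponent (r : ℕ) (g : Fq[X]) : Fq[X] ⊕ ℕ ⊕ Fq[X] → ℕ :=
  Sum.elim (fun _ => 0) (Sum.elim r.factorization (fun f => (normalizedFactors g).count f))

lemma inl_pow_dvd_sieveModulus [Fintype F] [Algebra Fq F] {f : Fq[X]} {b : ℕ} :
    sieveElt (Sum.inl f) ^ b ∣ sieveModulus Fq F ↔ f ^ b ∣ X ^ Module.finrank Fq F - 1 := by
  simp [sieveElt_inl_pow, sieveModulus, prod_dvd_iff]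

lemma inr_inl_pow_dvd_sieveModulus [Fintype F] [Algebra Fq F] {p b : ℕ} :
    sieveElt (Sum.inr (Sum.inl p)) ^ b ∣ sieveModulus Fq F ↔ p ^ b ∣ Fintype.card F - 1 := by
  rw [sieveElt_inr_inl_pow]
  simp only [sieveModulus, prod_dvd_iff, one_dvd, and_true, true_and]
  exact Int.natCast_dvd_natCast

lemma inr_inr_pow_dvd_sieveModulus [Fintype F] [Algebra Fq F] {f : Fq[X]} {b : ℕ} :
    sieveElt (Sum.inr (Sum.inr f)) ^ b ∣ sieveModulus Fq F ↔
      f ^ b ∣ X ^ Module.finrank Fq F - 1 := by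
  simp [sieveElt_inr_inr_pow, sieveModulus, prod_dvd_iff]

variable [Fintype Fq] [Algebra Fq F]

lemma mem_actRange_inl_pow {f : Fq[X]} {b : ℕ} {v : F × Additive Fˣ × F} :
    v ∈ actRange (sieveAct Fq F) (sieveElt (Sum.inl f) ^ b) ↔
      ∃ a, frobAct Fq F (f ^ b) a = v.1 := by
  rw [sieveElt_inl_pow, mem_actRange_sieveAct]
  simp

lemma mem_actRange_inr_inl_pow {p b : ℕ} {v : F × Additive Fˣ × F} :
    v ∈ actRange (sieveAct Fq F) (sieveElt (Sum.inr (Sum.inl p)) ^ b) ↔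
      ∃ u : Fˣ, u ^ p ^ b = v.2.1.toMul := by
  rw [sieveElt_inr_inl_pow, mem_actRange_sieveAct]
  simp only [zpow_natCast]
  simp

lemma mem_actRange_inr_inr_pow {f : Fq[X]} {b : ℕ} {v : F × Additive Fˣ × F} :
    v ∈ actRange (sieveAct Fq F) (sieveElt (Sum.inr (Sum.inr f)) ^ b) ↔
      ∃ a, frobAct Fq F (f ^ b) a = v.2.2 := by
  rw [sieveElt_inr_inr_pow, mem_actRange_sieveAct]
  simp

/-- A point surviving the sieve is counted by `Ncnt`. -/
lemma Ncnt_pos_of_sievePoint [Fintype F]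
    {r : ℕ} (hr0 : r ≠ 0) (hr : r ∣ Fintype.card F - 1) {g : Fq[X]}
    (hgm : g.Monic) (hg : g ∣ X ^ Module.finrank Fq F - 1)
    (β : {β : F // (frobAct Fq F g).toAddMonoidHom β ≠ 0})
    (hmem : ∀ i, IsSievePrime i → sievePoint (frobAct Fq F g).toAddMonoidHom β ∈
      actRange (sieveAct Fq F) (sieveElt i ^ sieveExponent r g i))
    (hnot : ∀ i, IsSievePrime i → sieveElt i ^ (sieveExponent r g i + 1) ∣ sieveModulus Fq F →
      sievePoint (frobAct Fq F g).toAddMonoidHom β ∉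
        actRange (sieveAct Fq F) (sieveElt i ^ (sieveExponent r g i + 1))) :
    0 < Ncnt F (Fintype.card Fq) (Module.finrank Fq F) r g
      (X ^ Module.finrank Fq F - 1 : Fq[X]) (radN (Fintype.card F - 1) / radN r)
      (radPoly (X ^ Module.finrank Fq F - 1 : Fq[X]) / radPoly g) := by
  have hα : frobAct Fq F g β ≠ 0 := β.2
  set α : Fˣ := Units.mk0 (frobAct Fq F g β) hα with hαdef
  have hcard : Fintype.card Fq ^ Module.finrank Fq F = Fintype.card F :=
    (Module.card_eq_pow_finrank (K := Fq) (V := F)).symm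
  have hg0 : g ≠ 0 := hgm.ne_zero
  have hcard0 : Fintype.card F - 1 ≠ 0 := card_sub_one_ne_zero
  have hM0 : (X ^ Module.finrank Fq F - 1 : Fq[X]) ≠ 0 := X_pow_finrank_sub_one_ne_zero
  refine (Set.ncard_pos (Set.toFinite _)).2 ⟨β, ?_, ?_, ?_⟩
  · refine isPolyFree_of_forall_not_mem_range fun f hfm hfi hf _ γ hγ => ?_
    refine hnot (Sum.inl f) ⟨hfm, hfi⟩ (inl_pow_dvd_sieveModulus.2 ?_)
      (mem_actRange_inl_pow.2 ⟨γ, ?_⟩)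
    · simpa [sieveExponent] using hf
    · simpa [sieveExponent, sievePoint] using hγ
  · rw [polyAct_eq_frobAct, QSet, hcard]
    refine ⟨hα, ?_, ?_, ?_⟩
    · refine gcd_div_orderOf_eq_one (α := α) fun p hp hpR hpd u hu => ?_
      have hpr : ¬ p ∣ r := by
        have := Nat.mem_primeFactors.2 ⟨hp, hpR, radN_div_ne_zero hcard0 hr⟩
        rw [primeFactors_radN_div hcard0 hr, Finset.mem_sdiff] at this
        exact fun h => this.2 (Nat.mem_primeFactors.2 ⟨hp, h, hr0⟩)
      have hb : sieveExponent r g (Sum.inr (Sum.inl p)) = 0 :=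
        Nat.factorization_eq_zero_of_not_dvd hpr
      refine hnot (Sum.inr (Sum.inl p)) hp (inr_inl_pow_dvd_sieveModulus.2 ?_)
        (mem_actRange_inr_inl_pow.2 ⟨u, ?_⟩)
      · simpa [hb] using hpd
      · simpa [hb, sievePoint] using hu
    · have := mem_actRange_prod (sieveAct Fq F) r.primeFactors
        (fun p => sieveElt (Sum.inr (Sum.inl p)) ^ r.factorization p)
        (fun p hp p' hp' hne => (isCoprime_sieveElt (i := Sum.inr (Sum.inl p))
          (j := Sum.inr (Sum.inl p')) (Nat.prime_of_mem_primeFactors hp)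
          (Nat.prime_of_mem_primeFactors hp') (by simpa using hne)).pow)
        (fun p hp => hmem (Sum.inr (Sum.inl p)) (Nat.prime_of_mem_primeFactors hp))
      obtain ⟨-, ⟨u, hu⟩, -⟩ := (mem_actRange_sieveAct _ _).1 this
      simp only [sieveElt_inr_inl_pow, Prod.snd_prod, Prod.fst_prod] at hu
      rw [← Nat.cast_prod, zpow_natCast] at hu
      have hprod : ∏ p ∈ r.primeFactors, p ^ r.factorization p = r :=
        Nat.prod_factorization_pow_eq_self hr0
      rw [hprod] at hu
      exact ⟨u, by simpa [sievePoint] using congrArg Units.val hu⟩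
    · intro p hp γ hγ
      obtain ⟨hp1, hp2⟩ := Finset.mem_filter.1 hp
      have hγ0 : γ ≠ 0 := by
        rintro rfl
        rw [zero_pow (pow_ne_zero _ (Nat.prime_of_mem_primeFactors hp1).ne_zero)] at hγ
        exact hα hγ.symm
      exact hnot (Sum.inr (Sum.inl p)) (Nat.prime_of_mem_primeFactors hp1)
        (inr_inl_pow_dvd_sieveModulus.2 hp2)
        (mem_actRange_inr_inl_pow.2 ⟨Units.mk0 γ hγ0, Units.ext hγ⟩)
  · rw [polyAct_eq_frobAct]
    refine ⟨?_, ?_, ?_⟩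
    · refine isPolyFree_of_forall_not_mem_range fun f hfm hfi hfG hfM γ hγ => ?_
      have hfg : f ∉ normalizedFactors g := by
        have := Multiset.mem_toFinset.2 ((mem_normalizedFactors_iff_monic
          (radPoly_div_ne_zero hM0 hg)).2 ⟨hfm, hfi, hfG⟩)
        rw [normalizedFactors_radPoly_div hM0 hg, Finset.mem_sdiff] at this
        exact fun h => this.2 (Multiset.mem_toFinset.2 h)
      have hb : sieveExponent r g (Sum.inr (Sum.inr f)) = 0 := Multiset.count_eq_zero.2 hfg
      refine hnot (Sum.inr (Sum.inr f)) ⟨hfm, hfi⟩ (inr_inr_pow_dvd_sieveModulus.2 ?_)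
        (mem_actRange_inr_inr_pow.2 ⟨γ, ?_⟩)
      · simpa [hb] using hfM
      · simpa [hb, sievePoint] using hγ
    · have hpr : ∀ f ∈ (normalizedFactors g).toFinset, f.Monic ∧ Irreducible f := fun f hf =>
        have := (mem_normalizedFactors_iff_monic hg0).1 (Multiset.mem_toFinset.1 hf)
        ⟨this.1, this.2.1⟩
      have := mem_actRange_prod (sieveAct Fq F) (normalizedFactors g).toFinset
        (fun f => sieveElt (Sum.inr (Sum.inr f)) ^ (normalizedFactors g).count f)
        (fun f hf f' hf' hne => (isCoprime_sieveElt (i := Sum.inr (Sum.inr f))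
          (j := Sum.inr (Sum.inr f')) (hpr f hf) (hpr f' hf') (by simpa using hne)).pow)
        (fun f hf => hmem (Sum.inr (Sum.inr f)) (hpr f hf))
      obtain ⟨-, -, ⟨u, hu⟩⟩ := (mem_actRange_sieveAct _ _).1 this
      simp only [sieveElt_inr_inr_pow, Prod.snd_prod, prod_pow_count_normalizedFactors hgm] at hu
      exact ⟨u, by rw [polyAct_eq_frobAct]; exact hu⟩
    · intro f hf γ hγ
      obtain ⟨hf1, hf2⟩ := Finset.mem_filter.1 hf
      have hf3 := (mem_normalizedFactors_iff_monic hg0).1 (Multiset.mem_toFinset.1 hf1)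
      rw [polyAct_eq_frobAct] at hγ
      exact hnot (Sum.inr (Sum.inr f)) ⟨hf3.1, hf3.2.1⟩ (inr_inr_pow_dvd_sieveModulus.2 hf2)
        (mem_actRange_inr_inr_pow.2 ⟨γ, hγ⟩)

end SieveExponent

section SieveWeight

lemma natDegree_eq_sum_count {Fq : Type*} [Field Fq] {g : Fq[X]} (hg : g.Monic) :
    g.natDegree = ∑ f ∈ (normalizedFactors g).toFinset,
      f.natDegree * (normalizedFactors g).count f := by
  conv_lhs => rw [← prod_pow_count_normalizedFactors hg]
  rw [natDegree_prod_of_monic]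
  · exact Finset.sum_congr rfl fun f _ => by rw [natDegree_pow, mul_comm]
  · exact fun f hf => (monic_of_mem_normalizedFactors (Multiset.mem_toFinset.1 hf)).pow _

variable {Fq : Type*} (F : Type*) [Field Fq] [Field F] [Fintype Fq] [Fintype F] [Algebra Fq F]

/-- The contribution of a condition to the error term of the sieve. -/
def sieveWeight (r : ℕ) (g : Fq[X]) (i : Fq[X] ⊕ ℕ ⊕ Fq[X]) : ℝ :=
  (if sieveElt i ^ (sieveExponent r g i + 1) ∣ sieveModulus Fq F then 2 else 1) *
    (sieveNorm (sieveElt i ^ sieveExponent r g i) : ℝ)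

lemma sieveWeight_nonneg (r : ℕ) (g : Fq[X]) (i : Fq[X] ⊕ ℕ ⊕ Fq[X]) :
    0 ≤ sieveWeight F r g i := by
  unfold sieveWeight
  split_ifs <;> positivity

lemma sieveWeight_le (r : ℕ) (g : Fq[X]) (i : Fq[X] ⊕ ℕ ⊕ Fq[X]) :
    sieveWeight F r g i ≤ 2 * (sieveNorm (sieveElt i ^ sieveExponent r g i) : ℝ) := by
  unfold sieveWeight
  gcongr
  split_ifs <;> norm_num

lemma sieveWeight_le_two {r : ℕ} {g : Fq[X]} {i : Fq[X] ⊕ ℕ ⊕ Fq[X]}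
    (hi : sieveExponent r g i = 0) : sieveWeight F r g i ≤ 2 := by
  refine (sieveWeight_le F r g i).trans ?_
  simp [hi, sieveNorm]

lemma prod_sieveWeight_nonneg {ι : Type*} (r : ℕ) (g : Fq[X]) (A : Finset ι)
    (e : ι → Fq[X] ⊕ ℕ ⊕ Fq[X]) : 0 ≤ ∏ a ∈ A, sieveWeight F r g (e a) :=
  Finset.prod_nonneg fun a _ => sieveWeight_nonneg F r g (e a)

lemma prod_sieveWeight_le_two_pow {ι : Type*} {r : ℕ} {g : Fq[X]} (A : Finset ι)
    (e : ι → Fq[X] ⊕ ℕ ⊕ Fq[X]) (hA : ∀ a ∈ A, sieveExponent r g (e a) = 0) :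
    ∏ a ∈ A, sieveWeight F r g (e a) ≤ 2 ^ A.card :=
  (Finset.prod_le_prod (fun a _ => sieveWeight_nonneg F r g (e a))
    fun a ha => sieveWeight_le_two F (hA a ha)).trans_eq (Finset.prod_const _)

lemma prod_sieveWeight_primeFactors_le {r : ℕ} (hr : r ≠ 0) (g : Fq[X]) :
    ∏ p ∈ r.primeFactors, sieveWeight F r g (Sum.inr (Sum.inl p)) ≤ r * radN r := by
  have hprod : ∏ p ∈ r.primeFactors, p ^ r.factorization p = r :=
    Nat.prod_factorization_pow_eq_self hr
  calc ∏ p ∈ r.primeFactors, sieveWeight F r g (Sum.inr (Sum.inl p))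
      ≤ ∏ p ∈ r.primeFactors, ((p ^ r.factorization p : ℕ) * p : ℝ) := by
        refine Finset.prod_le_prod (fun p _ => sieveWeight_nonneg F r g _) fun p hp => ?_
        refine (sieveWeight_le F r g _).trans ?_
        have h2 : (2 : ℝ) ≤ p := by exact_mod_cast (Nat.prime_of_mem_primeFactors hp).two_le
        rw [sieveElt_inr_inl_pow, mul_comm]
        simp only [sieveNorm, natDegree_one, pow_zero, one_mul, mul_one, Int.natAbs_natCast]
        exact mul_le_mul_of_nonneg_left h2 (Nat.cast_nonneg _)
    _ = r * radN r := by
        rw [Finset.prod_mul_distrib, ← Nat.cast_prod, ← Nat.cast_prod, hprod, radN]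

lemma prod_sieveWeight_normalizedFactors_le (r : ℕ) {g : Fq[X]} (hg : g.Monic) :
    ∏ f ∈ (normalizedFactors g).toFinset, sieveWeight F r g (Sum.inr (Sum.inr f)) ≤
      (Fintype.card Fq : ℝ) ^ (g.natDegree +
        if Nat.gcd (Fintype.card Fq) (Module.finrank Fq F) = 1 then 0 else g.natDegree) := by
  have hq : (2 : ℝ) ≤ Fintype.card Fq := by exact_mod_cast Fintype.one_lt_card (α := Fq)
  have hnorm : ∏ f ∈ (normalizedFactors g).toFinset,
      (sieveNorm (sieveElt (Sum.inr (Sum.inr f)) ^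
        sieveExponent r g (Sum.inr (Sum.inr f))) : ℝ) =
        (Fintype.card Fq : ℝ) ^ g.natDegree := by
    conv_rhs => rw [natDegree_eq_sum_count hg, ← Finset.prod_pow_eq_pow_sum]
    refine Finset.prod_congr rfl fun f _ => ?_
    rw [sieveElt_inr_inr_pow]
    simp [sieveNorm, sieveExponent, mul_comm]
  have hpos : 0 ≤ (Fintype.card Fq : ℝ) ^ g.natDegree := by positivity
  have hmem : ∀ f ∈ (normalizedFactors g).toFinset,
      f ∈ normalizedFactors g := fun f hf => Multiset.mem_toFinset.1 hf
  unfold sieveWeight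
  rw [Finset.prod_mul_distrib, hnorm, mul_comm, pow_add]
  refine mul_le_mul_of_nonneg_left ?_ hpos
  split_ifs with hgcd
  · rw [pow_zero, Finset.prod_eq_one]
    intro f hf
    refine if_neg fun hdvd => ?_
    rw [inr_inr_pow_dvd_sieveModulus] at hdvd
    have h1 : 1 ≤ sieveExponent r g (Sum.inr (Sum.inr f)) :=
      Multiset.one_le_count_iff_mem.2 (hmem f hf)
    have h2 : f * f ∣ X ^ Module.finrank Fq F - 1 := by
      rw [← sq]
      exact (pow_dvd_pow f (by omega)).trans hdvd
    exact (irreducible_of_normalized_factor f (hmem f hf)).not_isUnit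
      (squarefree_X_pow_sub_one hgcd f h2)
  · have hcard : (normalizedFactors g).toFinset.card ≤ g.natDegree := by
      rw [natDegree_eq_sum_count hg, Finset.card_eq_sum_ones]
      refine Finset.sum_le_sum fun f hf => Nat.mul_pos ?_ ?_
      · exact (irreducible_of_normalized_factor f (hmem f hf)).natDegree_pos
      · exact Multiset.count_pos.2 (hmem f hf)
    calc _ ≤ (2 : ℝ) ^ (normalizedFactors g).toFinset.card :=
          (Finset.prod_le_prod (fun f _ => by split_ifs <;> norm_num)
            fun f _ => by split_ifs <;> norm_num).trans_eq (Finset.prod_const _)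
      _ ≤ 2 ^ g.natDegree := pow_le_pow_right₀ one_le_two hcard
      _ ≤ _ := by gcongr

end SieveWeight

section SieveInequality

/-- The hypothesis on `q ^ (n / 2 - ϑ)` in multiplicative form. -/
lemma two_mul_sqrt_mul_le {q : ℝ} (hq : 0 < q) {n k e : ℕ} {w c S : ℝ} (hS : 0 ≤ S)
    (hw : w ≤ c * q ^ e) (h : 2 * c * S ≤ q ^ ((n : ℝ) / 2 - ((k + e : ℕ) : ℝ))) :
    2 * √(q ^ n) * q ^ k * w * S ≤ q ^ n := by
  have hsqrt : √(q ^ n) = q ^ ((n : ℝ) / 2) := by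
    rw [Real.sqrt_eq_rpow, ← Real.rpow_natCast, ← Real.rpow_mul hq.le]
    ring_nf
  rw [Real.rpow_sub hq, Real.rpow_natCast, ← hsqrt, le_div_iff₀ (pow_pos hq _)] at h
  calc 2 * √(q ^ n) * q ^ k * w * S ≤ 2 * √(q ^ n) * q ^ k * (c * q ^ e) * S := by gcongr
    _ = √(q ^ n) * (2 * c * S * q ^ (k + e)) := by ring
    _ ≤ √(q ^ n) * √(q ^ n) := by gcongr
    _ = q ^ n := Real.mul_self_sqrt (by positivity)

variable {Fq : Type*} (F : Type*) [Field Fq] [Field F] [Fintype F] [Algebra Fq F]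

/-- The conditions imposed directly in the sieve. -/
def sieveCore (r : ℕ) (g h : Fq[X]) (d : ℕ) (H : Fq[X]) : Finset (Fq[X] ⊕ ℕ ⊕ Fq[X]) :=
  ((normalizedFactors (X ^ Module.finrank Fq F - 1 : Fq[X])).toFinset.filter (· ∣ h)).disjSum
    ((r.primeFactors ∪ (radN (Fintype.card F - 1) / radN r).primeFactors.filter (· ∣ d)).disjSum
      ((normalizedFactors g).toFinset ∪ (normalizedFactors
        (radPoly (X ^ Module.finrank Fq F - 1 : Fq[X]) / radPoly g)).toFinset.filter (· ∣ H)))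

/-- The remaining conditions. -/
def sieveTail (r : ℕ) (g h : Fq[X]) (d : ℕ) (H : Fq[X]) : Finset (Fq[X] ⊕ ℕ ⊕ Fq[X]) :=
  ((normalizedFactors (X ^ Module.finrank Fq F - 1 : Fq[X])).toFinset.filter (¬ · ∣ h)).disjSum
    (((radN (Fintype.card F - 1) / radN r).primeFactors.filter (¬ · ∣ d)).disjSum
      ((normalizedFactors
        (radPoly (X ^ Module.finrank Fq F - 1 : Fq[X]) / radPoly g)).toFinset.filter (¬ · ∣ H)))

variable {F}

variable {r : ℕ} {g h : Fq[X]} {d : ℕ} {H : Fq[X]}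

lemma factorization_eq_zero_of_mem (hr : r ∣ Fintype.card F - 1) {p : ℕ}
    (hp : p ∈ (radN (Fintype.card F - 1) / radN r).primeFactors) : r.factorization p = 0 := by
  rw [primeFactors_radN_div card_sub_one_ne_zero hr, Finset.mem_sdiff] at hp
  exact Finsupp.notMem_support_iff.1 hp.2

lemma count_eq_zero_of_mem (hg : g ∣ X ^ Module.finrank Fq F - 1) {f : Fq[X]}
    (hf : f ∈ (normalizedFactors
      (radPoly (X ^ Module.finrank Fq F - 1 : Fq[X]) / radPoly g)).toFinset) :
    (normalizedFactors g).count f = 0 := by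
  rw [normalizedFactors_radPoly_div X_pow_finrank_sub_one_ne_zero hg, Finset.mem_sdiff,
    Multiset.mem_toFinset, Multiset.mem_toFinset] at hf
  exact Multiset.count_eq_zero.2 hf.2

/-- The product of the weights of the conditions imposed directly. -/
lemma prod_sieveWeight_sieveCore_le [Fintype Fq] (hr0 : r ≠ 0) (hr : r ∣ Fintype.card F - 1)
    (hgm : g.Monic) (hg : g ∣ X ^ Module.finrank Fq F - 1) (hh : h ≠ 0) (hd : d ≠ 0) (hH : H ≠ 0) :
    ∏ i ∈ sieveCore F r g h d H, sieveWeight F r g i ≤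
      r * radN r * Wpoly h * Wnat d * Wpoly H * (Fintype.card Fq : ℝ) ^ (g.natDegree +
        if Nat.gcd (Fintype.card Fq) (Module.finrank Fq F) = 1 then 0 else g.natDegree) := by
  have hM0 : (X ^ Module.finrank Fq F - 1 : Fq[X]) ≠ 0 := X_pow_finrank_sub_one_ne_zero
  have hG0 := radPoly_div_ne_zero hM0 hg
  rw [sieveCore, Finset.prod_disjSum, Finset.prod_disjSum, Finset.prod_union, Finset.prod_union]
  rotate_left
  · rw [Finset.disjoint_left]
    intro f hf hf'
    exact Multiset.count_ne_zero.2 (Multiset.mem_toFinset.1 hf)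
      (count_eq_zero_of_mem (F := F) hg (Finset.mem_filter.1 hf').1)
  · rw [Finset.disjoint_left]
    intro p hp hp'
    rw [← Nat.support_factorization, Finsupp.mem_support_iff] at hp
    exact hp (factorization_eq_zero_of_mem hr (Finset.mem_filter.1 hp').1)
  have h1 : ∏ f ∈ (normalizedFactors (X ^ Module.finrank Fq F - 1 : Fq[X])).toFinset.filter
      (· ∣ h), sieveWeight F r g (Sum.inl f) ≤ Wpoly h := by
    refine (prod_sieveWeight_le_two_pow F _ Sum.inl fun f _ => rfl).trans ?_
    exact_mod_cast two_pow_card_le_Wpoly hh fun f hf => by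
      have := (mem_normalizedFactors_iff_monic hM0).1
        (Multiset.mem_toFinset.1 (Finset.mem_filter.1 hf).1)
      exact ⟨this.1, this.2.1, (Finset.mem_filter.1 hf).2⟩
  have h2 : ∏ p ∈ (radN (Fintype.card F - 1) / radN r).primeFactors.filter (· ∣ d),
      sieveWeight F r g (Sum.inr (Sum.inl p)) ≤ Wnat d := by
    refine (prod_sieveWeight_le_two_pow F _ (fun p => Sum.inr (Sum.inl p)) fun p hp =>
      factorization_eq_zero_of_mem hr (Finset.mem_filter.1 hp).1).trans ?_
    have hle : ((radN (Fintype.card F - 1) / radN r).primeFactors.filter (· ∣ d)).card ≤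
        d.primeFactors.card := Finset.card_le_card fun p hp => by
      have := Finset.mem_filter.1 hp
      exact Nat.mem_primeFactors.2 ⟨Nat.prime_of_mem_primeFactors this.1, this.2, hd⟩
    exact_mod_cast (Nat.pow_le_pow_right two_pos hle).trans (two_pow_card_le_Wnat hd)
  have h3 : ∏ f ∈ (normalizedFactors (radPoly (X ^ Module.finrank Fq F - 1 : Fq[X]) /
      radPoly g)).toFinset.filter (· ∣ H), sieveWeight F r g (Sum.inr (Sum.inr f)) ≤ Wpoly H := by
    refine (prod_sieveWeight_le_two_pow F _ (fun f => Sum.inr (Sum.inr f)) fun f hf =>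
      count_eq_zero_of_mem (F := F) hg (Finset.mem_filter.1 hf).1).trans ?_
    exact_mod_cast two_pow_card_le_Wpoly hH fun f hf => by
      have := (mem_normalizedFactors_iff_monic hG0).1
        (Multiset.mem_toFinset.1 (Finset.mem_filter.1 hf).1)
      exact ⟨this.1, this.2.1, (Finset.mem_filter.1 hf).2⟩
  have h4 := prod_sieveWeight_primeFactors_le F hr0 g
  have h5 := prod_sieveWeight_normalizedFactors_le F r hgm
  refine (mul_le_mul h1 (mul_le_mul (mul_le_mul h4 h2 ?_ (by positivity))
    (mul_le_mul h5 h3 ?_ (by positivity)) (mul_nonneg ?_ ?_) (by positivity))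
    (mul_nonneg (mul_nonneg ?_ ?_) (mul_nonneg ?_ ?_)) (by positivity)).trans_eq ?_
  all_goals try exact prod_sieveWeight_nonneg F r g _ _
  ring

lemma mem_sieveCore_or_mem_sieveTail_iff (hr : r ∣ Fintype.card F - 1)
    (hgm : g.Monic) (hg : g ∣ X ^ Module.finrank Fq F - 1) {i : Fq[X] ⊕ ℕ ⊕ Fq[X]} :
    i ∈ sieveCore F r g h d H ∨ i ∈ sieveTail F r g h d H ↔
      IsSievePrime i ∧ sieveElt i ∣ sieveModulus Fq F := by
  have hM0 : (X ^ Module.finrank Fq F - 1 : Fq[X]) ≠ 0 := X_pow_finrank_sub_one_ne_zero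
  have hQ0 : Fintype.card F - 1 ≠ 0 := card_sub_one_ne_zero
  rw [← pow_one (sieveElt i)]
  rcases i with f | p | f
  · rw [inl_pow_dvd_sieveModulus, pow_one]
    simp only [sieveCore, sieveTail, Finset.inl_mem_disjSum, Finset.mem_filter, ← and_or_left,
      em, and_true, Multiset.mem_toFinset, mem_normalizedFactors_iff_monic hM0]
    exact and_assoc.symm
  · rw [inr_inl_pow_dvd_sieveModulus, pow_one]
    simp only [sieveCore, sieveTail, Finset.inr_mem_disjSum, Finset.inl_mem_disjSum,
      Finset.mem_filter, Finset.mem_union, or_assoc, ← and_or_left, em, and_true,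
      primeFactors_radN_div hQ0 hr, Finset.mem_sdiff]
    have h1 : p ∈ r.primeFactors → p ∈ (Fintype.card F - 1).primeFactors :=
      fun h => Nat.primeFactors_mono hr hQ0 h
    have h2 : p ∈ (Fintype.card F - 1).primeFactors ↔ p.Prime ∧ p ∣ Fintype.card F - 1 :=
      Nat.mem_primeFactors_of_ne_zero hQ0
    change _ ↔ p.Prime ∧ _
    tauto
  · rw [inr_inr_pow_dvd_sieveModulus, pow_one]
    simp only [sieveCore, sieveTail, Finset.inr_mem_disjSum,
      Finset.mem_filter, Finset.mem_union, or_assoc, ← and_or_left, em, and_true,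
      normalizedFactors_radPoly_div hM0 hg, Finset.mem_sdiff, Multiset.mem_toFinset]
    have h1 : f ∈ normalizedFactors g → f ∈ normalizedFactors (X ^ Module.finrank Fq F - 1) :=
      fun h => Multiset.subset_of_le
        ((dvd_iff_normalizedFactors_le_normalizedFactors hgm.ne_zero hM0).1 hg) h
    have h2 := mem_normalizedFactors_iff_monic (f := f) hM0
    change _ ↔ (f.Monic ∧ Irreducible f) ∧ _
    tauto

lemma sieveExponent_eq_zero_of_mem_sieveTail (hr : r ∣ Fintype.card F - 1)
    (hg : g ∣ X ^ Module.finrank Fq F - 1) {i : Fq[X] ⊕ ℕ ⊕ Fq[X]}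
    (hi : i ∈ sieveTail F r g h d H) : sieveExponent r g i = 0 := by
  rcases i with f | p | f
  · rfl
  · simp only [sieveTail, Finset.inr_mem_disjSum, Finset.inl_mem_disjSum, Finset.mem_filter] at hi
    exact factorization_eq_zero_of_mem hr hi.1
  · simp only [sieveTail, Finset.inr_mem_disjSum, Finset.mem_filter] at hi
    exact count_eq_zero_of_mem (F := F) hg hi.1

lemma disjoint_sieveCore_sieveTail (hr : r ∣ Fintype.card F - 1)
    (hg : g ∣ X ^ Module.finrank Fq F - 1) :
    Disjoint (sieveCore F r g h d H) (sieveTail F r g h d H) := by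
  rw [Finset.disjoint_left]
  intro i hi hi'
  have h0 := sieveExponent_eq_zero_of_mem_sieveTail hr hg hi'
  rcases i with f | p | f
  · simp only [sieveCore, sieveTail, Finset.inl_mem_disjSum, Finset.mem_filter] at hi hi'
    exact hi'.2 hi.2
  · simp only [sieveCore, sieveTail, Finset.inr_mem_disjSum, Finset.inl_mem_disjSum,
      Finset.mem_union, Finset.mem_filter] at hi hi'
    rcases hi with hi | hi
    · rw [← Nat.support_factorization, Finsupp.mem_support_iff] at hi
      exact hi h0
    · exact hi'.2 hi.2
  · simp only [sieveCore, sieveTail, Finset.inr_mem_disjSum, Finset.mem_union,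
      Finset.mem_filter] at hi hi'
    rcases hi with hi | hi
    · exact Multiset.count_ne_zero.2 (Multiset.mem_toFinset.1 hi) h0
    · exact hi'.2 hi.2

lemma sieveElt_pow_sieveExponent_dvd (hr : r ∣ Fintype.card F - 1) (hg0 : g ≠ 0)
    (hg : g ∣ X ^ Module.finrank Fq F - 1) (i : Fq[X] ⊕ ℕ ⊕ Fq[X]) :
    sieveElt i ^ sieveExponent r g i ∣ sieveModulus Fq F := by
  rcases i with f | p | f
  · exact inl_pow_dvd_sieveModulus.2 (by simp [sieveExponent])
  · exact inr_inl_pow_dvd_sieveModulus.2 ((Nat.ordProj_dvd r p).trans hr)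
  · refine inr_inr_pow_dvd_sieveModulus.2 (dvd_trans ?_ hg)
    rw [← (prod_normalizedFactors hg0).dvd_iff_dvd_right]
    have := Multiset.le_count_iff_replicate_le.1 (le_refl ((normalizedFactors g).count f))
    simpa [sieveExponent] using Multiset.prod_dvd_prod_of_le this

end SieveInequality

/-- Sieving criterion: with `D := 1 − Σ_i 1/q^{deg h_i} − Σ_i 1/p_i − Σ_i 1/q^{deg H_i}`
and `S := (m + l + m' − 1)/D + 2`, if `D > 0` and
`q^{n/2 − ϑ} > 2·r·rad(r)·W(h)·W(d)·W(H)·S` then `N_{r,k,g}(x^n−1, R, G) > 0`. -/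
theorem Ncnt_pos_of_sieving
    (q n r k : ℕ) (hq : IsPrimePow q) (hn : 0 < n) (hr : 0 < r)
    (hrdvd : r ∣ q ^ n - 1)
    (Fq F : Type*) [Field Fq] [Field F] [Fintype Fq] [Fintype F] [Algebra Fq F]
    (hcard : Fintype.card Fq = q) (hdim : Module.finrank Fq F = n)
    (g : Fq[X]) (hgm : g.Monic) (hgd : g.natDegree = k)
    (hgdvd : g ∣ (X ^ n - 1 : Fq[X]))
    (h : Fq[X]) (hhm : h.Monic) (hhdvd : h ∣ (X ^ n - 1 : Fq[X]))
    (d : ℕ) (hd : d ∣ radN (q ^ n - 1) / radN r)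
    (H : Fq[X]) (hHm : H.Monic)
    (hHdvd : H ∣ radPoly (X ^ n - 1 : Fq[X]) / radPoly g)
    (D S : ℝ)
    (hD : D = 1 -
      (∑ f ∈ (normalizedFactors (X ^ n - 1 : Fq[X])).toFinset.filter
          (fun f => ¬ f ∣ h), (1 : ℝ) / (q : ℝ) ^ f.natDegree) -
      (∑ p ∈ (radN (q ^ n - 1) / radN r).primeFactors.filter
          (fun p => ¬ p ∣ d), (1 : ℝ) / (p : ℝ)) -
      (∑ f ∈ (normalizedFactors
            (radPoly (X ^ n - 1 : Fq[X]) / radPoly g)).toFinset.filter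
          (fun f => ¬ f ∣ H), (1 : ℝ) / (q : ℝ) ^ f.natDegree))
    (hS : S = (((((normalizedFactors (X ^ n - 1 : Fq[X])).toFinset.filter
            (fun f => ¬ f ∣ h)).card : ℝ) +
          (((radN (q ^ n - 1) / radN r).primeFactors.filter
            (fun p => ¬ p ∣ d)).card : ℝ) +
          (((normalizedFactors
                (radPoly (X ^ n - 1 : Fq[X]) / radPoly g)).toFinset.filter
            (fun f => ¬ f ∣ H)).card : ℝ) - 1) / D) + 2)
    (hDpos : 0 < D)
    (hineq : (q : ℝ) ^ ((n : ℝ) / 2 -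
        (if Nat.gcd q n = 1 then 2 * k else 3 * k : ℕ)) >
      2 * r * radN r * Wpoly h * Wnat d * Wpoly H * S) :
    0 < Ncnt F q n r g (X ^ n - 1 : Fq[X]) (radN (q ^ n - 1) / radN r)
        (radPoly (X ^ n - 1 : Fq[X]) / radPoly g) := by
  subst hcard hdim
  have hcardF : Fintype.card Fq ^ Module.finrank Fq F = Fintype.card F :=
    (Module.card_eq_pow_finrank (K := Fq) (V := F)).symm
  have hq0 : (0 : ℝ) < Fintype.card Fq := by exact_mod_cast Fintype.card_pos
  simp only [hcardF] at hrdvd hd hD hS ⊢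
  have hd0 : d ≠ 0 := by
    rintro rfl
    exact radN_div_ne_zero card_sub_one_ne_zero hrdvd (Nat.eq_zero_of_zero_dvd hd)
  have hD' : D = 1 - ∑ i ∈ sieveTail F r g h d H, (sieveNorm (sieveElt i) : ℝ)⁻¹ := by
    rw [hD, sieveTail, Finset.sum_disjSum, Finset.sum_disjSum]
    simp [sieveNorm, sieveElt, sub_sub, add_assoc]
  have hS' : S = ((sieveTail F r g h d H).card - 1) / D + 2 := by
    rw [hS, sieveTail, Finset.card_disjSum, Finset.card_disjSum]
    push_cast
    ring
  have hS0 : 0 ≤ S := by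
    rcases Finset.eq_empty_or_nonempty (sieveTail F r g h d H) with ht | ht
    · rw [ht, Finset.sum_empty, sub_zero] at hD'
      rw [hS', ht, hD']
      norm_num
    · have : (1 : ℝ) ≤ (sieveTail F r g h d H).card := by exact_mod_cast ht.card_pos
      rw [hS']
      have := div_nonneg (sub_nonneg.2 this) hDpos.le
      linarith
  have hmem := @mem_sieveCore_or_mem_sieveTail_iff Fq F _ _ _ _ r g h d H hrdvd hgm hgdvd
  obtain ⟨β, h1, h2⟩ := exists_sievePoint hgdvd (sieveCore F r g h d H) (sieveTail F r g h d H)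
    (disjoint_sieveCore_sieveTail hrdvd hgdvd) (sieveExponent r g)
    (fun i hi => (hmem.1 hi).1)
    (fun i _ => sieveElt_pow_sieveExponent_dvd hrdvd hgm.ne_zero hgdvd i)
    (fun i hi => ⟨sieveExponent_eq_zero_of_mem_sieveTail hrdvd hgdvd hi,
      (hmem.1 (Or.inr hi)).2⟩)
    hD' hDpos
    (by
      have hw := prod_sieveWeight_sieveCore_le (F := F) hr.ne' hrdvd hgm hgdvd hhm.ne_zero hd0
        hHm.ne_zero
      rw [← hS', ← hcardF, Nat.cast_pow]
      refine two_mul_sqrt_mul_le hq0 hS0 hw ?_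
      have hϑ : g.natDegree + (g.natDegree +
          if Nat.gcd (Fintype.card Fq) (Module.finrank Fq F) = 1 then 0 else g.natDegree) =
          if Nat.gcd (Fintype.card Fq) (Module.finrank Fq F) = 1 then 2 * k else 3 * k := by
        split_ifs <;> omega
      rw [hϑ]
      exact (le_of_eq (by ring)).trans (le_of_lt hineq))
  refine Ncnt_pos_of_sievePoint hr.ne' hrdvd hgm hgdvd β (fun i hi => ?_) fun i hi hdvd => ?_
  · by_cases hb : sieveExponent r g i = 0
    · rw [hb, pow_zero]
      exact ⟨_, DFunLike.congr_fun (map_one (sieveAct Fq F)) _⟩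
    · have hdvd := (dvd_pow_self _ hb).trans
        (sieveElt_pow_sieveExponent_dvd hrdvd hgm.ne_zero hgdvd i)
      refine h1 i ((hmem.2 ⟨hi, hdvd⟩).resolve_right fun ht => hb ?_)
      exact sieveExponent_eq_zero_of_mem_sieveTail hrdvd hgdvd ht
  · exact h2 i (hmem.2 ⟨hi, (dvd_pow_self _ (Nat.succ_ne_zero _)).trans hdvd⟩) hdvd

end
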